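/- arXiv:1805.02554 — 3 statements merged into one kernel-verified Lean document; each statement's English description precedes it below -/
import Mathlib

section
/- Let κ and λ be cardinals with 3 ≤ κ and 3 ≤ λ. Let F be a lattice freely generated by a family x : ι → F with #ι = λ, and let G be a lattice freely generated by a family y : ρ → G with #ρ = κ. Then there exists an injective lattice homomorphism φ : G → F whose range is selfdually positioned in F if and only if max κ ℵ₀ ≤ max λ ℵ₀. -/
open Cardinal

universe u

/-- A lattice `F` is freely generated by the family `x : ι → F` if the sublattice generated by
the range of `x` is all of `F` and every map from the generators into a lattice extends to a
lattice homomorphism. -/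
def IsFreelyGenerated {F : Type*} [Lattice F] {ι : Type*} (x : ι → F) : Prop :=
  latticeClosure (Set.range x) = Set.univ ∧
    ∀ (K : Type*) [Lattice K] (f : ι → K), ∃ φ : LatticeHom F K, ∀ i, φ (x i) = f i

/-- The image of `t` under a dual automorphism `δ : F ≃o Fᵒᵈ`, viewed back in `F`. -/
def dBar {F : Type*} [Lattice F] (δ : F ≃o Fᵒᵈ) (t : F) : F := OrderDual.ofDual (δ t)

/-- A subset `S` of `F` is selfdually positioned (w.r.t. the dual automorphism `δ`)
if `δ '' S = S`. -/
def SelfduallyPositioned {F : Type*} [Lattice F] (δ : F ≃o Fᵒᵈ) (S : Set F) : Prop :=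
  dBar δ '' S = S

namespace SDP

/-- Lattice terms. -/
inductive T (α : Type*) : Type _
  | var : α → T α
  | sup : T α → T α → T α
  | inf : T α → T α → T α

namespace T

def ev {α : Type*} {L : Type*} [Lattice L] (f : α → L) : T α → L
  | var i => f i
  | sup s t => ev f s ⊔ ev f t
  | inf s t => ev f s ⊓ ev f t

def map {α β : Type*} (e : α → β) : T α → T β
  | var i => var (e i)
  | sup s t => sup (map e s) (map e t)
  | inf s t => inf (map e s) (map e t)

def dual {α : Type*} : T α → T α
  | var i => var i
  | sup s t => inf (dual s) (dual t)
  | inf s t => sup (dual s) (dual t)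

def vars {α : Type*} : T α → Set α
  | var i => {i}
  | sup s t => vars s ∪ vars t
  | inf s t => vars s ∪ vars t

theorem vars_finite {α : Type*} (t : T α) : (vars t).Finite := by
  induction t with
  | var i => exact Set.finite_singleton i
  | sup s t hs ht => exact hs.union ht
  | inf s t hs ht => exact hs.union ht

theorem map_map_of {α β : Type*} (e : α → β) (h : β → α) (t : T α)
    (H : ∀ i ∈ vars t, h (e i) = i) : map h (map e t) = t := by
  induction t with
  | var i => simp [map, H i (by simp [vars])]
  | sup s t hs ht =>
    simp only [map]
    rw [hs fun i hi => H i (Or.inl hi), ht fun i hi => H i (Or.inr hi)]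
  | inf s t hs ht =>
    simp only [map]
    rw [hs fun i hi => H i (Or.inl hi), ht fun i hi => H i (Or.inr hi)]

theorem ev_map {α β L : Type*} [Lattice L] (e : α → β) (f : β → L) (t : T α) :
    ev f (map e t) = ev (f ∘ e) t := by
  induction t with
  | var i => rfl
  | sup s t hs ht => simp only [map, ev, hs, ht]
  | inf s t hs ht => simp only [map, ev, hs, ht]

theorem hom_ev {α L K : Type*} [Lattice L] [Lattice K] (φ : LatticeHom L K) (f : α → L)
    (t : T α) : φ (ev f t) = ev (φ ∘ f) t := by
  induction t with
  | var i => rfl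
  | sup s t hs ht => simp only [ev, map_sup, hs, ht]
  | inf s t hs ht => simp only [ev, map_inf, hs, ht]

end T

open T

/-- Whitman's derivation rules. -/
inductive W {α : Type*} : T α → T α → Prop
  | var (i : α) : W (var i) (var i)
  | supL {s s' t} : W s t → W s' t → W (sup s s') t
  | infR {s t t'} : W s t → W s t' → W s (inf t t')
  | supR1 {s t t'} : W s t → W s (sup t t')
  | supR2 {s t t'} : W s t' → W s (sup t t')
  | infL1 {s s' t} : W s t → W (inf s s') t
  | infL2 {s s' t} : W s' t → W (inf s s') t

namespace W

theorem refl {α : Type*} (t : T α) : W t t := by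
  induction t with
  | var i => exact .var i
  | sup s t hs ht => exact .supL (.supR1 hs) (.supR2 ht)
  | inf s t hs ht => exact .infR (.infL1 hs) (.infL2 ht)

theorem sup_inv {α : Type*} {s s' t : T α} (h : W (sup s s') t) : W s t ∧ W s' t := by
  generalize hu : sup s s' = u at h
  induction h with
  | var i => cases hu
  | supL h1 h2 _ _ => cases hu; exact ⟨h1, h2⟩
  | infR h1 h2 i1 i2 => exact ⟨.infR (i1 hu).1 (i2 hu).1, .infR (i1 hu).2 (i2 hu).2⟩
  | supR1 h i => exact ⟨.supR1 (i hu).1, .supR1 (i hu).2⟩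
  | supR2 h i => exact ⟨.supR2 (i hu).1, .supR2 (i hu).2⟩
  | infL1 h i => cases hu
  | infL2 h i => cases hu

theorem inf_inv {α : Type*} {s t t' : T α} (h : W s (inf t t')) : W s t ∧ W s t' := by
  generalize hu : inf t t' = u at h
  induction h with
  | var i => cases hu
  | infR h1 h2 _ _ => cases hu; exact ⟨h1, h2⟩
  | supL h1 h2 i1 i2 => exact ⟨.supL (i1 hu).1 (i2 hu).1, .supL (i1 hu).2 (i2 hu).2⟩
  | infL1 h i => exact ⟨.infL1 (i hu).1, .infL1 (i hu).2⟩
  | infL2 h i => exact ⟨.infL2 (i hu).1, .infL2 (i hu).2⟩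
  | supR1 h i => cases hu
  | supR2 h i => cases hu

theorem trans {α : Type*} {s t r : T α} (h : W s t) (h' : W t r) : W s r := by
  induction t generalizing s r with
  | var i =>
    generalize hu : T.var i = u at h
    induction h with
    | var j => rw [← hu]; exact h'
    | supL _ _ i1 i2 => exact .supL (i1 hu) (i2 hu)
    | infR => cases hu
    | supR1 => cases hu
    | supR2 => cases hu
    | infL1 _ i => exact .infL1 (i hu)
    | infL2 _ i => exact .infL2 (i hu)
  | sup t1 t2 c1 c2 =>
    obtain ⟨k1, k2⟩ := sup_inv h'
    generalize hu : T.sup t1 t2 = u at h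
    induction h with
    | var j => cases hu
    | supL _ _ i1 i2 => exact .supL (i1 hu) (i2 hu)
    | infR => cases hu
    | supR1 a => cases hu; exact c1 a k1
    | supR2 a => cases hu; exact c2 a k2
    | infL1 _ i => exact .infL1 (i hu)
    | infL2 _ i => exact .infL2 (i hu)
  | inf t1 t2 c1 c2 =>
    obtain ⟨k1, k2⟩ := inf_inv h
    generalize hu : T.inf t1 t2 = u at h'
    induction h' with
    | var j => cases hu
    | supL => cases hu
    | infR _ _ i1 i2 => exact .infR (i1 hu) (i2 hu)
    | supR1 _ i => exact .supR1 (i hu)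
    | supR2 _ i => exact .supR2 (i hu)
    | infL1 a => cases hu; exact c1 k1 a
    | infL2 a => cases hu; exact c2 k2 a

theorem sound {α L : Type*} [Lattice L] (f : α → L) {s t : T α} (h : W s t) :
    ev f s ≤ ev f t := by
  induction h with
  | var i => exact le_rfl
  | supL _ _ i1 i2 => exact sup_le i1 i2
  | infR _ _ i1 i2 => exact le_inf i1 i2
  | supR1 _ i => exact i.trans le_sup_left
  | supR2 _ i => exact i.trans le_sup_right
  | infL1 _ i => exact inf_le_left.trans i
  | infL2 _ i => exact inf_le_right.trans i

theorem map {α β : Type*} (e : α → β) {s t : T α} (h : W s t) : W (T.map e s) (T.map e t) := by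
  induction h with
  | var i => exact .var _
  | supL _ _ i1 i2 => exact .supL i1 i2
  | infR _ _ i1 i2 => exact .infR i1 i2
  | supR1 _ i => exact .supR1 i
  | supR2 _ i => exact .supR2 i
  | infL1 _ i => exact .infL1 i
  | infL2 _ i => exact .infL2 i

end W

instance wSetoid (α : Type*) : Setoid (T α) where
  r s t := W s t ∧ W t s
  iseqv := ⟨fun t => ⟨W.refl t, W.refl t⟩, fun h => ⟨h.2, h.1⟩,
    fun h k => ⟨h.1.trans k.1, k.2.trans h.2⟩⟩

/-- The free lattice as a quotient of the terms. -/
def FL (α : Type*) : Type _ := Quotient (wSetoid α)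

instance (α : Type*) : Lattice (FL α) where
  le := Quotient.lift₂ (fun s t => W s t) (by
    rintro a b c d ⟨h1, h2⟩ ⟨h3, h4⟩
    exact propext ⟨fun h => h2.trans (h.trans h3), fun h => h1.trans (h.trans h4)⟩)
  le_refl := by rintro ⟨a⟩; exact W.refl a
  le_trans := by rintro ⟨a⟩ ⟨b⟩ ⟨c⟩ h k; exact W.trans h k
  le_antisymm := by rintro ⟨a⟩ ⟨b⟩ h k; exact Quotient.sound ⟨h, k⟩
  sup := Quotient.map₂ T.sup (by
    rintro a b ⟨h1, h2⟩ c d ⟨h3, h4⟩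
    exact ⟨.supL (.supR1 h1) (.supR2 h3), .supL (.supR1 h2) (.supR2 h4)⟩)
  inf := Quotient.map₂ T.inf (by
    rintro a b ⟨h1, h2⟩ c d ⟨h3, h4⟩
    exact ⟨.infR (.infL1 h1) (.infL2 h3), .infR (.infL1 h2) (.infL2 h4)⟩)
  le_sup_left := by rintro ⟨a⟩ ⟨b⟩; exact W.supR1 (W.refl a)
  le_sup_right := by rintro ⟨a⟩ ⟨b⟩; exact W.supR2 (W.refl b)
  sup_le := by rintro ⟨a⟩ ⟨b⟩ ⟨c⟩ h k; exact W.supL h k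
  inf_le_left := by rintro ⟨a⟩ ⟨b⟩; exact W.infL1 (W.refl a)
  inf_le_right := by rintro ⟨a⟩ ⟨b⟩; exact W.infL2 (W.refl b)
  le_inf := by rintro ⟨a⟩ ⟨b⟩ ⟨c⟩ h k; exact W.infR h k

def FL.mk {α : Type*} (t : T α) : FL α := Quotient.mk _ t

theorem FL.mk_le {α : Type*} {s t : T α} : FL.mk s ≤ FL.mk t ↔ W s t := Iff.rfl

theorem FL.ev_mk {α β : Type*} (g : α → β) (t : T α) :
    ev (fun i => FL.mk (T.var (g i))) t = FL.mk (T.map g t) := by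
  induction t with
  | var i => rfl
  | sup s t hs ht => simp only [ev, hs, ht]; rfl
  | inf s t hs ht => simp only [ev, hs, ht]; rfl

section free
variable {F : Type*} [Lattice F] {ι : Type*} {x : ι → F}

theorem ev_surj (hx : latticeClosure (Set.range x) = Set.univ) (a : F) : ∃ t, ev x t = a := by
  let S : Sublattice F :=
    { carrier := Set.range (ev x)
      supClosed' := by rintro _ ⟨s, rfl⟩ _ ⟨t, rfl⟩; exact ⟨.sup s t, rfl⟩
      infClosed' := by rintro _ ⟨s, rfl⟩ _ ⟨t, rfl⟩; exact ⟨.inf s t, rfl⟩ }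
  have h : latticeClosure (Set.range x) ⊆ Set.range (ev x) :=
    latticeClosure_min (by rintro _ ⟨i, rfl⟩; exact ⟨.var i, rfl⟩) S.isSublattice
  rw [hx] at h
  exact h (Set.mem_univ a)

theorem key (hx : IsFreelyGenerated x) {s t : T ι} (h : ev x s ≤ ev x t) : W s t := by
  classical
  have hfin : (vars s ∪ vars t).Finite := (vars_finite s).union (vars_finite t)
  by_cases hne : Nonempty ι
  swap
  · exfalso
    have : ∀ t : T ι, False := fun t => by
      induction t with
      | var i => exact hne ⟨i⟩
      | sup _ _ h _ => exact h
      | inf _ _ h _ => exact h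
    exact this s
  have hc : (vars s ∪ vars t).Countable := hfin.countable
  obtain ⟨g, hg⟩ := Set.countable_iff_exists_injOn.1 hc
  let g' : ι → ULift ℕ := fun i => ⟨g i⟩
  have hg' : Set.InjOn g' (vars s ∪ vars t) := fun a ha b hb hab =>
    hg ha hb (congrArg ULift.down hab)
  let k := Function.invFunOn g' (vars s ∪ vars t)
  have hk : ∀ i ∈ vars s ∪ vars t, k (g' i) = i := fun i hi => hg'.leftInvOn_invFunOn hi
  obtain ⟨φ, hφ⟩ := hx.2 (FL (ULift ℕ)) (fun i => FL.mk (T.var (g' i)))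
  have h2 : φ (ev x s) ≤ φ (ev x t) := OrderHomClass.mono φ h
  have h3 : (φ ∘ x) = fun i => FL.mk (T.var (g' i)) := funext hφ
  rw [hom_ev, hom_ev, h3, FL.ev_mk, FL.ev_mk, FL.mk_le] at h2
  have h4 := h2.map k
  rwa [map_map_of _ _ _ fun i hi => hk i (Or.inl hi),
    map_map_of _ _ _ fun i hi => hk i (Or.inr hi)] at h4

theorem exists_hom (hx : IsFreelyGenerated x) {K : Type*} [Lattice K] (f : ι → K) :
    ∃ φ : LatticeHom F K, ∀ t, φ (ev x t) = ev f t := by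
  choose r hr using ev_surj hx.1
  have H : ∀ s t, ev x s = ev x t → ev f s = ev f t := fun s t h =>
    le_antisymm ((key hx h.le).sound f) ((key hx h.ge).sound f)
  have H' : ∀ t, ev f (r (ev x t)) = ev f t := fun t => H _ _ (hr _)
  refine ⟨{ toFun := fun a => ev f (r a), map_sup' := ?_, map_inf' := ?_ }, H'⟩
  · intro a b
    exact H (r (a ⊔ b)) (.sup (r a) (r b)) (by simp only [ev, hr])
  · intro a b
    exact H (r (a ⊓ b)) (.inf (r a) (r b)) (by simp only [ev, hr])

/-- Whitman's condition. -/
def WC (L : Type*) [Lattice L] : Prop :=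
  ∀ a b c d : L, a ⊓ b ≤ c ⊔ d → a ≤ c ⊔ d ∨ b ≤ c ⊔ d ∨ a ⊓ b ≤ c ∨ a ⊓ b ≤ d

theorem WC.dual {L : Type*} [Lattice L] (h : WC L) : WC Lᵒᵈ := fun a b c d hh => by
  have := h (OrderDual.ofDual c) (OrderDual.ofDual d) (OrderDual.ofDual a) (OrderDual.ofDual b) hh
  rcases this with h | h | h | h
  · exact Or.inr (Or.inr (Or.inl h))
  · exact Or.inr (Or.inr (Or.inr h))
  · exact Or.inl h
  · exact Or.inr (Or.inl h)

theorem wc_of_free (hx : IsFreelyGenerated x) : WC F := by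
  intro a b c d h
  obtain ⟨a, rfl⟩ := ev_surj hx.1 a
  obtain ⟨b, rfl⟩ := ev_surj hx.1 b
  obtain ⟨c, rfl⟩ := ev_surj hx.1 c
  obtain ⟨d, rfl⟩ := ev_surj hx.1 d
  have h' : W (T.inf a b) (T.sup c d) := key hx h
  cases h' with
  | supR1 h => exact Or.inr (Or.inr (Or.inl (h.sound x)))
  | supR2 h => exact Or.inr (Or.inr (Or.inr (h.sound x)))
  | infL1 h => exact Or.inl (h.sound x)
  | infL2 h => exact Or.inr (Or.inl (h.sound x))

end free

/-- Every member of the family is separated from the others by an ideal. -/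
def Sep {L J : Type*} [Lattice L] (f : J → L) : Prop :=
  ∀ j, ∃ D : Set L, IsLowerSet D ∧ SupClosed D ∧ (∀ k, k ≠ j → f k ∈ D) ∧ f j ∉ D

theorem var_le {L J : Type*} [Lattice L] {f : J → L} (h : Sep f) {j : J} {t : T J}
    (ht : f j ≤ ev f t) : W (T.var j) t := by
  obtain ⟨D, hl, hs, h1, h2⟩ := h j
  have : W (T.var j) t ∨ ev f t ∈ D := by
    clear ht
    induction t with
    | var i =>
      by_cases hi : i = j
      · subst hi; exact Or.inl (.var _)
      · exact Or.inr (h1 i hi)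
    | sup s t is it =>
      rcases is with h | h
      · exact Or.inl (.supR1 h)
      rcases it with k | k
      · exact Or.inl (.supR2 k)
      exact Or.inr (hs h k)
    | inf s t is it =>
      rcases is with h | h
      · rcases it with k | k
        · exact Or.inl (.infR h k)
        · exact Or.inr (hl inf_le_right k)
      · exact Or.inr (hl inf_le_left h)
  rcases this with h | h
  · exact h
  · exact absurd (hl ht h) h2

theorem le_var {L J : Type*} [Lattice L] {f : J → L}
    (h : Sep (fun j => OrderDual.toDual (f j))) {j : J} {t : T J}
    (ht : ev f t ≤ f j) : W t (T.var j) := by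
  obtain ⟨D, hl, hs, h1, h2⟩ := h j
  have : W t (T.var j) ∨ OrderDual.toDual (ev f t) ∈ D := by
    clear ht
    induction t with
    | var i =>
      by_cases hi : i = j
      · subst hi; exact Or.inl (.var _)
      · exact Or.inr (h1 i hi)
    | inf s t is it =>
      rcases is with h | h
      · exact Or.inl (.infL1 h)
      rcases it with k | k
      · exact Or.inl (.infL2 k)
      exact Or.inr (hs h k)
    | sup s t is it =>
      rcases is with h | h
      · rcases it with k | k
        · exact Or.inl (.supL h k)
        · refine Or.inr (hl (show _ ≤ _ from ?_) k)
          exact OrderDual.toDual_le_toDual.2 le_sup_right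
      · refine Or.inr (hl (show _ ≤ _ from ?_) h)
        exact OrderDual.toDual_le_toDual.2 le_sup_left
  rcases this with h | h
  · exact h
  · exact absurd (hl (OrderDual.toDual_le_toDual.2 ht) h) h2

theorem criterion {L J : Type*} [Lattice L] {f : J → L} (hW : WC L) (h : Sep f)
    (h' : Sep (fun j => OrderDual.toDual (f j))) (s t : T J) (hst : ev f s ≤ ev f t) : W s t := by
  induction s generalizing t with
  | var i => exact var_le h hst
  | sup s1 s2 i1 i2 =>
    exact .supL (i1 _ (le_sup_left.trans hst)) (i2 _ (le_sup_right.trans hst))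
  | inf s1 s2 i1 i2 =>
    induction t with
    | var j => exact le_var h' hst
    | inf t1 t2 j1 j2 =>
      exact .infR (j1 (le_trans hst inf_le_left)) (j2 (le_trans hst inf_le_right))
    | sup t1 t2 j1 j2 =>
      rcases hW _ _ _ _ hst with k | k | k | k
      · exact .infL1 (i1 (.sup t1 t2) k)
      · exact .infL2 (i2 (.sup t1 t2) k)
      · exact .supR1 (j1 k)
      · exact .supR2 (j2 k)

section core

/-- Ideals (possibly empty). -/
def IsId {L : Type*} [Lattice L] (D : Set L) : Prop :=
  (∀ a b : L, b ≤ a → a ∈ D → b ∈ D) ∧ ∀ a b : L, a ∈ D → b ∈ D → a ⊔ b ∈ D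

/-- Filters (possibly empty). -/
def IsFi {L : Type*} [Lattice L] (D : Set L) : Prop :=
  (∀ a b : L, a ≤ b → a ∈ D → b ∈ D) ∧ ∀ a b : L, a ∈ D → b ∈ D → a ⊓ b ∈ D

/-- The members `f k`, `k ∈ A`, and `x`, `y`, `z` are separated from each other by ideals. -/
structure LSep {L J : Type*} [Lattice L] (A : Set J) (f : J → L) (x y z : L) : Prop where
  hx : ∃ D : Set L, IsId D ∧ (∀ k ∈ A, f k ∈ D) ∧ y ∈ D ∧ z ∈ D ∧ x ∉ D
  hy : ∃ D : Set L, IsId D ∧ (∀ k ∈ A, f k ∈ D) ∧ x ∈ D ∧ z ∈ D ∧ y ∉ D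
  hz : ∃ D : Set L, IsId D ∧ (∀ k ∈ A, f k ∈ D) ∧ x ∈ D ∧ y ∈ D ∧ z ∉ D
  hA : ∀ j ∈ A, ∃ D : Set L, IsId D ∧ (∀ k ∈ A, k ≠ j → f k ∈ D) ∧ x ∈ D ∧ y ∈ D ∧ z ∈ D ∧ f j ∉ D

/-- The dual version of `LSep`. -/
structure USep {L J : Type*} [Lattice L] (A : Set J) (f : J → L) (x y z : L) : Prop where
  hx : ∃ D : Set L, IsFi D ∧ (∀ k ∈ A, f k ∈ D) ∧ y ∈ D ∧ z ∈ D ∧ x ∉ D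
  hy : ∃ D : Set L, IsFi D ∧ (∀ k ∈ A, f k ∈ D) ∧ x ∈ D ∧ z ∈ D ∧ y ∉ D
  hz : ∃ D : Set L, IsFi D ∧ (∀ k ∈ A, f k ∈ D) ∧ x ∈ D ∧ y ∈ D ∧ z ∉ D
  hA : ∀ j ∈ A, ∃ D : Set L, IsFi D ∧ (∀ k ∈ A, k ≠ j → f k ∈ D) ∧ x ∈ D ∧ y ∈ D ∧ z ∈ D ∧ f j ∉ D

variable {L J : Type*} [Lattice L]

theorem USep.dual {A : Set J} {f : J → L} {x y z : L} (h : USep A f x y z) :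
    LSep (L := Lᵒᵈ) A (fun j => OrderDual.toDual (f j)) (OrderDual.toDual x) (OrderDual.toDual y)
      (OrderDual.toDual z) := ⟨h.hx, h.hy, h.hz, h.hA⟩

theorem LSep.dual {A : Set J} {f : J → L} {x y z : L} (h : LSep A f x y z) :
    USep (L := Lᵒᵈ) A (fun j => OrderDual.toDual (f j)) (OrderDual.toDual x) (OrderDual.toDual y)
      (OrderDual.toDual z) := ⟨h.hx, h.hy, h.hz, h.hA⟩

theorem LSep.swap {A : Set J} {f : J → L} {x y z : L} (h : LSep A f x y z) :
    LSep A f x z y where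
  hx := by obtain ⟨D, a, b, c, d, e⟩ := h.hx; exact ⟨D, a, b, d, c, e⟩
  hy := h.hz
  hz := h.hy
  hA j hj := by obtain ⟨D, a, b, c, d, e, g⟩ := h.hA j hj; exact ⟨D, a, b, c, e, d, g⟩

theorem USep.swap {A : Set J} {f : J → L} {x y z : L} (h : USep A f x y z) :
    USep A f x z y where
  hx := by obtain ⟨D, a, b, c, d, e⟩ := h.hx; exact ⟨D, a, b, d, c, e⟩
  hy := h.hz
  hz := h.hy
  hA j hj := by obtain ⟨D, a, b, c, d, e, g⟩ := h.hA j hj; exact ⟨D, a, b, c, e, d, g⟩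

theorem IsId.infl {D : Set L} (h : IsId D) {a b : L} (ha : a ∈ D) : a ⊓ b ∈ D :=
  h.1 _ _ inf_le_left ha
theorem IsId.infr {D : Set L} (h : IsId D) {a b : L} (ha : b ∈ D) : a ⊓ b ∈ D :=
  h.1 _ _ inf_le_right ha
theorem IsId.sup {D : Set L} (h : IsId D) {a b : L} (ha : a ∈ D) (hb : b ∈ D) : a ⊔ b ∈ D :=
  h.2 _ _ ha hb
theorem IsFi.supl {D : Set L} (h : IsFi D) {a b : L} (ha : a ∈ D) : a ⊔ b ∈ D :=
  h.1 _ _ le_sup_left ha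
theorem IsFi.supr {D : Set L} (h : IsFi D) {a b : L} (ha : b ∈ D) : a ⊔ b ∈ D :=
  h.1 _ _ le_sup_right ha
theorem IsFi.inf {D : Set L} (h : IsFi D) {a b : L} (ha : a ∈ D) (hb : b ∈ D) : a ⊓ b ∈ D :=
  h.2 _ _ ha hb

/-- Finite joins of members of `S`. -/
inductive Gen (S : Set L) : L → Prop
  | mem {a} : a ∈ S → Gen S a
  | sup {a b} : Gen S a → Gen S b → Gen S (a ⊔ b)

theorem Gen.sub {S D : Set L} (hD : IsId D) (h : S ⊆ D) {a : L} (ha : Gen S a) : a ∈ D := by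
  induction ha with
  | mem h1 => exact h h1
  | sup _ _ i j => exact hD.sup i j

theorem sep_inf (hW : WC L) {S : Set L} {a b : L}
    (ha : ∃ D, IsId D ∧ S ⊆ D ∧ a ∉ D) (hb : ∃ D, IsId D ∧ S ⊆ D ∧ b ∉ D)
    (hS : ∀ s ∈ S, ¬ a ⊓ b ≤ s) : ∃ D, IsId D ∧ S ⊆ D ∧ a ⊓ b ∉ D := by
  obtain ⟨D1, i1, s1, n1⟩ := ha
  obtain ⟨D2, i2, s2, n2⟩ := hb
  refine ⟨{w | ∃ e, Gen S e ∧ w ≤ e}, ⟨?_, ?_⟩, ?_, ?_⟩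
  · rintro u v huv ⟨e, he, h⟩
    exact ⟨e, he, huv.trans h⟩
  · rintro u v ⟨e, he, h⟩ ⟨e', he', h'⟩
    exact ⟨_, he.sup he', sup_le_sup h h'⟩
  · exact fun s hs => ⟨s, .mem hs, le_rfl⟩
  · rintro ⟨e, he, h⟩
    induction he with
    | mem h1 => exact hS _ h1 h
    | @sup u v h1 h2 j1 j2 =>
      rcases hW _ _ _ _ h with k | k | k | k
      · exact n1 (i1.1 _ _ k ((h1.sup h2).sub i1 s1))
      · exact n2 (i2.1 _ _ k ((h1.sup h2).sub i2 s2))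
      · exact j1 k
      · exact j2 k

def U (x y z : L) : L := (z ⊓ (x ⊔ y)) ⊔ (y ⊓ (x ⊔ (y ⊓ z)))
def Uo (x y z : L) : L := (z ⊔ (x ⊓ y)) ⊓ (y ⊔ (x ⊓ (y ⊔ z)))

theorem IsId.U1 {D : Set L} (h : IsId D) {x y z : L} (hy : y ∈ D) (hz : z ∈ D) : U x y z ∈ D :=
  h.sup (h.infl hz) (h.infl hy)
theorem IsId.U2 {D : Set L} (h : IsId D) {x y z : L} (hx : x ∈ D) (hz : z ∈ D) : U x y z ∈ D :=
  h.sup (h.infl hz) (h.infr (h.sup hx (h.infr hz)))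
theorem IsId.U3 {D : Set L} (h : IsId D) {x y z : L} (hx : x ∈ D) (hy : y ∈ D) : U x y z ∈ D :=
  h.sup (h.infr (h.sup hx hy)) (h.infl hy)
theorem IsId.Uo1 {D : Set L} (h : IsId D) {x y z : L} (hy : y ∈ D) (hz : z ∈ D) : Uo x y z ∈ D :=
  h.infl (h.sup hz (h.infr hy))
theorem IsId.Uo2 {D : Set L} (h : IsId D) {x y z : L} (hx : x ∈ D) (hz : z ∈ D) : Uo x y z ∈ D :=
  h.infl (h.sup hz (h.infl hx))
theorem IsId.Uo3 {D : Set L} (h : IsId D) {x y z : L} (hx : x ∈ D) (hy : y ∈ D) : Uo x y z ∈ D :=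
  h.infr (h.sup hy (h.infl hx))
theorem IsFi.Uo1 {D : Set L} (h : IsFi D) {x y z : L} (hy : y ∈ D) (hz : z ∈ D) : Uo x y z ∈ D :=
  h.inf (h.supl hz) (h.supl hy)
theorem IsFi.Uo2 {D : Set L} (h : IsFi D) {x y z : L} (hx : x ∈ D) (hz : z ∈ D) : Uo x y z ∈ D :=
  h.inf (h.supl hz) (h.supr (h.inf hx (h.supr hz)))
theorem IsFi.Uo3 {D : Set L} (h : IsFi D) {x y z : L} (hx : x ∈ D) (hy : y ∈ D) : Uo x y z ∈ D :=
  h.inf (h.supr (h.inf hx hy)) (h.supl hy)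

theorem core1 (hW : WC L) {A : Set J} {f : J → L} {x y z : L} (h : LSep A f x y z)
    (h' : USep A f x y z) :
    ∃ D : Set L, IsId D ∧ (∀ k ∈ A, f k ∈ D) ∧ x ∈ D ∧ Uo x y z ∈ D ∧ U x z y ∈ D ∧
      Uo x z y ∈ D ∧ U x y z ∉ D := by
  obtain ⟨Dx, ix, Ax, yx, zx, nx⟩ := h.hx
  obtain ⟨Dy, iy, Ay, xy, zy, ny⟩ := h.hy
  obtain ⟨Dz, iz, Az, xz, yz, nz⟩ := h.hz
  obtain ⟨Fx, jx, -, fyx, fzx, mx⟩ := h'.hx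
  obtain ⟨Fy, jy, -, fxy, fzy, my⟩ := h'.hy
  have qx : ¬ z ⊓ (x ⊔ y) ≤ x := fun k => mx (jx.1 _ _ k (jx.inf fzx (jx.supr fyx)))
  have qy : ¬ z ⊓ (x ⊔ y) ≤ y := fun k => my (jy.1 _ _ k (jy.inf fzy (jy.supl fxy)))
  have key : ∃ D, IsId D ∧ (f '' A ∪ {x, Uo x y z, U x z y, Uo x z y}) ⊆ D ∧
      z ⊓ (x ⊔ y) ∉ D := by
    refine sep_inf hW ⟨Dz, iz, ?_, nz⟩ ⟨Dy, iy, ?_, fun k => ny (iy.1 _ _ le_sup_right k)⟩ ?_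
    · rintro w (⟨k, hk, rfl⟩ | rfl | rfl | rfl | rfl)
      · exact Az k hk
      · exact xz
      · exact iz.Uo3 xz yz
      · exact iz.U2 xz yz
      · exact iz.Uo2 xz yz
    · rintro w (⟨k, hk, rfl⟩ | rfl | rfl | rfl | rfl)
      · exact Ay k hk
      · exact xy
      · exact iy.Uo2 xy zy
      · exact iy.U3 xy zy
      · exact iy.Uo3 xy zy
    · rintro w (⟨k, hk, rfl⟩ | rfl | rfl | rfl | rfl) hle
      · obtain ⟨D, i, -, a, b, c, n⟩ := h'.hA k hk
        exact n (i.1 _ _ hle (i.inf c (i.supl a)))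
      · exact qx hle
      · -- below `y ⊔ x ⊓ (y ⊔ z)`
        have hle := hle.trans inf_le_right
        rcases hW _ _ _ _ hle with k | k | k | k
        · exact nz (iz.1 _ _ k (iz.sup yz (iz.infl xz)))
        · exact nx (ix.1 _ _ (le_sup_left.trans k) (ix.sup yx (ix.infr (ix.sup yx zx))))
        · exact qy k
        · exact qx (k.trans inf_le_left)
      · -- below `U x z y`
        rcases hW _ _ _ _ hle with k | k | k | k
        · exact nz (iz.1 _ _ k (iz.U2 xz yz))
        · exact ny (iy.1 _ _ (le_sup_right.trans k) (iy.U3 xy zy))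
        · exact qy (k.trans inf_le_left)
        · have k := k.trans inf_le_right
          rcases hW _ _ _ _ k with k | k | k | k
          · exact nz (iz.1 _ _ k (iz.sup xz (iz.infr yz)))
          · exact ny (iy.1 _ _ (le_sup_right.trans k) (iy.sup xy (iy.infl zy)))
          · exact qx k
          · exact qy (k.trans inf_le_right)
      · -- below `y ⊔ x ⊓ z`
        have hle := hle.trans inf_le_left
        rcases hW _ _ _ _ hle with k | k | k | k
        · exact nz (iz.1 _ _ k (iz.sup yz (iz.infl xz)))
        · exact nx (ix.1 _ _ (le_sup_left.trans k) (ix.sup yx (ix.infr zx)))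
        · exact qy k
        · exact qx (k.trans inf_le_left)
  obtain ⟨D, i, s, n⟩ := key
  refine ⟨D, i, fun k hk => s (Or.inl ⟨k, hk, rfl⟩), s (by simp), s (by simp), s (by simp),
    s (by simp), fun k => n (i.1 _ _ le_sup_left k)⟩

theorem core2 (hW : WC L) {A : Set J} {f : J → L} {x y z : L} (h : LSep A f x y z)
    (h' : USep A f x y z) :
    ∃ D : Set L, IsId D ∧ (∀ k ∈ A, f k ∈ D) ∧ x ∈ D ∧ U x y z ∈ D ∧ U x z y ∈ D ∧
      Uo x z y ∈ D ∧ Uo x y z ∉ D := by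
  obtain ⟨Dx, ix, Ax, yx, zx, nx⟩ := h.hx
  obtain ⟨Dy, iy, Ay, xy, zy, ny⟩ := h.hy
  obtain ⟨Dz, iz, Az, xz, yz, nz⟩ := h.hz
  obtain ⟨Fx, jx, -, fyx, fzx, mx⟩ := h'.hx
  obtain ⟨Fy, jy, -, fxy, fzy, my⟩ := h'.hy
  obtain ⟨Fz, jz, -, fxz, fyz, mz⟩ := h'.hz
  have qx : ¬ Uo x y z ≤ x := fun k => mx (jx.1 _ _ k (jx.Uo1 fyx fzx))
  have qy : ¬ Uo x y z ≤ y := fun k => my (jy.1 _ _ k (jy.Uo2 fxy fzy))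
  have qz : ¬ Uo x y z ≤ z := fun k => mz (jz.1 _ _ k (jz.Uo3 fxz fyz))
  have key : ∃ D, IsId D ∧ (f '' A ∪ {x, U x y z, U x z y, Uo x z y}) ⊆ D ∧
      (z ⊔ (x ⊓ y)) ⊓ (y ⊔ (x ⊓ (y ⊔ z))) ∉ D := by
    refine sep_inf hW ⟨Dz, iz, ?_, fun k => nz (iz.1 _ _ le_sup_left k)⟩
      ⟨Dy, iy, ?_, fun k => ny (iy.1 _ _ le_sup_left k)⟩ ?_
    · rintro w (⟨k, hk, rfl⟩ | rfl | rfl | rfl | rfl)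
      · exact Az k hk
      · exact xz
      · exact iz.U3 xz yz
      · exact iz.U2 xz yz
      · exact iz.Uo2 xz yz
    · rintro w (⟨k, hk, rfl⟩ | rfl | rfl | rfl | rfl)
      · exact Ay k hk
      · exact xy
      · exact iy.U2 xy zy
      · exact iy.U3 xy zy
      · exact iy.Uo3 xy zy
    · rintro w (⟨k, hk, rfl⟩ | rfl | rfl | rfl | rfl) hle
      · obtain ⟨D, i, -, a, b, c, n⟩ := h'.hA k hk
        exact n (i.1 _ _ hle (i.Uo1 b c))
      · exact qx hle
      · rcases hW _ _ _ _ hle with k | k | k | k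
        · exact nz (iz.1 _ _ (le_sup_left.trans k) (iz.U3 xz yz))
        · exact ny (iy.1 _ _ (le_sup_left.trans k) (iy.U2 xy zy))
        · exact qz (k.trans inf_le_left)
        · exact qy (k.trans inf_le_left)
      · rcases hW _ _ _ _ hle with k | k | k | k
        · exact nz (iz.1 _ _ (le_sup_left.trans k) (iz.U2 xz yz))
        · exact ny (iy.1 _ _ (le_sup_left.trans k) (iy.U3 xy zy))
        · exact qy (k.trans inf_le_left)
        · exact qz (k.trans inf_le_left)
      · have hle := hle.trans inf_le_left
        rcases hW _ _ _ _ hle with k | k | k | k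
        · exact nz (iz.1 _ _ (le_sup_left.trans k) (iz.sup yz (iz.infl xz)))
        · have k := le_sup_right.trans k
          rcases hW _ _ _ _ k with k | k | k | k
          · exact nx (ix.1 _ _ k (ix.sup yx (ix.infr zx)))
          · exact nz (iz.1 _ _ (le_sup_right.trans k) (iz.sup yz (iz.infl xz)))
          · exact my (jy.1 _ _ k (jy.inf fxy (jy.supr fzy)))
          · exact mz (jz.1 _ _ (k.trans inf_le_right) (jz.inf fxz (jz.supl fyz)))
        · exact qy k
        · exact qx (k.trans inf_le_left)
  obtain ⟨D, i, s, n⟩ := key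
  exact ⟨D, i, fun k hk => s (Or.inl ⟨k, hk, rfl⟩), s (by simp), s (by simp), s (by simp),
    s (by simp), n⟩

/-- One step, first form (for a dual automorphism fixing `y` and `z`). -/
theorem stepA (hW : WC L) {A : Set J} {f : J → L} {x y z : L} (h : LSep A f x y z)
    (h' : USep A f x y z) : LSep A f x (U x z y) (Uo x z y) where
  hx := by
    obtain ⟨D, i, a, hy, hz, n⟩ := h.hx
    exact ⟨D, i, a, i.U1 hz hy, i.Uo1 hz hy, n⟩
  hy := by
    obtain ⟨D, i, a, b, c, d, e, n⟩ := core1 hW h.swap h'.swap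
    exact ⟨D, i, a, b, c, n⟩
  hz := by
    obtain ⟨D, i, a, b, c, d, e, n⟩ := core2 hW h.swap h'.swap
    exact ⟨D, i, a, b, c, n⟩
  hA j hj := by
    obtain ⟨D, i, a, hx, hy, hz, n⟩ := h.hA j hj
    exact ⟨D, i, a, hx, i.U1 hz hy, i.Uo1 hz hy, n⟩

/-- One step, second form (for a dual automorphism swapping `y` and `z`). -/
theorem stepB (hW : WC L) {A : Set J} {f : J → L} {x y z : L} (h : LSep A f x y z)
    (h' : USep A f x y z) {a b : J} (hfa : f a = U x y z) (hfb : f b = Uo x z y) :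
    LSep (insert a (insert b A)) f x (U x z y) (Uo x y z) where
  hx := by
    obtain ⟨D, i, c, hy, hz, n⟩ := h.hx
    refine ⟨D, i, ?_, i.U1 hz hy, i.Uo1 hy hz, n⟩
    rintro k (rfl | rfl | hk)
    · rw [hfa]; exact i.U1 hy hz
    · rw [hfb]; exact i.Uo1 hz hy
    · exact c k hk
  hy := by
    obtain ⟨D, i, c, d, e, g, o, n⟩ := core1 hW h.swap h'.swap
    refine ⟨D, i, ?_, d, o, n⟩
    rintro k (rfl | rfl | hk)
    · rwa [hfa]
    · rwa [hfb]
    · exact c k hk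
  hz := by
    obtain ⟨D, i, c, d, e, g, o, n⟩ := core2 hW h h'
    refine ⟨D, i, ?_, d, g, n⟩
    rintro k (rfl | rfl | hk)
    · rwa [hfa]
    · rwa [hfb]
    · exact c k hk
  hA j hj := by
    by_cases hja : j = a
    · subst hja
      obtain ⟨D, i, c, d, e, g, o, n⟩ := core1 hW h h'
      refine ⟨D, i, ?_, d, g, e, by rwa [hfa]⟩
      rintro k (rfl | rfl | hk) hkj
      · exact absurd rfl hkj
      · rwa [hfb]
      · exact c k hk
    by_cases hjb : j = b
    · subst hjb
      obtain ⟨D, i, c, d, e, g, o, n⟩ := core2 hW h.swap h'.swap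
      refine ⟨D, i, ?_, d, e, o, by rwa [hfb]⟩
      rintro k (rfl | rfl | hk) hkj
      · rwa [hfa]
      · exact absurd rfl hkj
      · exact c k hk
    obtain ⟨D, i, c, hx, hy, hz, n⟩ := h.hA j (by simpa [hja, hjb] using hj)
    refine ⟨D, i, ?_, hx, i.U1 hz hy, i.Uo1 hy hz, n⟩
    rintro k (rfl | rfl | hk) hkj
    · rw [hfa]; exact i.U1 hy hz
    · rw [hfb]; exact i.Uo1 hz hy
    · exact c k hk hkj

theorem stepA' (hW : WC L) {A : Set J} {f : J → L} {x y z : L} (h : LSep A f x y z)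
    (h' : USep A f x y z) : USep A f x (U x z y) (Uo x z y) := by
  have := (stepA hW.dual h'.dual h.dual).dual
  have t : USep A f x (Uo x z y) (U x z y) := ⟨this.hx, this.hy, this.hz, this.hA⟩
  exact t.swap

theorem stepB' (hW : WC L) {A : Set J} {f : J → L} {x y z : L} (h : LSep A f x y z)
    (h' : USep A f x y z) {a b : J} (hfa : f a = U x y z) (hfb : f b = Uo x z y) :
    USep (insert a (insert b A)) f x (U x z y) (Uo x y z) := by
  have := (stepB hW.dual h'.dual.swap h.dual.swap (a := b) (b := a) hfb hfa).dual
  have t : USep (insert b (insert a A)) f x (Uo x y z) (U x z y) :=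
    ⟨this.hx, this.hy, this.hz, this.hA⟩
  rw [Set.insert_comm]
  exact t.swap

/-- The sequence of pairs. -/
def pq (x y z : L) : ℕ → L × L
  | 0 => (U x z y, Uo x z y)
  | n + 1 => (U x (pq x y z n).2 (pq x y z n).1, Uo x (pq x y z n).1 (pq x y z n).2)

def fam (x y z : L) : ℤ → L
  | .ofNat 0 => x
  | .ofNat (n + 1) => U x (pq x y z n).1 (pq x y z n).2
  | .negSucc n => Uo x (pq x y z n).2 (pq x y z n).1

def idx (n : ℕ) : Set ℤ := {k | k ≠ 0 ∧ k.natAbs ≤ n}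

theorem idx_succ (n : ℕ) : idx (n + 1) = insert ((n : ℤ) + 1) (insert (Int.negSucc n) (idx n)) := by
  ext k
  simp only [idx, Set.mem_ofPred_eq, Set.mem_insert_iff]
  omega

theorem sep_pq (hW : WC L) {x y z : L} (h : LSep (∅ : Set ℤ) (fam x y z) x y z)
    (h' : USep (∅ : Set ℤ) (fam x y z) x y z) (n : ℕ) :
    LSep (idx n) (fam x y z) x (pq x y z n).1 (pq x y z n).2 ∧
    USep (idx n) (fam x y z) x (pq x y z n).1 (pq x y z n).2 := by
  induction n with
  | zero =>
    have : idx 0 = ∅ := by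
      ext k
      simp only [idx, Set.mem_ofPred_eq, Set.mem_empty_iff_false, iff_false]
      omega
    rw [this]
    exact ⟨stepA hW h h', stepA' hW h h'⟩
  | succ n ih =>
    rw [idx_succ]
    exact ⟨stepB hW ih.1 ih.2 rfl rfl, stepB' hW ih.1 ih.2 rfl rfl⟩

theorem fam_mem {x y z : L} {S : Set L} (hU : ∀ a ∈ S, ∀ b ∈ S, U x a b ∈ S ∧ Uo x a b ∈ S)
    (hx : x ∈ S) {n : ℕ} (h1 : (pq x y z n).1 ∈ S) (h2 : (pq x y z n).2 ∈ S) (k : ℤ)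
    (hk : k ∉ idx n) : fam x y z k ∈ S := by
  have hm : ∀ m, (pq x y z (n + m)).1 ∈ S ∧ (pq x y z (n + m)).2 ∈ S := by
    intro m
    induction m with
    | zero => exact ⟨h1, h2⟩
    | succ m ih => exact ⟨(hU _ ih.2 _ ih.1).1, (hU _ ih.1 _ ih.2).2⟩
  rcases k with (_ | k) | k
  · exact hx
  · have : n ≤ k := by
      by_contra hlt
      exact hk ⟨by simp; omega, by simp; omega⟩
    obtain ⟨m, rfl⟩ := Nat.exists_eq_add_of_le this
    exact (hU _ (hm m).1 _ (hm m).2).1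
  · have : n ≤ k := by
      by_contra hlt
      exact hk ⟨by simp, by simp; omega⟩
    obtain ⟨m, rfl⟩ := Nat.exists_eq_add_of_le this
    exact (hU _ (hm m).2 _ (hm m).1).2

theorem fam_sep (hW : WC L) {x y z : L} (h : LSep (∅ : Set ℤ) (fam x y z) x y z)
    (h' : USep (∅ : Set ℤ) (fam x y z) x y z) : Sep (fam x y z) := by
  intro j
  by_cases hj : j = 0
  · subst hj
    obtain ⟨D, i, -, hy, hz, n⟩ := (sep_pq hW h h' 0).1.hx
    refine ⟨D, fun a b => i.1 a b, fun a ha b hb => i.sup ha hb, ?_, n⟩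
    intro k hk
    have hm : ∀ m, (pq x y z m).1 ∈ D ∧ (pq x y z m).2 ∈ D := by
      intro m
      induction m with
      | zero => exact ⟨hy, hz⟩
      | succ m ih => exact ⟨i.U1 ih.2 ih.1, i.Uo1 ih.1 ih.2⟩
    rcases k with (_ | k) | k
    · exact absurd rfl hk
    · exact i.U1 (hm k).1 (hm k).2
    · exact i.Uo1 (hm k).2 (hm k).1
  · obtain ⟨D, i, hA, hx, hy, hz, n⟩ := (sep_pq hW h h' j.natAbs).1.hA j ⟨hj, le_rfl⟩
    refine ⟨D, fun a b => i.1 a b, fun a ha b hb => i.sup ha hb, ?_, n⟩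
    intro k hk
    by_cases hki : k ∈ idx j.natAbs
    · exact hA k hki hk
    · exact fam_mem (fun a ha b hb => ⟨i.U1 ha hb, i.Uo1 ha hb⟩) hx hy hz k hki

theorem IsFi.U1 {D : Set L} (h : IsFi D) {x y z : L} (hy : y ∈ D) (hz : z ∈ D) : U x y z ∈ D :=
  h.supl (h.inf hz (h.supr hy))

theorem fam_sep' (hW : WC L) {x y z : L} (h : LSep (∅ : Set ℤ) (fam x y z) x y z)
    (h' : USep (∅ : Set ℤ) (fam x y z) x y z) :
    Sep (fun j => OrderDual.toDual (fam x y z j)) := by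
  intro j
  by_cases hj : j = 0
  · subst hj
    obtain ⟨D, i, -, hy, hz, n⟩ := (sep_pq hW h h' 0).2.hx
    refine ⟨D, fun a b => i.1 a b, fun a ha b hb => i.inf ha hb, ?_, n⟩
    intro k hk
    have hm : ∀ m, (pq x y z m).1 ∈ D ∧ (pq x y z m).2 ∈ D := by
      intro m
      induction m with
      | zero => exact ⟨hy, hz⟩
      | succ m ih => exact ⟨i.U1 ih.2 ih.1, i.Uo1 ih.1 ih.2⟩
    rcases k with (_ | k) | k
    · exact absurd rfl hk
    · exact i.U1 (hm k).1 (hm k).2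
    · exact i.Uo1 (hm k).2 (hm k).1
  · obtain ⟨D, i, hA, hx, hy, hz, n⟩ := (sep_pq hW h h' j.natAbs).2.hA j ⟨hj, le_rfl⟩
    refine ⟨D, fun a b => i.1 a b, fun a ha b hb => i.inf ha hb, ?_, n⟩
    intro k hk
    by_cases hki : k ∈ idx j.natAbs
    · exact hA k hki hk
    · exact fam_mem (S := D) (fun a ha b hb => ⟨i.U1 ha hb, i.Uo1 ha hb⟩) hx hy hz k hki

end core

section final
variable {F : Type*} [Lattice F]

theorem dBar_sup (δ : F ≃o Fᵒᵈ) (a b : F) : dBar δ (a ⊔ b) = dBar δ a ⊓ dBar δ b := by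
  simp only [dBar, map_sup]; rfl

theorem dBar_inf (δ : F ≃o Fᵒᵈ) (a b : F) : dBar δ (a ⊓ b) = dBar δ a ⊔ dBar δ b := by
  simp only [dBar, map_inf]; rfl

theorem dBar_ev {α : Type*} (δ : F ≃o Fᵒᵈ) (f : α → F) (t : T α) :
    dBar δ (ev f t) = ev (fun i => dBar δ (f i)) (T.dual t) := by
  induction t with
  | var i => rfl
  | sup s t hs ht => simp only [ev, T.dual, dBar_sup, hs, ht]
  | inf s t hs ht => simp only [ev, T.dual, dBar_inf, hs, ht]

theorem dBar_dBar_ev {α : Type*} (δ : F ≃o Fᵒᵈ) (f : α → F)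
    (h : ∀ i, dBar δ (dBar δ (f i)) = f i) (t : T α) : dBar δ (dBar δ (ev f t)) = ev f t := by
  induction t with
  | var i => exact h i
  | sup s t hs ht => simp only [ev, dBar_sup, dBar_inf, hs, ht]
  | inf s t hs ht => simp only [ev, dBar_sup, dBar_inf, hs, ht]

theorem finish {G ρ : Type*} [Lattice G] {y : ρ → G} (hy : IsFreelyGenerated y)
    (δ : F ≃o Fᵒᵈ) (f : ρ → F) (hf : ∀ s t, ev f s ≤ ev f t → W s t) (σ : ρ → ρ)
    (hσ : ∀ r, dBar δ (f r) = f (σ r)) (hσσ : ∀ r, σ (σ r) = r) :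
    ∃ φ : LatticeHom G F, Function.Injective φ ∧ SelfduallyPositioned δ (Set.range ⇑φ) := by
  obtain ⟨φ, hφ⟩ := exists_hom hy f
  have inv : ∀ t : T ρ, dBar δ (ev f t) ∈ Set.range φ := by
    intro t
    refine ⟨ev y (T.map σ (T.dual t)), ?_⟩
    rw [hφ, ev_map, dBar_ev]
    congr 1
    funext i
    exact (hσ i).symm
  refine ⟨φ, ?_, ?_⟩
  · intro a b hab
    obtain ⟨s, rfl⟩ := ev_surj hy.1 a
    obtain ⟨t, rfl⟩ := ev_surj hy.1 b
    rw [hφ, hφ] at hab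
    exact le_antisymm ((hf _ _ hab.le).sound y) ((hf _ _ hab.ge).sound y)
  · apply Set.Subset.antisymm
    · rintro _ ⟨_, ⟨a, rfl⟩, rfl⟩
      obtain ⟨s, rfl⟩ := ev_surj hy.1 a
      rw [hφ]
      exact inv s
    · rintro _ ⟨a, rfl⟩
      obtain ⟨s, rfl⟩ := ev_surj hy.1 a
      rw [hφ]
      exact ⟨_, inv s, dBar_dBar_ev δ f (fun i => by rw [hσ, hσ, hσσ]) s⟩

theorem dBar_U (δ : F ≃o Fᵒᵈ) (x y z : F) :
    dBar δ (U x y z) = Uo (dBar δ x) (dBar δ y) (dBar δ z) := by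
  simp only [U, Uo, dBar_sup, dBar_inf]

theorem dBar_Uo (δ : F ≃o Fᵒᵈ) (x y z : F) :
    dBar δ (Uo x y z) = U (dBar δ x) (dBar δ y) (dBar δ z) := by
  simp only [U, Uo, dBar_sup, dBar_inf]

theorem dBar_pq (δ : F ≃o Fᵒᵈ) {x y z : F} (hx : dBar δ x = x) (hy : dBar δ y = y)
    (hz : dBar δ z = z) (n : ℕ) :
    dBar δ (pq x y z n).1 = (pq x y z n).2 ∧ dBar δ (pq x y z n).2 = (pq x y z n).1 := by
  induction n with
  | zero => simp only [pq, dBar_U, dBar_Uo, hx, hy, hz, and_self]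
  | succ n ih => simp only [pq, dBar_U, dBar_Uo, hx, ih.1, ih.2, and_self]

theorem dBar_fam (δ : F ≃o Fᵒᵈ) {x y z : F} (hx : dBar δ x = x) (hy : dBar δ y = y)
    (hz : dBar δ z = z) (k : ℤ) : dBar δ (fam x y z k) = fam x y z (-k) := by
  have h := dBar_pq δ hx hy hz
  rcases k with (_ | k) | k
  · exact hx
  · change dBar δ (U _ _ _) = Uo _ _ _
    rw [dBar_U, hx, (h k).1, (h k).2]
  · change dBar δ (Uo _ _ _) = U _ _ _
    rw [dBar_Uo, hx, (h k).1, (h k).2]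

theorem not_le_sup {ι : Type*} {x : ι → F} (hx : IsFreelyGenerated x) {i j k : ι} (hj : i ≠ j)
    (hk : i ≠ k) : ¬ x i ≤ x j ⊔ x k := by
  intro h
  have h : W (T.var i) (T.sup (T.var j) (T.var k)) := key hx h
  cases h with
  | supR1 h => cases h; exact hj rfl
  | supR2 h => cases h; exact hk rfl

theorem not_inf_le {ι : Type*} {x : ι → F} (hx : IsFreelyGenerated x) {i j k : ι} (hj : i ≠ j)
    (hk : i ≠ k) : ¬ x j ⊓ x k ≤ x i := by
  intro h
  have h : W (T.inf (T.var j) (T.var k)) (T.var i) := key hx h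
  cases h with
  | infL1 h => cases h; exact hj rfl
  | infL2 h => cases h; exact hk rfl

theorem isId_Iic (a : F) : IsId (Set.Iic a) :=
  ⟨fun _ _ h k => h.trans k, fun _ _ h k => sup_le h k⟩

theorem isFi_Ici (a : F) : IsFi (Set.Ici a) :=
  ⟨fun _ _ h k => le_trans k h, fun _ _ h k => le_inf h k⟩

theorem base {ι : Type*} {x : ι → F} (hx : IsFreelyGenerated x) {i j k : ι} (hij : i ≠ j)
    (hik : i ≠ k) (hjk : j ≠ k) (f : ℤ → F) : LSep ∅ f (x i) (x j) (x k) where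
  hx := ⟨_, isId_Iic (x j ⊔ x k), by simp, le_sup_left, le_sup_right, not_le_sup hx hij hik⟩
  hy := ⟨_, isId_Iic (x i ⊔ x k), by simp, le_sup_left, le_sup_right, not_le_sup hx hij.symm hjk⟩
  hz := ⟨_, isId_Iic (x i ⊔ x j), by simp, le_sup_left, le_sup_right,
    not_le_sup hx hik.symm hjk.symm⟩
  hA j hj := absurd hj (by simp)

theorem base' {ι : Type*} {x : ι → F} (hx : IsFreelyGenerated x) {i j k : ι} (hij : i ≠ j)
    (hik : i ≠ k) (hjk : j ≠ k) (f : ℤ → F) : USep ∅ f (x i) (x j) (x k) where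
  hx := ⟨_, isFi_Ici (x j ⊓ x k), by simp, inf_le_left, inf_le_right, not_inf_le hx hij hik⟩
  hy := ⟨_, isFi_Ici (x i ⊓ x k), by simp, inf_le_left, inf_le_right, not_inf_le hx hij.symm hjk⟩
  hz := ⟨_, isFi_Ici (x i ⊓ x j), by simp, inf_le_left, inf_le_right,
    not_inf_le hx hik.symm hjk.symm⟩
  hA j hj := absurd hj (by simp)

theorem W_of_map {α β : Type*} {e : α → β} (he : Function.Injective e) {s t : T α}
    (h : W (T.map e s) (T.map e t)) : W s t := by
  by_cases hne : Nonempty α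
  swap
  · exfalso
    have : ∀ t : T α, False := fun t => by
      induction t with
      | var i => exact hne ⟨i⟩
      | sup _ _ h _ => exact h
      | inf _ _ h _ => exact h
    exact this s
  have h4 := h.map (Function.invFun e)
  rwa [map_map_of _ _ _ fun i _ => Function.leftInverse_invFun he i,
    map_map_of _ _ _ fun i _ => Function.leftInverse_invFun he i] at h4

/-- Symmetric indexing of a countable type by integers. -/
theorem exists_index (ρ : Type*) [Countable ρ] : ∃ (c : ρ → ℤ) (σ : ρ → ρ),
    Function.Injective c ∧ (∀ r, σ (σ r) = r) ∧ ∀ r, c (σ r) = - c r := by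
  rcases finite_or_infinite ρ with h | h
  · obtain ⟨N, ⟨e⟩⟩ := Finite.exists_equiv_fin ρ
    refine ⟨fun r => 2 * (e r : ℕ) + 1 - N, fun r => e.symm (Fin.rev (e r)), ?_, ?_, ?_⟩
    · intro a b hab
      apply e.injective
      apply Fin.ext
      simp only at hab
      omega
    · intro r; simp
    · intro r
      have := (e r).2
      simp only [Equiv.apply_symm_apply, Fin.val_rev]
      omega
  · obtain ⟨e⟩ := nonempty_equiv_of_countable (α := ρ) (β := ℤ)
    exact ⟨e, fun r => e.symm (- e r), e.injective, fun r => by simp, fun r => by simp⟩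

/-- Stack code of a term. -/
def code {α : Type*} : T α → List (α ⊕ Bool)
  | .var i => [Sum.inl i]
  | .sup s t => code s ++ (code t ++ [Sum.inr true])
  | .inf s t => code s ++ (code t ++ [Sum.inr false])

def stackEval {α : Type*} : List (α ⊕ Bool) → List (T α) → List (T α)
  | [], st => st
  | Sum.inl i :: l, st => stackEval l (.var i :: st)
  | Sum.inr true :: l, t :: s :: st => stackEval l (.sup s t :: st)
  | Sum.inr false :: l, t :: s :: st => stackEval l (.inf s t :: st)
  | Sum.inr _ :: _, _ => []

theorem stackEval_code {α : Type*} (t : T α) (l : List (α ⊕ Bool)) (st : List (T α)) :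
    stackEval (code t ++ l) st = stackEval l (t :: st) := by
  induction t generalizing l st with
  | var i => rfl
  | sup s t hs ht => simp only [code, List.append_assoc, hs, ht]; rfl
  | inf s t hs ht => simp only [code, List.append_assoc, hs, ht]; rfl

theorem code_injective {α : Type*} : Function.Injective (code (α := α)) := by
  intro s t h
  have h1 := stackEval_code s [] []
  have h2 := stackEval_code t [] []
  rw [h, h2] at h1
  simpa [stackEval] using h1.symm

theorem mk_T_le (α : Type u) : #(T α) ≤ max #α ℵ₀ := by
  refine (Cardinal.mk_le_of_injective code_injective).trans ?_
  refine (Cardinal.mk_list_le_max _).trans ?_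
  rw [Cardinal.mk_sum]
  simp only [Cardinal.lift_uzero, Cardinal.mk_bool]
  refine max_le (le_max_right _ _) ?_
  refine Cardinal.add_le_of_le (le_max_right _ _) (le_max_left _ _) ?_
  refine le_trans ?_ (le_max_right _ _)
  simp

theorem gen_injective {ρ : Type*} {y : ρ → F} (hy : IsFreelyGenerated y) :
    Function.Injective y := by
  intro a b h
  have : W (T.var a) (T.var b) := key hy (show y a ≤ y b from h.le)
  cases this
  rfl

end final

end SDP

theorem selfdually_positioned_free_sublattice_iff {κ lam : Cardinal.{u}}
    (hκ : 3 ≤ κ) (hlam : 3 ≤ lam)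
    {F : Type*} [Lattice F] {ι : Type u} (x : ι → F) (hx : IsFreelyGenerated x)
    (hι : #ι = lam)
    {G : Type*} [Lattice G] {ρ : Type u} (y : ρ → G) (hy : IsFreelyGenerated y)
    (hρ : #ρ = κ)
    (δ : F ≃o Fᵒᵈ) (hδ : ∀ i, dBar δ (x i) = x i) :
    (∃ φ : LatticeHom G F, Function.Injective φ ∧
        SelfduallyPositioned δ (Set.range ⇑φ)) ↔
      max κ ℵ₀ ≤ max lam ℵ₀ := by
  subst hρ hι
  constructor
  · rintro ⟨φ, hφ, -⟩
    refine max_le ?_ (le_max_right _ _)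
    choose r hr using SDP.ev_surj hx.1
    have hri : Function.Injective r := fun a b h => by rw [← hr a, ← hr b, h]
    exact (Cardinal.mk_le_of_injective
      (hri.comp (hφ.comp (SDP.gen_injective hy)))).trans (SDP.mk_T_le ι)
  · intro hle
    by_cases hc : #ρ ≤ ℵ₀
    · have : Countable ρ := Cardinal.mk_le_aleph0_iff.1 hc
      obtain ⟨c, σ, hc, hσσ, hσ⟩ := SDP.exists_index ρ
      have h3 : Cardinal.lift.{u} #(Fin 3) ≤ Cardinal.lift.{0} #ι := by simpa using hlam
      obtain ⟨e⟩ := Cardinal.lift_mk_le'.1 h3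
      have h01 : e 0 ≠ e 1 := e.injective.ne (by decide)
      have h02 : e 0 ≠ e 2 := e.injective.ne (by decide)
      have h12 : e 1 ≠ e 2 := e.injective.ne (by decide)
      have hW := SDP.wc_of_free hx
      have b1 := SDP.base hx h01 h02 h12 (SDP.fam (x (e 0)) (x (e 1)) (x (e 2)))
      have b2 := SDP.base' hx h01 h02 h12 (SDP.fam (x (e 0)) (x (e 1)) (x (e 2)))
      refine SDP.finish hy δ (SDP.fam (x (e 0)) (x (e 1)) (x (e 2)) ∘ c) ?_ σ ?_ hσσ
      · intro s t h
        rw [← SDP.T.ev_map, ← SDP.T.ev_map] at h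
        exact SDP.W_of_map hc
          (SDP.criterion hW (SDP.fam_sep hW b1 b2) (SDP.fam_sep' hW b1 b2) _ _ h)
      · intro r
        simp only [Function.comp_apply, hσ]
        exact SDP.dBar_fam δ (hδ _) (hδ _) (hδ _) _
    · have hle' : #ρ ≤ #ι := by
        rcases le_max_iff.1 ((le_max_left _ _).trans hle) with h | h
        · exact h
        · exact absurd h hc
      obtain ⟨e⟩ := hle'
      refine SDP.finish hy δ (x ∘ e) ?_ id (fun r => hδ _) (fun r => rfl)
      intro s t h
      rw [← SDP.T.ev_map, ← SDP.T.ev_map] at h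
      exact SDP.W_of_map e.injective (SDP.key hx h)
end

section
/- Let κ and λ be cardinals with 3 ≤ κ and 3 ≤ λ. Let F be a lattice freely generated by a family x : ι → F with #ι = λ, and let G be a lattice freely generated by a family y : ρ → G with #ρ = κ. Then there exists an injective lattice homomorphism φ : G → F whose range is a DA-symmetric subset of F if and only if either κ = λ, or (λ < ℵ₀ and (κ = ℵ₀ or κ = 2·k for some positive natural number k)). -/
open Cardinal

universe u

/-- A subset `S` of a lattice is DA-symmetric if it is invariant under all automorphisms and
all dual automorphisms. -/
def DASymmetric {F : Type*} [Lattice F] (S : Set F) : Prop :=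
  (∀ π : F ≃o F, π '' S = S) ∧
    ∀ ψ : F ≃o Fᵒᵈ, (fun u => OrderDual.ofDual (ψ u)) '' S = S

/-! ## Lattice terms and Whitman's preorder -/

/-- Lattice terms. -/
inductive FTerm (α : Type*) : Type _
  | var : α → FTerm α
  | sup : FTerm α → FTerm α → FTerm α
  | inf : FTerm α → FTerm α → FTerm α

namespace FTerm

variable {α β γ : Type*}

def bind (f : α → FTerm β) : FTerm α → FTerm β
  | var i => f i
  | sup a b => sup (bind f a) (bind f b)
  | inf a b => inf (bind f a) (bind f b)

def eval {L : Type*} [Lattice L] (f : α → L) : FTerm α → L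
  | var i => f i
  | sup a b => eval f a ⊔ eval f b
  | inf a b => eval f a ⊓ eval f b

def dual : FTerm α → FTerm α
  | var i => var i
  | sup a b => inf (dual a) (dual b)
  | inf a b => sup (dual a) (dual b)

def vars : FTerm α → Set α
  | var i => {i}
  | sup a b => vars a ∪ vars b
  | inf a b => vars a ∪ vars b

/-- Cut-free derivability of inequalities (Whitman). -/
inductive W : FTerm α → FTerm α → Prop
  | var (i : α) : W (var i) (var i)
  | sup_le {a b q : FTerm α} : W a q → W b q → W (sup a b) q
  | le_inf {p a b : FTerm α} : W p a → W p b → W p (inf a b)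
  | inf_left {a b q : FTerm α} : W a q → W (inf a b) q
  | inf_right {a b q : FTerm α} : W b q → W (inf a b) q
  | sup_left {p a b : FTerm α} : W p a → W p (sup a b)
  | sup_right {p a b : FTerm α} : W p b → W p (sup a b)

theorem W.refl (p : FTerm α) : W p p := by
  induction p with
  | var i => exact W.var i
  | sup a b iha ihb => exact W.sup_le (W.sup_left iha) (W.sup_right ihb)
  | inf a b iha ihb => exact W.le_inf (W.inf_left iha) (W.inf_right ihb)

theorem W.of_sup {p q : FTerm α} (h : W p q) : ∀ a b, p = sup a b → W a q ∧ W b q := by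
  induction h with
  | var i => intro a b h; cases h
  | sup_le h1 h2 => intro a b h; cases h; exact ⟨h1, h2⟩
  | le_inf h1 h2 ih1 ih2 =>
    intro a b h
    exact ⟨.le_inf (ih1 a b h).1 (ih2 a b h).1, .le_inf (ih1 a b h).2 (ih2 a b h).2⟩
  | inf_left => intro a b h; cases h
  | inf_right => intro a b h; cases h
  | sup_left h1 ih => intro a b h; exact ⟨.sup_left (ih a b h).1, .sup_left (ih a b h).2⟩
  | sup_right h1 ih => intro a b h; exact ⟨.sup_right (ih a b h).1, .sup_right (ih a b h).2⟩

theorem W.of_inf {p q : FTerm α} (h : W p q) : ∀ a b, q = inf a b → W p a ∧ W p b := by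
  induction h with
  | var i => intro a b h; cases h
  | le_inf h1 h2 => intro a b h; cases h; exact ⟨h1, h2⟩
  | sup_le h1 h2 ih1 ih2 =>
    intro a b h
    exact ⟨.sup_le (ih1 a b h).1 (ih2 a b h).1, .sup_le (ih1 a b h).2 (ih2 a b h).2⟩
  | sup_left => intro a b h; cases h
  | sup_right => intro a b h; cases h
  | inf_left h1 ih => intro a b h; exact ⟨.inf_left (ih a b h).1, .inf_left (ih a b h).2⟩
  | inf_right h1 ih => intro a b h; exact ⟨.inf_right (ih a b h).1, .inf_right (ih a b h).2⟩

theorem W.sup_iff {a b q : FTerm α} : W (sup a b) q ↔ W a q ∧ W b q :=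
  ⟨fun h => h.of_sup a b rfl, fun h => .sup_le h.1 h.2⟩

theorem W.inf_iff {p a b : FTerm α} : W p (inf a b) ↔ W p a ∧ W p b :=
  ⟨fun h => h.of_inf a b rfl, fun h => .le_inf h.1 h.2⟩

theorem W.trans_var {p q : FTerm α} (h : W p q) :
    ∀ i r, q = FTerm.var i → W (FTerm.var i) r → W p r := by
  induction h with
  | var i => intro j r h hr; cases h; exact hr
  | sup_le h1 h2 ih1 ih2 => intro j r h hr; exact .sup_le (ih1 j r h hr) (ih2 j r h hr)
  | le_inf => intro j r h; cases h
  | inf_left h1 ih => intro j r h hr; exact .inf_left (ih j r h hr)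
  | inf_right h1 ih => intro j r h hr; exact .inf_right (ih j r h hr)
  | sup_left => intro j r h; cases h
  | sup_right => intro j r h; cases h

theorem W.trans_sup {p q : FTerm α} (h : W p q) : ∀ a b r, q = FTerm.sup a b →
    (∀ p r, W p a → W a r → W p r) → (∀ p r, W p b → W b r → W p r) →
    W (FTerm.sup a b) r → W p r := by
  induction h with
  | var i => intro a b r h; cases h
  | sup_le h1 h2 ih1 ih2 =>
    intro a b r h ha hb hr; exact .sup_le (ih1 a b r h ha hb hr) (ih2 a b r h ha hb hr)
  | le_inf => intro a b r h; cases h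
  | inf_left h1 ih => intro a b r h ha hb hr; exact .inf_left (ih a b r h ha hb hr)
  | inf_right h1 ih => intro a b r h ha hb hr; exact .inf_right (ih a b r h ha hb hr)
  | sup_left h1 => intro a b r h ha hb hr; cases h; exact ha _ _ h1 (W.sup_iff.1 hr).1
  | sup_right h1 => intro a b r h ha hb hr; cases h; exact hb _ _ h1 (W.sup_iff.1 hr).2

theorem W.trans_inf {q r : FTerm α} (h : W q r) : ∀ a b p, q = FTerm.inf a b →
    (∀ p r, W p a → W a r → W p r) → (∀ p r, W p b → W b r → W p r) →
    W p (FTerm.inf a b) → W p r := by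
  induction h with
  | var i => intro a b r h; cases h
  | le_inf h1 h2 ih1 ih2 =>
    intro a b r h ha hb hr; exact .le_inf (ih1 a b r h ha hb hr) (ih2 a b r h ha hb hr)
  | sup_le => intro a b r h; cases h
  | sup_left h1 ih => intro a b r h ha hb hr; exact .sup_left (ih a b r h ha hb hr)
  | sup_right h1 ih => intro a b r h ha hb hr; exact .sup_right (ih a b r h ha hb hr)
  | inf_left h1 => intro a b r h ha hb hr; cases h; exact ha _ _ (W.inf_iff.1 hr).1 h1
  | inf_right h1 => intro a b r h ha hb hr; cases h; exact hb _ _ (W.inf_iff.1 hr).2 h1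

theorem W.trans {p q r : FTerm α} (h1 : W p q) (h2 : W q r) : W p r := by
  induction q generalizing p r with
  | var i => exact h1.trans_var i r rfl h2
  | sup a b iha ihb => exact h1.trans_sup a b r rfl (fun _ _ => iha) (fun _ _ => ihb) h2
  | inf a b iha ihb => exact h2.trans_inf a b p rfl (fun _ _ => iha) (fun _ _ => ihb) h1

theorem W.bind {p q : FTerm α} (h : W p q) (f : α → FTerm β) : W (p.bind f) (q.bind f) := by
  induction h with
  | var i => exact .refl _
  | sup_le _ _ h1 h2 => exact .sup_le h1 h2
  | le_inf _ _ h1 h2 => exact .le_inf h1 h2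
  | inf_left _ h => exact .inf_left h
  | inf_right _ h => exact .inf_right h
  | sup_left _ h => exact .sup_left h
  | sup_right _ h => exact .sup_right h

theorem W.dual {p q : FTerm α} (h : W p q) : W q.dual p.dual := by
  induction h with
  | var i => exact .refl _
  | sup_le _ _ h1 h2 => exact .le_inf h1 h2
  | le_inf _ _ h1 h2 => exact .sup_le h1 h2
  | inf_left _ h => exact .sup_left h
  | inf_right _ h => exact .sup_right h
  | sup_left _ h => exact .inf_left h
  | sup_right _ h => exact .inf_right h

theorem W.sound {p q : FTerm α} (h : W p q) {L : Type*} [Lattice L] (f : α → L) :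
    p.eval f ≤ q.eval f := by
  induction h with
  | var i => exact le_rfl
  | sup_le _ _ h1 h2 => exact _root_.sup_le h1 h2
  | le_inf _ _ h1 h2 => exact _root_.le_inf h1 h2
  | inf_left _ h => exact inf_le_of_left_le h
  | inf_right _ h => exact inf_le_of_right_le h
  | sup_left _ h => exact le_sup_of_le_left h
  | sup_right _ h => exact le_sup_of_le_right h

theorem dual_dual (p : FTerm α) : p.dual.dual = p := by
  induction p <;> simp_all [FTerm.dual]

theorem bind_bind (p : FTerm α) (f : α → FTerm β) (g : β → FTerm γ) :
    (p.bind f).bind g = p.bind (fun i => (f i).bind g) := by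
  induction p <;> simp_all [FTerm.bind]

theorem bind_var (p : FTerm α) : p.bind var = p := by
  induction p <;> simp_all [FTerm.bind]

theorem dual_bind (p : FTerm α) (f : α → FTerm β) :
    (p.bind f).dual = p.dual.bind (fun i => (f i).dual) := by
  induction p <;> simp_all [FTerm.bind, FTerm.dual]

theorem eval_bind {L : Type*} [Lattice L] (p : FTerm α) (f : α → FTerm β) (g : β → L) :
    (p.bind f).eval g = p.eval (fun i => (f i).eval g) := by
  induction p <;> simp_all [FTerm.bind, FTerm.eval]

theorem eval_map {L M : Type*} [Lattice L] [Lattice M] (φ : L → M)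
    (hs : ∀ a b, φ (a ⊔ b) = φ a ⊔ φ b) (hi : ∀ a b, φ (a ⊓ b) = φ a ⊓ φ b)
    (p : FTerm α) (f : α → L) : φ (p.eval f) = p.eval (fun i => φ (f i)) := by
  induction p <;> simp_all [FTerm.eval]

theorem eval_antimap {L M : Type*} [Lattice L] [Lattice M] (φ : L → M)
    (hs : ∀ a b, φ (a ⊔ b) = φ a ⊓ φ b) (hi : ∀ a b, φ (a ⊓ b) = φ a ⊔ φ b)
    (p : FTerm α) (f : α → L) : φ (p.eval f) = p.dual.eval (fun i => φ (f i)) := by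
  induction p <;> simp_all [FTerm.eval, FTerm.dual]

theorem vars_finite (p : FTerm α) : p.vars.Finite := by
  induction p <;> simp_all [FTerm.vars]

theorem vars_nonempty (p : FTerm α) : p.vars.Nonempty := by
  induction p with
  | var i => exact ⟨i, rfl⟩
  | sup a b iha ihb => exact iha.mono Set.subset_union_left
  | inf a b iha ihb => exact iha.mono Set.subset_union_left

theorem bind_congr (p : FTerm α) {f g : α → FTerm β} (h : ∀ i ∈ p.vars, f i = g i) :
    p.bind f = p.bind g := by
  induction p <;> simp_all [FTerm.vars, FTerm.bind]

theorem eval_congr {L : Type*} [Lattice L] (p : FTerm α) {f g : α → L}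
    (h : ∀ i ∈ p.vars, f i = g i) : p.eval f = p.eval g := by
  induction p <;> simp_all [FTerm.vars, FTerm.eval]

instance : Preorder (FTerm α) where
  le := W
  le_refl := W.refl
  le_trans _ _ _ := W.trans

end FTerm

/-- The free lattice as a quotient of terms. -/
def FLq (α : Type*) := Antisymmetrization (FTerm α) (· ≤ ·)

namespace FLq
variable {α : Type*}

instance : PartialOrder (FLq α) := inferInstanceAs (PartialOrder (Antisymmetrization _ _))

def mk (p : FTerm α) : FLq α := toAntisymmetrization (· ≤ ·) p

theorem mk_le {p q : FTerm α} : mk p ≤ mk q ↔ FTerm.W p q := Iff.rfl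

theorem mk_surj (u : FLq α) : ∃ p, mk p = u := Quotient.exists_rep u

noncomputable def out (u : FLq α) : FTerm α := (mk_surj u).choose
theorem mk_out (u : FLq α) : mk (out u) = u := (mk_surj u).choose_spec

noncomputable instance : Lattice (FLq α) where
  sup u v := mk (.sup (out u) (out v))
  inf u v := mk (.inf (out u) (out v))
  le_sup_left u v := by
    conv_lhs => rw [← mk_out u]
    exact mk_le.2 (.sup_left (.refl _))
  le_sup_right u v := by
    conv_lhs => rw [← mk_out v]
    exact mk_le.2 (.sup_right (.refl _))
  sup_le u v w h1 h2 := by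
    rw [← mk_out w]
    rw [← mk_out u, ← mk_out w, mk_le] at h1
    rw [← mk_out v, ← mk_out w, mk_le] at h2
    exact mk_le.2 (.sup_le h1 h2)
  inf_le_left u v := by
    conv_rhs => rw [← mk_out u]
    exact mk_le.2 (.inf_left (.refl _))
  inf_le_right u v := by
    conv_rhs => rw [← mk_out v]
    exact mk_le.2 (.inf_right (.refl _))
  le_inf w u v h1 h2 := by
    rw [← mk_out w]
    rw [← mk_out w, ← mk_out u, mk_le] at h1
    rw [← mk_out w, ← mk_out v, mk_le] at h2
    exact mk_le.2 (.le_inf h1 h2)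

theorem mk_sup (p q : FTerm α) : mk (.sup p q) = mk p ⊔ mk q := by
  apply le_antisymm
  · obtain ⟨r, hr⟩ := mk_surj (mk p ⊔ mk q)
    have h1 : mk p ≤ mk r := hr ▸ le_sup_left
    have h2 : mk q ≤ mk r := hr ▸ le_sup_right
    rw [← hr]; exact mk_le.2 (.sup_le h1 h2)
  · exact sup_le (mk_le.2 (.sup_left (.refl _))) (mk_le.2 (.sup_right (.refl _)))

theorem mk_inf (p q : FTerm α) : mk (.inf p q) = mk p ⊓ mk q := by
  apply le_antisymm
  · exact le_inf (mk_le.2 (.inf_left (.refl _))) (mk_le.2 (.inf_right (.refl _)))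
  · obtain ⟨r, hr⟩ := mk_surj (mk p ⊓ mk q)
    have h1 : mk r ≤ mk p := hr ▸ inf_le_left
    have h2 : mk r ≤ mk q := hr ▸ inf_le_right
    rw [← hr]; exact mk_le.2 (.le_inf h1 h2)

theorem eval_mk {β : Type*} (p : FTerm β) (f : β → FTerm α) :
    p.eval (fun i => mk (f i)) = mk (p.bind f) := by
  induction p <;> simp_all [FTerm.eval, FTerm.bind, mk_sup, mk_inf]

end FLq

/-- A family satisfies no lattice inequalities except the trivial ones. -/
def FreeFam {L : Type*} [Lattice L] {ρ : Type*} (f : ρ → L) : Prop :=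
  ∀ p q : FTerm ρ, p.eval f ≤ q.eval f → FTerm.W p q

/-- Universe-free version of free generation. -/
structure FreeGen {L : Type*} [Lattice L] {ρ : Type*} (f : ρ → L) : Prop where
  surj : ∀ u, ∃ p : FTerm ρ, p.eval f = u
  free : FreeFam f

theorem IsFreelyGenerated.freeGen {F : Type*} [Lattice F] {ι : Type*} {x : ι → F}
    (hx : IsFreelyGenerated x) : FreeGen x := by
  constructor
  · intro u
    have hu : u ∈ latticeClosure (Set.range x) := by rw [hx.1]; trivial
    have hS : IsSublattice {u | ∃ p : FTerm ι, p.eval x = u} := by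
      constructor
      · rintro _ ⟨p, rfl⟩ _ ⟨q, rfl⟩; exact ⟨.sup p q, rfl⟩
      · rintro _ ⟨p, rfl⟩ _ ⟨q, rfl⟩; exact ⟨.inf p q, rfl⟩
    refine latticeClosure_min ?_ hS hu
    rintro _ ⟨i, rfl⟩; exact ⟨.var i, rfl⟩
  · intro p q hpq
    have hfin : (p.vars ∪ q.vars).Finite := p.vars_finite.union q.vars_finite
    obtain ⟨f, hf⟩ := Set.countable_iff_exists_injOn.1 hfin.countable
    obtain ⟨φ, hφ⟩ := hx.2 (ULift (FLq ℕ)) (fun i => ULift.up (FLq.mk (.var (f i))))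
    have key : ∀ r : FTerm ι, (φ (r.eval x)).down = FLq.mk (r.bind (fun i => .var (f i))) := by
      intro r
      rw [FTerm.eval_map (fun u => (φ u).down) (by simp) (by simp), ← FLq.eval_mk]
      simp [hφ]
    have h1 : (φ (p.eval x)).down ≤ (φ (q.eval x)).down := OrderHomClass.mono φ hpq
    rw [key, key, FLq.mk_le] at h1
    haveI : Nonempty ι := ⟨p.vars_nonempty.some⟩
    have h2 := h1.bind (fun n => .var (Function.invFunOn f (p.vars ∪ q.vars) n))
    rw [FTerm.bind_bind, FTerm.bind_bind] at h2
    have hl := hf.leftInvOn_invFunOn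
    rw [FTerm.bind_congr (g := FTerm.var) p, FTerm.bind_congr (g := FTerm.var) q,
      FTerm.bind_var, FTerm.bind_var] at h2
    · exact h2
    · intro i hi; exact congrArg FTerm.var (hl (Or.inr hi))
    · intro i hi; exact congrArg FTerm.var (hl (Or.inl hi))

/-- Both join prime and meet prime. -/
def DPrime {L : Type*} [Lattice L] (u : L) : Prop :=
  (∀ a b, u ≤ a ⊔ b → u ≤ a ∨ u ≤ b) ∧ (∀ a b, a ⊓ b ≤ u → a ≤ u ∨ b ≤ u)

namespace FreeGen
variable {L : Type*} [Lattice L] {ρ : Type*} {f : ρ → L}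

theorem whit (hf : FreeGen f) (a b c d : L) (h : a ⊓ b ≤ c ⊔ d) :
    a ≤ c ⊔ d ∨ b ≤ c ⊔ d ∨ a ⊓ b ≤ c ∨ a ⊓ b ≤ d := by
  obtain ⟨a, rfl⟩ := hf.surj a
  obtain ⟨b, rfl⟩ := hf.surj b
  obtain ⟨c, rfl⟩ := hf.surj c
  obtain ⟨d, rfl⟩ := hf.surj d
  have h := hf.free (.inf a b) (.sup c d) h
  cases h with
  | inf_left h => exact Or.inl (h.sound f)
  | inf_right h => exact Or.inr (Or.inl (h.sound f))
  | sup_left h => exact Or.inr (Or.inr (Or.inl (h.sound f)))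
  | sup_right h => exact Or.inr (Or.inr (Or.inr (h.sound f)))

theorem gen_sup (hf : FreeGen f) (i : ρ) (a b : L) (h : f i ≤ a ⊔ b) : f i ≤ a ∨ f i ≤ b := by
  obtain ⟨a, rfl⟩ := hf.surj a
  obtain ⟨b, rfl⟩ := hf.surj b
  have h := hf.free (.var i) (.sup a b) h
  cases h with
  | sup_left h => exact Or.inl (h.sound f)
  | sup_right h => exact Or.inr (h.sound f)

theorem inf_gen (hf : FreeGen f) (i : ρ) (a b : L) (h : a ⊓ b ≤ f i) : a ≤ f i ∨ b ≤ f i := by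
  obtain ⟨a, rfl⟩ := hf.surj a
  obtain ⟨b, rfl⟩ := hf.surj b
  have h := hf.free (.inf a b) (.var i) h
  cases h with
  | inf_left h => exact Or.inl (h.sound f)
  | inf_right h => exact Or.inr (h.sound f)

end FreeGen

theorem FreeFam.le_iff {L : Type*} [Lattice L] {ρ : Type*} {f : ρ → L} (hf : FreeFam f)
    {i j : ρ} : f i ≤ f j ↔ i = j := by
  constructor
  · intro h
    have h := hf (.var i) (.var j) h
    cases h; rfl
  · rintro rfl; exact le_rfl

theorem FreeFam.injective {L : Type*} [Lattice L] {ρ : Type*} {f : ρ → L} (hf : FreeFam f) :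
    Function.Injective f := fun _ _ h => hf.le_iff.1 h.le

namespace FreeGen
variable {L : Type*} [Lattice L] {ρ : Type*} {f : ρ → L}

theorem dprime_iff (hf : FreeGen f) {u : L} : DPrime u ↔ ∃ i, f i = u := by
  constructor
  · intro hu
    obtain ⟨p, hp⟩ := hf.surj u
    induction p with
    | var i => exact ⟨i, hp⟩
    | sup a b iha ihb =>
      simp only [FTerm.eval] at hp
      rcases hu.1 _ _ hp.ge with h | h
      · exact iha (le_antisymm (hp ▸ le_sup_left) h)
      · exact ihb (le_antisymm (hp ▸ le_sup_right) h)
    | inf a b iha ihb =>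
      simp only [FTerm.eval] at hp
      rcases hu.2 _ _ hp.le with h | h
      · exact iha (le_antisymm h (hp ▸ inf_le_left))
      · exact ihb (le_antisymm h (hp ▸ inf_le_right))
  · rintro ⟨i, rfl⟩
    exact ⟨hf.gen_sup i, hf.inf_gen i⟩

theorem dual (hf : FreeGen f) : FreeGen (fun i => OrderDual.toDual (f i)) := by
  have key : ∀ p : FTerm ρ, p.eval (fun i => OrderDual.toDual (f i))
      = OrderDual.toDual (p.dual.eval f) := by
    intro p
    rw [FTerm.eval_antimap OrderDual.toDual (fun _ _ => rfl) (fun _ _ => rfl), FTerm.dual_dual]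
  constructor
  · intro u
    obtain ⟨p, hp⟩ := hf.surj (OrderDual.ofDual u)
    refine ⟨p.dual, ?_⟩
    rw [key, FTerm.dual_dual, hp]; rfl
  · intro p q h
    rw [key, key] at h
    have h := (hf.free _ _ (OrderDual.toDual_le_toDual.1 h)).dual
    rwa [FTerm.dual_dual, FTerm.dual_dual] at h

theorem comp_equiv {ρ' : Type*} (hf : FreeGen f) (σ : ρ' ≃ ρ) : FreeGen (fun i => f (σ i)) := by
  have key : ∀ p : FTerm ρ', p.eval (fun i => f (σ i)) = (p.bind (fun i => .var (σ i))).eval f := by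
    intro p; rw [FTerm.eval_bind]; rfl
  constructor
  · intro u
    obtain ⟨p, hp⟩ := hf.surj u
    refine ⟨p.bind (fun i => .var (σ.symm i)), ?_⟩
    rw [key, FTerm.bind_bind, ← hp]
    simp [FTerm.bind, FTerm.bind_var]
  · intro p q h
    rw [key, key] at h
    have h := (hf.free _ _ h).bind (fun i => .var (σ.symm i))
    rw [FTerm.bind_bind, FTerm.bind_bind] at h
    simpa [FTerm.bind, FTerm.bind_var] using h

/-- Universal property. -/
theorem lift (hf : FreeGen f) {M : Type*} [Lattice M] (g : ρ → M) :
    ∃ φ : LatticeHom L M, ∀ p : FTerm ρ, φ (p.eval f) = p.eval g := by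
  choose t ht using hf.surj
  have key : ∀ p : FTerm ρ, (t (p.eval f)).eval g = p.eval g := fun p =>
    le_antisymm ((hf.free _ _ (ht _).le).sound g) ((hf.free _ _ (ht _).ge).sound g)
  refine ⟨⟨⟨fun u => (t u).eval g, ?_⟩, ?_⟩, key⟩
  · intro a b
    have := key (.sup (t a) (t b))
    simpa only [FTerm.eval, ht] using this
  · intro a b
    have := key (.inf (t a) (t b))
    simpa only [FTerm.eval, ht] using this

theorem lift_injective (hf : FreeGen f) {M : Type*} [Lattice M] {g : ρ → M} (hg : FreeFam g)
    {φ : LatticeHom L M} (hφ : ∀ p : FTerm ρ, φ (p.eval f) = p.eval g) :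
    Function.Injective φ := by
  intro u v h
  obtain ⟨p, rfl⟩ := hf.surj u
  obtain ⟨q, rfl⟩ := hf.surj v
  rw [hφ, hφ] at h
  exact le_antisymm ((hg _ _ h.le).sound f) ((hg _ _ h.ge).sound f)

theorem iso (hf : FreeGen f) {M : Type*} [Lattice M] {g : ρ → M} (hg : FreeGen g) :
    ∃ e : L ≃o M, ∀ i, e (f i) = g i := by
  obtain ⟨φ, hφ⟩ := hf.lift g
  obtain ⟨ψ, hψ⟩ := hg.lift f
  refine ⟨⟨⟨φ, ψ, ?_, ?_⟩, ?_⟩, fun i => hφ (.var i)⟩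
  · intro u
    obtain ⟨p, rfl⟩ := hf.surj u
    rw [hφ, hψ]
  · intro u
    obtain ⟨p, rfl⟩ := hg.surj u
    rw [hψ, hφ]
  · intro u v
    obtain ⟨p, rfl⟩ := hf.surj u
    obtain ⟨q, rfl⟩ := hf.surj v
    change φ _ ≤ φ _ ↔ _
    rw [hφ, hφ]
    exact ⟨fun h => (hg.free _ _ h).sound f, fun h => (hf.free _ _ h).sound g⟩

end FreeGen

theorem DPrime.map {L M : Type*} [Lattice L] [Lattice M] (e : L ≃o M) {u : L} (hu : DPrime u) :
    DPrime (e u) := by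
  constructor
  · intro a b h
    have := hu.1 (e.symm a) (e.symm b)
    rw [← map_sup, ← e.le_symm_apply] at *
    simpa [e.le_symm_apply] using this h
  · intro a b h
    have := hu.2 (e.symm a) (e.symm b)
    rw [← map_inf, ← e.symm_apply_le] at *
    simpa [e.symm_apply_le] using this h

theorem DPrime.ofDual {L : Type*} [Lattice L] {u : Lᵒᵈ} (hu : DPrime u) :
    DPrime (OrderDual.ofDual u) := ⟨fun a b h => hu.2 a b h, fun a b h => hu.1 a b h⟩

/-- Freeness criterion in lattices with Whitman's condition. -/
theorem freeFam_of_sep {L : Type*} [Lattice L] {ρ : Type*} {f : ρ → L}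
    (hW : ∀ a b c d : L, a ⊓ b ≤ c ⊔ d → a ≤ c ⊔ d ∨ b ≤ c ⊔ d ∨ a ⊓ b ≤ c ∨ a ⊓ b ≤ d)
    (hI : ∀ i, ∃ I : L → Prop, (∀ a b, I a → I b → I (a ⊔ b)) ∧ (∀ a b, a ≤ b → I b → I a) ∧
      (∀ j, j ≠ i → I (f j)) ∧ ¬ I (f i))
    (hJ : ∀ i, ∃ I : L → Prop, (∀ a b, I a → I b → I (a ⊓ b)) ∧ (∀ a b, b ≤ a → I b → I a) ∧
      (∀ j, j ≠ i → I (f j)) ∧ ¬ I (f i)) : FreeFam f := by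
  have key1 : ∀ i (a b : FTerm ρ), f i ≤ a.eval f ⊔ b.eval f → f i ≤ a.eval f ∨ f i ≤ b.eval f := by
    intro i a b h
    obtain ⟨I, h1, h2, h3, h4⟩ := hI i
    have : ∀ t : FTerm ρ, f i ≤ t.eval f ∨ I (t.eval f) := by
      intro t
      induction t with
      | var j =>
        by_cases hj : j = i
        · left; rw [hj]; exact le_rfl
        · right; exact h3 j hj
      | sup a b iha ihb =>
        rcases iha with h | ha
        · left; exact h.trans le_sup_left
        rcases ihb with h | hb
        · left; exact h.trans le_sup_right
        · right; exact h1 _ _ ha hb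
      | inf a b iha ihb =>
        rcases iha with ha | h
        · rcases ihb with hb | h
          · left; exact le_inf ha hb
          · right; exact h2 _ _ inf_le_right h
        · right; exact h2 _ _ inf_le_left h
    rcases this a with ha | ha
    · exact Or.inl ha
    rcases this b with hb | hb
    · exact Or.inr hb
    exact absurd (h2 _ _ h (h1 _ _ ha hb)) h4
  have key2 : ∀ i (a b : FTerm ρ), a.eval f ⊓ b.eval f ≤ f i → a.eval f ≤ f i ∨ b.eval f ≤ f i := by
    intro i a b h
    obtain ⟨I, h1, h2, h3, h4⟩ := hJ i
    have : ∀ t : FTerm ρ, t.eval f ≤ f i ∨ I (t.eval f) := by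
      intro t
      induction t with
      | var j =>
        by_cases hj : j = i
        · left; rw [hj]; exact le_rfl
        · right; exact h3 j hj
      | inf a b iha ihb =>
        rcases iha with h | ha
        · left; exact inf_le_left.trans h
        rcases ihb with h | hb
        · left; exact inf_le_right.trans h
        · right; exact h1 _ _ ha hb
      | sup a b iha ihb =>
        rcases iha with ha | h
        · rcases ihb with hb | h
          · left; exact sup_le ha hb
          · right; exact h2 _ _ le_sup_right h
        · right; exact h2 _ _ le_sup_left h
    rcases this a with ha | ha
    · exact Or.inl ha
    rcases this b with hb | hb
    · exact Or.inr hb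
    exact absurd (h2 _ _ h (h1 _ _ ha hb)) h4
  have key0 : ∀ i j, f i ≤ f j → i = j := by
    intro i j h
    obtain ⟨I, h1, h2, h3, h4⟩ := hI i
    by_contra hne
    exact h4 (h2 _ _ h (h3 j (Ne.symm hne)))
  intro p
  induction p with
  | var i =>
    intro q
    induction q with
    | var j => intro h; rw [key0 i j h]; exact .refl _
    | sup c d ihc ihd =>
      intro h
      rcases key1 i c d h with h | h
      · exact .sup_left (ihc h)
      · exact .sup_right (ihd h)
    | inf c d ihc ihd =>
      intro h
      exact .le_inf (ihc (le_trans h inf_le_left)) (ihd (le_trans h inf_le_right))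
  | sup a b iha ihb =>
    intro q h
    exact .sup_le (iha q (le_trans le_sup_left h)) (ihb q (le_trans le_sup_right h))
  | inf a b iha ihb =>
    intro q
    induction q with
    | var j =>
      intro h
      rcases key2 j a b h with h | h
      · exact .inf_left (iha _ h)
      · exact .inf_right (ihb _ h)
    | sup c d ihc ihd =>
      intro h
      rcases hW _ _ _ _ h with h | h | h | h
      · exact .inf_left (iha _ h)
      · exact .inf_right (ihb _ h)
      · exact .sup_left (ihc h)
      · exact .sup_right (ihd h)
    | inf c d ihc ihd =>
      intro h
      exact .le_inf (ihc (le_trans h inf_le_left)) (ihd (le_trans h inf_le_right))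

theorem FLq.freeGen {α : Type*} : FreeGen (fun i : α => FLq.mk (.var i)) := by
  constructor
  · intro u
    obtain ⟨p, rfl⟩ := FLq.mk_surj u
    exact ⟨p, by rw [FLq.eval_mk]; exact congrArg _ p.bind_var⟩
  · intro p q h
    rw [FLq.eval_mk, FLq.eval_mk, FTerm.bind_var, FTerm.bind_var] at h
    exact h

/-- Freeness criterion for term families. -/
theorem term_free_of_sep {α ρ : Type*} {f : ρ → FTerm α}
    (hI : ∀ i, ∃ I : FTerm α → Prop, (∀ a b, I a → I b → I (.sup a b)) ∧
      (∀ a b, FTerm.W a b → I b → I a) ∧ (∀ j, j ≠ i → I (f j)) ∧ ¬ I (f i))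
    (hJ : ∀ i, ∃ I : FTerm α → Prop, (∀ a b, I a → I b → I (.inf a b)) ∧
      (∀ a b, FTerm.W b a → I b → I a) ∧ (∀ j, j ≠ i → I (f j)) ∧ ¬ I (f i))
    (p q : FTerm ρ) (h : FTerm.W (p.bind f) (q.bind f)) : FTerm.W p q := by
  have : FreeFam (fun i => FLq.mk (f i)) := by
    refine freeFam_of_sep FLq.freeGen.whit ?_ ?_
    · intro i
      obtain ⟨I, h1, h2, h3, h4⟩ := hI i
      refine ⟨fun u => ∃ t, u ≤ FLq.mk t ∧ I t, ?_, ?_, ?_, ?_⟩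
      · rintro a b ⟨s, hs, hs'⟩ ⟨t, ht, ht'⟩
        exact ⟨_, by rw [FLq.mk_sup]; exact sup_le_sup hs ht, h1 _ _ hs' ht'⟩
      · rintro a b h ⟨s, hs, hs'⟩
        exact ⟨s, h.trans hs, hs'⟩
      · intro j hj; exact ⟨_, le_rfl, h3 j hj⟩
      · rintro ⟨t, ht, ht'⟩
        exact h4 (h2 _ _ (FLq.mk_le.1 ht) ht')
    · intro i
      obtain ⟨I, h1, h2, h3, h4⟩ := hJ i
      refine ⟨fun u => ∃ t, FLq.mk t ≤ u ∧ I t, ?_, ?_, ?_, ?_⟩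
      · rintro a b ⟨s, hs, hs'⟩ ⟨t, ht, ht'⟩
        exact ⟨_, by rw [FLq.mk_inf]; exact inf_le_inf hs ht, h1 _ _ hs' ht'⟩
      · rintro a b h ⟨s, hs, hs'⟩
        exact ⟨s, hs.trans h, hs'⟩
      · intro j hj; exact ⟨_, le_rfl, h3 j hj⟩
      · rintro ⟨t, ht, ht'⟩
        exact h4 (h2 _ _ (FLq.mk_le.1 ht) ht')
  apply this
  rw [FLq.eval_mk, FLq.eval_mk]
  exact h

namespace FTerm

/-- Decision procedure for Whitman's preorder: variable on the left. -/
def leVar {α : Type*} [DecidableEq α] (i : α) : FTerm α → Bool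
  | var j => decide (i = j)
  | sup c d => leVar i c || leVar i d
  | inf c d => leVar i c && leVar i d

/-- Decision procedure for Whitman's preorder: meet on the left. -/
def leInf {α : Type*} (fa fb : FTerm α → Bool) : FTerm α → Bool
  | var j => fa (var j) || fb (var j)
  | sup c d => fa (sup c d) || fb (sup c d) || leInf fa fb c || leInf fa fb d
  | inf c d => leInf fa fb c && leInf fa fb d

/-- Decision procedure for Whitman's preorder. -/
def leB {α : Type*} [DecidableEq α] : FTerm α → FTerm α → Bool
  | var i => leVar i
  | sup a b => fun q => leB a q && leB b q
  | inf a b => leInf (leB a) (leB b)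

theorem leB_iff {α : Type*} [DecidableEq α] (p : FTerm α) : ∀ q, leB p q = true ↔ W p q := by
  induction p with
  | var i =>
    intro q
    induction q with
    | var j =>
      simp only [leB, leVar, decide_eq_true_eq]
      exact ⟨fun h => h ▸ .refl _, fun h => by cases h; rfl⟩
    | sup c d ihc ihd =>
      simp only [leB, leVar, Bool.or_eq_true] at *
      rw [ihc, ihd]
      refine ⟨fun h => h.elim .sup_left .sup_right, fun h => ?_⟩
      cases h with
      | sup_left h => exact Or.inl h
      | sup_right h => exact Or.inr h
    | inf c d ihc ihd =>
      simp only [leB, leVar, Bool.and_eq_true] at *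
      rw [ihc, ihd, W.inf_iff]
  | sup a b iha ihb =>
    intro q
    simp only [leB, Bool.and_eq_true]
    rw [iha, ihb, W.sup_iff]
  | inf a b iha ihb =>
    intro q
    induction q with
    | var j =>
      simp only [leB, leInf, Bool.or_eq_true]
      rw [iha, ihb]
      refine ⟨fun h => h.elim .inf_left .inf_right, fun h => ?_⟩
      cases h with
      | inf_left h => exact Or.inl h
      | inf_right h => exact Or.inr h
    | sup c d ihc ihd =>
      simp only [leB, leInf, Bool.or_eq_true] at *
      rw [iha, ihb, ihc, ihd]
      constructor
      · rintro (((h | h) | h) | h)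
        · exact .inf_left h
        · exact .inf_right h
        · exact .sup_left h
        · exact .sup_right h
      · intro h
        cases h with
        | inf_left h => exact Or.inl (Or.inl (Or.inl h))
        | inf_right h => exact Or.inl (Or.inl (Or.inr h))
        | sup_left h => exact Or.inl (Or.inr h)
        | sup_right h => exact Or.inr h
    | inf c d ihc ihd =>
      simp only [leB, leInf, Bool.and_eq_true] at *
      rw [ihc, ihd, W.inf_iff]

instance {α : Type*} [DecidableEq α] (p q : FTerm α) : Decidable (W p q) :=
  decidable_of_iff _ (leB_iff p q)

end FTerm

namespace Six
open FTerm

/-- Four generators, arranged in two dual pairs. -/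
abbrev A := Bool × Bool

/-- The dual automorphism of the free lattice over `A` swapping the members of each pair. -/
def tau (t : FTerm A) : FTerm A := t.dual.bind (fun a => var (a.1, !a.2))

theorem tau_tau (t : FTerm A) : tau (tau t) = t := by
  unfold tau
  rw [dual_bind, dual_dual, bind_bind]
  simp [FTerm.dual, FTerm.bind, bind_var]

theorem tau_W {s t : FTerm A} (h : W s t) : W (tau t) (tau s) := h.dual.bind _

abbrev x : FTerm A := var (false, false)
abbrev y : FTerm A := var (true, false)
abbrev z : FTerm A := var (false, true)
abbrev w : FTerm A := var (true, true)

/-- The first two pairs. -/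
def e : A → FTerm A
  | (false, false) => sup x (inf y w)
  | (true, false) => sup x (inf y (sup x z))
  | (false, true) => tau (sup x (inf y w))
  | (true, true) => tau (sup x (inf y (sup x z)))

/-- The third pair. -/
def r : Bool → FTerm A
  | false => sup x (inf w (sup x z))
  | true => tau (sup x (inf w (sup x z)))

def six : Bool ⊕ A → FTerm A := Sum.elim r e

def others (i : Bool ⊕ A) : FTerm A :=
  match i with
  | .inl false => sup (r true) (sup (sup (e (false, false)) (e (false, true))) (sup (e (true, false)) (e (true, true))))
  | .inl true => sup (r false) (sup (sup (e (false, false)) (e (false, true))) (sup (e (true, false)) (e (true, true))))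
  | .inr (false, false) => sup (sup (r false) (r true)) (sup (e (false, true)) (sup (e (true, false)) (e (true, true))))
  | .inr (false, true) => sup (sup (r false) (r true)) (sup (e (false, false)) (sup (e (true, false)) (e (true, true))))
  | .inr (true, false) => sup (sup (r false) (r true)) (sup (sup (e (false, false)) (e (false, true))) (e (true, true)))
  | .inr (true, true) => sup (sup (r false) (r true)) (sup (sup (e (false, false)) (e (false, true))) (e (true, false)))

def flip : Bool ⊕ A → Bool ⊕ A
  | .inl s => .inl (!s)
  | .inr a => .inr (a.1, !a.2)

theorem others_ge : ∀ i j : Bool ⊕ A, j ≠ i → W (six j) (others i) := by decide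
theorem others_not : ∀ i : Bool ⊕ A, ¬ W (six i) (others i) := by decide

theorem e_flip (a : A) : tau (e a) = e (a.1, !a.2) := by
  rcases a with ⟨_ | _, _ | _⟩ <;> first | rfl | exact tau_tau _

theorem r_flip (s : Bool) : tau (r s) = r (!s) := by
  rcases s with _ | _ <;> first | rfl | exact tau_tau _

theorem six_flip (i : Bool ⊕ A) : tau (six i) = six (flip i) := by
  rcases i with s | a
  · exact r_flip s
  · exact e_flip a

theorem flip_flip (i) : flip (flip i) = i := by
  rcases i with s | ⟨a, b⟩ <;> simp [flip]

/-- Filters from ideals, by duality. -/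
theorem filter_of_ideal {ρ : Type*} {f : ρ → FTerm A} {fl : ρ → ρ} (hfl : ∀ i, fl (fl i) = i)
    (hf : ∀ i, tau (f i) = f (fl i))
    (hI : ∀ i, ∃ I : FTerm A → Prop, (∀ a b, I a → I b → I (.sup a b)) ∧
      (∀ a b, FTerm.W a b → I b → I a) ∧ (∀ j, j ≠ i → I (f j)) ∧ ¬ I (f i)) :
    ∀ i, ∃ I : FTerm A → Prop, (∀ a b, I a → I b → I (.inf a b)) ∧
      (∀ a b, FTerm.W b a → I b → I a) ∧ (∀ j, j ≠ i → I (f j)) ∧ ¬ I (f i) := by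
  intro i
  obtain ⟨I, h1, h2, h3, h4⟩ := hI (fl i)
  refine ⟨fun t => I (tau t), fun a b ha hb => h1 _ _ ha hb,
    fun a b h hb => h2 _ _ (tau_W h) hb, ?_, ?_⟩
  · intro j hj
    rw [hf]
    exact h3 _ (fun h => hj (by rw [← hfl j, h, hfl]))
  · change ¬ I (tau (f i)); rw [hf]; exact h4

theorem six_free (p q : FTerm (Bool ⊕ A)) (h : W (p.bind six) (q.bind six)) : W p q := by
  have hI : ∀ i, ∃ I : FTerm A → Prop, (∀ a b, I a → I b → I (.sup a b)) ∧
      (∀ a b, FTerm.W a b → I b → I a) ∧ (∀ j, j ≠ i → I (six j)) ∧ ¬ I (six i) := fun i =>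
    ⟨fun t => W t (others i), fun a b ha hb => .sup_le ha hb, fun a b h hb => h.trans hb,
      fun j hj => others_ge i j hj, others_not i⟩
  exact term_free_of_sep hI (filter_of_ideal flip_flip six_flip hI) p q h

/-- The infinite free family. -/
def R : ℕ → Bool → FTerm A
  | 0, s => r s
  | k + 1, s => (R k s).bind e

theorem R_flip (k : ℕ) (s : Bool) : tau (R k s) = R k (!s) := by
  induction k with
  | zero => exact r_flip s
  | succ k ih =>
    have h1 : ∀ t : FTerm A, tau (t.bind e) = (tau t).bind e := by
      intro t
      unfold tau
      rw [dual_bind, bind_bind, bind_bind]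
      congr 1
      funext a
      exact e_flip a
    change tau ((R k s).bind e) = (R k (!s)).bind e
    rw [h1, ih]

theorem kill (p q : FTerm A)
    (h : W (p.bind (fun a => var (Sum.inr a)))
      (sup (sup (var (Sum.inl false)) (var (Sum.inl true)))
        (q.bind (fun a => var (Sum.inr a))) : FTerm (Bool ⊕ A))) : W p q := by
  -- send the two extra generators to a new bottom element
  let g : Bool ⊕ A → WithBot (FLq A) := Sum.elim (fun _ => ⊥) (fun a => (FLq.mk (var a) : FLq A))
  have h1 := h.sound g
  have key : ∀ t : FTerm A, (t.bind (fun a => var (Sum.inr a : Bool ⊕ A))).eval g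
      = ((FLq.mk t : FLq A) : WithBot (FLq A)) := by
    intro t
    rw [eval_bind]
    induction t with
    | var a => rfl
    | sup a b iha ihb =>
      rw [FLq.mk_sup, WithBot.coe_sup, ← iha, ← ihb]; rfl
    | inf a b iha ihb =>
      rw [FLq.mk_inf, WithBot.coe_inf, ← iha, ← ihb]; rfl
  simp only [FTerm.eval] at h1
  rw [key, key] at h1
  simp only [g, Sum.elim_inl, bot_sup_eq, WithBot.coe_le_coe] at h1
  exact h1

theorem R_ideal (k : ℕ) : ∀ s : Bool, ∃ I : FTerm A → Prop, (∀ a b, I a → I b → I (.sup a b)) ∧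
      (∀ a b, FTerm.W a b → I b → I a) ∧
      (∀ j t, (j, t) ≠ (k, s) → I (R j t)) ∧ ¬ I (R k s) := by
  induction k with
  | zero =>
    intro s
    refine ⟨fun t => W t (others (.inl s)), fun a b ha hb => .sup_le ha hb,
      fun a b h hb => h.trans hb, ?_, others_not (.inl s)⟩
    intro j t hj
    cases j with
    | zero =>
      exact others_ge (.inl s) (.inl t) (by rintro ⟨⟩; exact hj rfl)
    | succ j =>
      change W ((R j t).bind e) _
      have : ∀ u : FTerm A, W (u.bind e) (others (.inl s)) := by
        intro u
        induction u with
        | var a => exact others_ge (.inl s) (.inr a) (by simp)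
        | sup a b iha ihb => exact .sup_le iha ihb
        | inf a b iha ihb => exact .inf_left iha
      exact this _
  | succ k ih =>
    intro s
    obtain ⟨I, h1, h2, h3, h4⟩ := ih s
    refine ⟨fun u => ∃ t, I t ∧ W u (sup (sup (r false) (r true)) (t.bind e)), ?_, ?_, ?_, ?_⟩
    · rintro a b ⟨t, ht, hat⟩ ⟨t', ht', hbt⟩
      refine ⟨sup t t', h1 _ _ ht ht', .sup_le ?_ ?_⟩
      · exact hat.trans (.sup_le (.sup_left (.refl _)) (.sup_right (.sup_left (.refl _))))
      · exact hbt.trans (.sup_le (.sup_left (.refl _)) (.sup_right (.sup_right (.refl _))))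
    · rintro a b h ⟨t, ht, hbt⟩
      exact ⟨t, ht, h.trans hbt⟩
    · intro j t hj
      cases j with
      | zero =>
        refine ⟨R (k + 1) false, h3 _ _ (by simp), .sup_left ?_⟩
        cases t with
        | false => exact .sup_left (.refl _)
        | true => exact .sup_right (.refl _)
      | succ j =>
        refine ⟨R j t, h3 _ _ ?_, .sup_right (.refl _)⟩
        intro h; apply hj
        simp only [Prod.mk.injEq] at h ⊢
        exact ⟨by rw [h.1], h.2⟩
    · rintro ⟨t, ht, h⟩
      apply h4
      refine h2 _ _ (kill _ t (six_free _ _ ?_)) ht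
      simp only [FTerm.bind]
      rw [bind_bind, bind_bind]
      exact h

def Rf : ℕ × Bool → FTerm A := fun i => R i.1 i.2

theorem Rf_free (p q : FTerm (ℕ × Bool)) (h : W (p.bind Rf) (q.bind Rf)) : W p q := by
  have hI : ∀ i, ∃ I : FTerm A → Prop, (∀ a b, I a → I b → I (.sup a b)) ∧
      (∀ a b, FTerm.W a b → I b → I a) ∧ (∀ j, j ≠ i → I (Rf j)) ∧ ¬ I (Rf i) := by
    rintro ⟨k, s⟩
    obtain ⟨I, h1, h2, h3, h4⟩ := R_ideal k s
    exact ⟨I, h1, h2, fun j hj => h3 _ _ hj, h4⟩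
  exact term_free_of_sep hI (filter_of_ideal (fl := fun i => (i.1, !i.2)) (by simp)
    (fun i => R_flip i.1 i.2) hI) p q h

end Six

namespace Sym
set_option linter.unusedSectionVars false
variable {L : Type*} [Lattice L]

/-- Whitman-type statement for `u` with meetands `C`. -/
def MI (u : L) (C : Set L) : Prop :=
  ∀ a b, u ≤ a ⊔ b → (∃ c ∈ C, c ≤ a ⊔ b) ∨ u ≤ a ∨ u ≤ b

theorem MI.sup' {u : L} {C : Set L} (h : MI u C) {ι : Type*} (s : Finset ι) (hs : s.Nonempty)
    (g : ι → L) (hu : u ≤ s.sup' hs g) : (∃ c ∈ C, c ≤ s.sup' hs g) ∨ ∃ l ∈ s, u ≤ g l := by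
  induction hs using Finset.Nonempty.cons_induction with
  | singleton a => exact Or.inr ⟨a, by simp, by simpa using hu⟩
  | cons a s ha hs ih =>
    rw [Finset.sup'_cons hs] at hu ⊢
    rcases h _ _ hu with h1 | h1 | h1
    · exact Or.inl h1
    · exact Or.inr ⟨a, by simp, h1⟩
    · rcases ih h1 with ⟨c, hc, h2⟩ | ⟨l, hl, h2⟩
      · exact Or.inl ⟨c, hc, h2.trans le_sup_right⟩
      · exact Or.inr ⟨l, by simp [hl], h2⟩

theorem MI_inf' (hW : ∀ a b c d : L, a ⊓ b ≤ c ⊔ d → a ≤ c ⊔ d ∨ b ≤ c ⊔ d ∨ a ⊓ b ≤ c ∨ a ⊓ b ≤ d)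
    {ι : Type*} (s : Finset ι) (hs : s.Nonempty) (g : ι → L) : MI (s.inf' hs g) (g '' s) := by
  intro a b h
  induction hs using Finset.Nonempty.cons_induction with
  | singleton i => exact Or.inl ⟨g i, by simp, by simpa using h⟩
  | cons i s hi hs ih =>
    rw [Finset.inf'_cons hs] at h ⊢
    rcases hW _ _ _ _ h with h1 | h1 | h1 | h1
    · exact Or.inl ⟨g i, by simp, h1⟩
    · rcases ih h1 with ⟨c, ⟨j, hj, rfl⟩, h2⟩ | h2 | h2
      · exact Or.inl ⟨g j, ⟨j, by simp at hj; simp [hj], rfl⟩, h2⟩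
      · exact Or.inr (Or.inl (inf_le_right.trans h2))
      · exact Or.inr (Or.inr (inf_le_right.trans h2))
    · exact Or.inr (Or.inl h1)
    · exact Or.inr (Or.inr h1)

section
variable {ι : Type*} [Fintype ι] [DecidableEq ι] [Nontrivial ι]

theorem er_ne (i : ι) : (Finset.univ.erase i : Finset ι).Nonempty := by
  obtain ⟨j, hj⟩ := exists_ne i
  exact ⟨j, by simp [hj]⟩

def osup (f : ι → L) (i : ι) : L := (Finset.univ.erase i).sup' (er_ne i) f
def oinf (f : ι → L) (i : ι) : L := (Finset.univ.erase i).inf' (er_ne i) f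
def asup (f : ι → L) : L := Finset.univ.sup' Finset.univ_nonempty f
def ainf (f : ι → L) : L := Finset.univ.inf' Finset.univ_nonempty f

def c (x : ι → L) (i : ι) : L := x i ⊓ osup x i
def d (x : ι → L) (i : ι) : L := x i ⊔ oinf x i
def m (x : ι → L) (i : ι) : L := oinf (d x) i
def k (x : ι → L) (i : ι) : L := osup (c x) i
def al1 (x : ι → L) : L := asup (m x)
def be1 (x : ι → L) : L := ainf (k x)
def al2 (x : ι → L) : L := asup (fun i => d x i ⊓ k x i)
def be2 (x : ι → L) : L := ainf (fun i => c x i ⊔ m x i)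

def v (x : ι → L) : Bool × Bool → L
  | (false, false) => al1 x
  | (false, true) => be1 x
  | (true, false) => al2 x
  | (true, true) => be2 x

theorem le_osup (f : ι → L) {i j : ι} (h : j ≠ i) : f j ≤ osup f i :=
  Finset.le_sup' f (by simp [h])
theorem oinf_le (f : ι → L) {i j : ι} (h : j ≠ i) : oinf f i ≤ f j :=
  Finset.inf'_le f (by simp [h])
theorem le_asup (f : ι → L) (j : ι) : f j ≤ asup f := Finset.le_sup' f (by simp)
theorem ainf_le (f : ι → L) (j : ι) : ainf f ≤ f j := Finset.inf'_le f (by simp)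

theorem v_dual (x : ι → L) (a : Bool × Bool) :
    v (fun i => OrderDual.toDual (x i)) a = OrderDual.toDual (v x (a.1, !a.2)) := by
  rcases a with ⟨_ | _, _ | _⟩ <;> rfl

section map
variable {M : Type*} [Lattice M] (e : L ≃o M)

theorem map_osup (f : ι → L) : ∀ i, e (osup f i) = osup (fun i => e (f i)) i := fun i =>
  Finset.apply_sup'_eq_sup'_comp _ e (fun _ _ => map_sup e _ _)
theorem map_oinf (f : ι → L) : ∀ i, e (oinf f i) = oinf (fun i => e (f i)) i := fun i =>
  map_osup (L := Lᵒᵈ) (M := Mᵒᵈ) e.dual f i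
theorem map_asup (f : ι → L) : e (asup f) = asup (fun i => e (f i)) :=
  Finset.apply_sup'_eq_sup'_comp _ e (fun _ _ => map_sup e _ _)
theorem map_ainf (f : ι → L) : e (ainf f) = ainf (fun i => e (f i)) :=
  map_asup (L := Lᵒᵈ) (M := Mᵒᵈ) e.dual f

theorem v_map (x : ι → L) (a : Bool × Bool) : e (v x a) = v (fun i => e (x i)) a := by
  have hc : ∀ i, e (c x i) = c (fun i => e (x i)) i := fun i => by
    simp only [c, map_inf, map_osup]
  have hd : ∀ i, e (d x i) = d (fun i => e (x i)) i := fun i => by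
    simp only [d, map_sup, map_oinf]
  have hm : ∀ i, e (m x i) = m (fun i => e (x i)) i := fun i => by
    simp only [m, map_oinf, hd]
  have hk : ∀ i, e (k x i) = k (fun i => e (x i)) i := fun i => by
    simp only [k, map_osup, hc]
  rcases a with ⟨_ | _, _ | _⟩
  · simp only [v, al1, map_asup, hm]
  · simp only [v, be1, map_ainf, hk]
  · simp only [v, al2, map_asup, hd, hk, map_inf]
  · simp only [v, be2, map_ainf, hm, hc, map_sup]
end map

theorem perm_osup (σ : ι ≃ ι) (f : ι → L) (i : ι) : osup (fun i => f (σ i)) i = osup f (σ i) := by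
  apply le_antisymm
  · exact Finset.sup'_le _ _ fun j hj => le_osup f (by simpa using hj)
  · refine Finset.sup'_le _ _ fun j hj => ?_
    have := le_osup (fun i => f (σ i)) (i := i) (j := σ.symm j)
      (by simpa [Equiv.symm_apply_eq] using hj)
    simpa using this
theorem perm_oinf (σ : ι ≃ ι) (f : ι → L) (i : ι) : oinf (fun i => f (σ i)) i = oinf f (σ i) :=
  perm_osup (L := Lᵒᵈ) σ f i
theorem perm_asup (σ : ι ≃ ι) (f : ι → L) : asup (fun i => f (σ i)) = asup f := by
  apply le_antisymm
  · exact Finset.sup'_le _ _ fun j hj => le_asup f _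
  · refine Finset.sup'_le _ _ fun j hj => ?_
    simpa using le_asup (fun i => f (σ i)) (σ.symm j)
theorem perm_ainf (σ : ι ≃ ι) (f : ι → L) : ainf (fun i => f (σ i)) = ainf f :=
  perm_asup (L := Lᵒᵈ) σ f

theorem v_perm (σ : ι ≃ ι) (x : ι → L) (a : Bool × Bool) : v (fun i => x (σ i)) a = v x a := by
  have hc : ∀ i, c (fun i => x (σ i)) i = c x (σ i) := fun i => by
    simp only [c, perm_osup]
  have hd : ∀ i, d (fun i => x (σ i)) i = d x (σ i) := fun i => by
    simp only [d, perm_oinf]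
  have hm : ∀ i, m (fun i => x (σ i)) i = m x (σ i) := fun i => by
    unfold m; rw [← perm_oinf]; congr 1; funext i; exact hd i
  have hk : ∀ i, k (fun i => x (σ i)) i = k x (σ i) := fun i => by
    unfold k; rw [← perm_osup]; congr 1; funext i; exact hc i
  rcases a with ⟨_ | _, _ | _⟩
  · simp only [v, al1]; rw [← perm_asup σ (m x)]; exact congrArg asup (funext hm)
  · simp only [v, be1]; rw [← perm_ainf σ (k x)]; exact congrArg ainf (funext hk)
  · simp only [v, al2]; rw [← perm_asup σ (fun i => d x i ⊓ k x i)]; simp only [hd, hk]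
  · simp only [v, be2]; rw [← perm_ainf σ (fun i => c x i ⊔ m x i)]; simp only [hm, hc]

section free
variable {x : ι → L} (hx : FreeGen x) (h3 : ∀ i l : ι, ∃ j, j ≠ i ∧ j ≠ l)
include hx

theorem gen_MI (i : ι) : MI (x i) ∅ := fun a b h => Or.inr (hx.gen_sup i a b h)
theorem le_gen_MI (i : ι) : MI (L := Lᵒᵈ) (OrderDual.toDual (x i)) ∅ :=
  fun a b h => Or.inr (hx.inf_gen i a b h)

theorem g_sup (i : ι) (a b : L) : x i ≤ a ⊔ b ↔ x i ≤ a ∨ x i ≤ b :=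
  ⟨hx.gen_sup i a b, fun h => h.elim (fun h => h.trans le_sup_left) (fun h => h.trans le_sup_right)⟩
theorem g_asup (i : ι) (f : ι → L) : x i ≤ asup f ↔ ∃ j, x i ≤ f j := by
  constructor
  · intro h
    rcases (gen_MI hx i).sup' _ _ _ h with ⟨_, h, _⟩ | ⟨l, _, h⟩
    · exact h.elim
    · exact ⟨l, h⟩
  · rintro ⟨j, h⟩; exact h.trans (le_asup _ _)
theorem g_osup (i l : ι) (f : ι → L) : x i ≤ osup f l ↔ ∃ j, j ≠ l ∧ x i ≤ f j := by
  constructor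
  · intro h
    rcases (gen_MI hx i).sup' _ _ _ h with ⟨_, h, _⟩ | ⟨l, hl, h⟩
    · exact h.elim
    · exact ⟨l, by simpa using hl, h⟩
  · rintro ⟨j, hj, h⟩; exact h.trans (le_osup _ hj)
omit hx in
theorem g_ainf (u : L) (f : ι → L) : u ≤ ainf f ↔ ∀ j, u ≤ f j := by
  simp [ainf]
omit hx in
theorem g_oinf (u : L) (l : ι) (f : ι → L) : u ≤ oinf f l ↔ ∀ j, j ≠ l → u ≤ f j := by
  simp [oinf]
theorem inf_g (i : ι) (a b : L) : a ⊓ b ≤ x i ↔ a ≤ x i ∨ b ≤ x i := g_sup (L := Lᵒᵈ) hx.dual i a b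
theorem ainf_g (i : ι) (f : ι → L) : ainf f ≤ x i ↔ ∃ j, f j ≤ x i :=
  g_asup (L := Lᵒᵈ) hx.dual i f
theorem oinf_g (i l : ι) (f : ι → L) : oinf f l ≤ x i ↔ ∃ j, j ≠ l ∧ f j ≤ x i :=
  g_osup (L := Lᵒᵈ) hx.dual i l f
omit hx in
theorem asup_g (u : L) (f : ι → L) : asup f ≤ u ↔ ∀ j, f j ≤ u := by
  simp [asup]
omit hx in
theorem osup_g (u : L) (l : ι) (f : ι → L) : osup f l ≤ u ↔ ∀ j, j ≠ l → f j ≤ u := by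
  simp [osup]

theorem gg (i j : ι) : x i ≤ x j ↔ i = j := FreeFam.le_iff hx.free

include h3

theorem gc (i l : ι) : ¬ x i ≤ c x l := by
  simp only [c, le_inf_iff, g_osup hx, gg hx]
  rintro ⟨rfl, j, h, rfl⟩; exact h rfl
theorem gd (i l : ι) : x i ≤ d x l ↔ i = l := by
  simp only [d, g_sup hx, g_oinf, gg hx, or_iff_left_iff_imp]
  intro h
  obtain ⟨j, hj, hj'⟩ := h3 l i
  exact absurd (h j hj).symm hj'
theorem gm (i l : ι) : ¬ x i ≤ m x l := by
  simp only [m, g_oinf, gd hx h3]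
  intro h
  obtain ⟨j, hj, hj'⟩ := h3 l i
  exact absurd (h j hj).symm hj'
theorem gk (i l : ι) : ¬ x i ≤ k x l := by
  simp only [k, g_osup hx, gc hx h3, and_false, exists_false, not_false_eq_true]
theorem gal1 (i : ι) : ¬ x i ≤ al1 x := by
  simp only [al1, g_asup hx, gm hx h3, exists_false, not_false_eq_true]
theorem gbe1 (i : ι) : ¬ x i ≤ be1 x := by
  simp only [be1, g_ainf, gk hx h3, forall_const, not_false_eq_true]
theorem gal2 (i : ι) : ¬ x i ≤ al2 x := by
  simp only [al2, g_asup hx, le_inf_iff, gk hx h3, and_false, exists_false, not_false_eq_true]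
theorem gbe2 (i : ι) : ¬ x i ≤ be2 x := by
  simp only [be2, g_ainf, g_sup hx, gc hx h3, gm hx h3, or_false, forall_const, not_false_eq_true]

theorem dg (i l : ι) : ¬ d x l ≤ x i := gc (L := Lᵒᵈ) hx.dual h3 i l
theorem cg (i l : ι) : c x l ≤ x i ↔ i = l := gd (L := Lᵒᵈ) hx.dual h3 i l
theorem kg (i l : ι) : ¬ k x l ≤ x i := gm (L := Lᵒᵈ) hx.dual h3 i l
theorem mg (i l : ι) : ¬ m x l ≤ x i := gk (L := Lᵒᵈ) hx.dual h3 i l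
theorem be1g (i : ι) : ¬ be1 x ≤ x i := gal1 (L := Lᵒᵈ) hx.dual h3 i
theorem be2g (i : ι) : ¬ be2 x ≤ x i := gal2 (L := Lᵒᵈ) hx.dual h3 i
theorem dkg (i l : ι) : ¬ d x l ⊓ k x l ≤ x i := by
  simp only [inf_g hx, dg hx h3, kg hx h3, or_self, not_false_eq_true]

omit h3

theorem MI_dk (i : ι) : MI (d x i ⊓ k x i) {d x i, k x i} := by
  intro a b h
  rcases hx.whit _ _ _ _ h with h | h | h | h
  · exact Or.inl ⟨_, by simp, h⟩
  · exact Or.inl ⟨_, by simp, h⟩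
  · exact Or.inr (Or.inl h)
  · exact Or.inr (Or.inr h)

theorem MI_c (i : ι) : MI (c x i) {x i, osup x i} := by
  intro a b h
  rcases hx.whit _ _ _ _ h with h | h | h | h
  · exact Or.inl ⟨_, by simp, h⟩
  · exact Or.inl ⟨_, by simp, h⟩
  · exact Or.inr (Or.inl h)
  · exact Or.inr (Or.inr h)

theorem MI_m (i : ι) : MI (m x i) {u | ∃ j, j ≠ i ∧ u = d x j} := by
  intro a b h
  rcases MI_inf' hx.whit _ (er_ne i) _ _ _ h with ⟨_, ⟨j, hj, rfl⟩, h⟩ | h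
  · exact Or.inl ⟨_, ⟨j, by simpa using hj, rfl⟩, h⟩
  · exact Or.inr h

theorem MI_be1 : MI (be1 x) {u | ∃ j, u = k x j} := by
  intro a b h
  rcases MI_inf' hx.whit _ Finset.univ_nonempty _ _ _ h with ⟨_, ⟨j, hj, rfl⟩, h⟩ | h
  · exact Or.inl ⟨_, ⟨j, rfl⟩, h⟩
  · exact Or.inr h

theorem MI_be2 : MI (be2 x) {u | ∃ j, u = c x j ⊔ m x j} := by
  intro a b h
  rcases MI_inf' hx.whit _ Finset.univ_nonempty _ _ _ h with ⟨_, ⟨j, hj, rfl⟩, h⟩ | h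
  · exact Or.inl ⟨_, ⟨j, rfl⟩, h⟩
  · exact Or.inr h

omit hx in
theorem MI.asup {u : L} {C : Set L} (h : MI u C) {g : ι → L} (hu : u ≤ asup g) :
    (∃ c ∈ C, c ≤ Sym.asup g) ∨ ∃ l, u ≤ g l := by
  rcases h.sup' _ _ _ hu with h | ⟨l, _, h⟩
  · exact Or.inl h
  · exact Or.inr ⟨l, h⟩

omit hx in
theorem MI.osup {u : L} {C : Set L} (h : MI u C) {g : ι → L} {i : ι} (hu : u ≤ osup g i) :
    (∃ c ∈ C, c ≤ Sym.osup g i) ∨ ∃ l, l ≠ i ∧ u ≤ g l := by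
  rcases h.sup' _ _ _ hu with h | ⟨l, hl, h⟩
  · exact Or.inl h
  · exact Or.inr ⟨l, by simpa using hl, h⟩

omit hx in
theorem MI.sup3 {u : L} {C : Set L} (h : MI u C) {p q r : L} (hu : u ≤ p ⊔ q ⊔ r) :
    (∃ c ∈ C, c ≤ p ⊔ q ⊔ r) ∨ u ≤ p ∨ u ≤ q ∨ u ≤ r := by
  rcases h _ _ hu with h1 | h1 | h1
  · exact Or.inl h1
  · rcases h _ _ h1 with ⟨c, hc, h2⟩ | h2 | h2
    · exact Or.inl ⟨c, hc, h2.trans le_sup_left⟩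
    · exact Or.inr (Or.inl h2)
    · exact Or.inr (Or.inr (Or.inl h2))
  · exact Or.inr (Or.inr (Or.inr h1))

include h3

/-- the meetands of `c j` are not below `R` if some other generator and `x j` are not. -/
theorem c_no {j : ι} {R : L} (h1 : ¬ x j ≤ R) {t : ι} (ht : t ≠ j) (h2 : ¬ x t ≤ R) :
    ¬ ∃ w ∈ ({x j, osup x j} : Set L), w ≤ R := by
  rintro ⟨w, rfl | rfl, h⟩
  · exact h1 h
  · exact h2 ((le_osup x ht).trans h)

theorem c_d {j l : ι} (h : l ≠ j) : ¬ c x j ≤ d x l := by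
  intro hh
  obtain ⟨t, ht, ht'⟩ := h3 j l
  rcases MI_c hx j _ _ hh with h1 | h1 | h1
  · exact c_no hx h3 (by rw [← d, gd hx h3]; exact h.symm) ht (by rw [← d, gd hx h3]; exact ht') h1
  · rw [cg hx h3] at h1; exact h h1
  · have := h1.trans (oinf_le x ht')
    rw [cg hx h3] at this; exact ht this

theorem c_k (j : ι) : ¬ c x j ≤ k x j := by
  intro hh
  obtain ⟨t, ht, -⟩ := h3 j j
  rcases (MI_c hx j).osup hh with h1 | ⟨l, hl, h1⟩
  · exact c_no hx h3 (gk hx h3 _ j) ht (gk hx h3 _ j) h1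
  · have := h1.trans inf_le_left
    rw [cg hx h3] at this; exact hl this

theorem c_m (j l : ι) : ¬ c x j ≤ m x l := by
  intro hh
  obtain ⟨t, ht, ht'⟩ := h3 l j
  exact c_d hx h3 ht' (hh.trans (oinf_le _ ht))

theorem c_cm {j l : ι} (h : l ≠ j) : ¬ c x j ≤ c x l ⊔ m x l := by
  intro hh
  obtain ⟨t, ht, -⟩ := h3 j j
  rcases MI_c hx j _ _ hh with h1 | h1 | h1
  · exact c_no hx h3 (by rw [g_sup hx]; simp [gc hx h3, gm hx h3]) ht
      (by rw [g_sup hx]; simp [gc hx h3, gm hx h3]) h1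
  · have := h1.trans inf_le_left
    rw [cg hx h3] at this; exact h this
  · exact c_m hx h3 _ _ h1

theorem c_be2 (j : ι) : ¬ c x j ≤ be2 x := by
  intro h
  obtain ⟨l, hl, -⟩ := h3 j j
  exact c_cm hx h3 hl (h.trans (ainf_le _ l))
theorem c_be1 (j : ι) : ¬ c x j ≤ be1 x := fun h => c_k hx h3 j (h.trans (ainf_le _ j))

theorem d_no {j : ι} {R : L} (h : ¬ x j ≤ R) : ¬ d x j ≤ R := fun hh => h (le_sup_left.trans hh)

theorem c_al1 (j : ι) : ¬ c x j ≤ al1 x := by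
  intro hh
  obtain ⟨t, ht, -⟩ := h3 j j
  rcases (MI_c hx j).asup hh with h1 | ⟨l, h1⟩
  · exact c_no hx h3 (gal1 hx h3 _) ht (gal1 hx h3 _) h1
  · exact c_m hx h3 _ _ h1

theorem c_al2 (j : ι) : ¬ c x j ≤ al2 x := by
  intro hh
  obtain ⟨t, ht, -⟩ := h3 j j
  rcases (MI_c hx j).asup hh with h1 | ⟨l, h1⟩
  · exact c_no hx h3 (gal2 hx h3 _) ht (gal2 hx h3 _) h1
  · by_cases h : l = j
    · subst h; exact c_k hx h3 _ (h1.trans inf_le_right)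
    · exact c_d hx h3 h (h1.trans inf_le_left)

theorem m_k (i l : ι) : ¬ m x i ≤ k x l := by
  intro hh
  rcases (MI_m hx i).osup hh with ⟨_, ⟨j, _, rfl⟩, h⟩ | ⟨t, _, h⟩
  · exact d_no hx h3 (gk hx h3 _ _) h
  · exact mg hx h3 t i (h.trans inf_le_left)

theorem m_d (i : ι) : ¬ m x i ≤ d x i := by
  intro hh
  rcases MI_m hx i _ _ hh with ⟨_, ⟨j, hj, rfl⟩, h⟩ | h | h
  · exact d_no hx h3 (R := d x i) (by rw [gd hx h3]; exact hj) h
  · exact mg hx h3 _ i h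
  · obtain ⟨t, ht, -⟩ := h3 i i
    exact mg hx h3 t i (h.trans (oinf_le x ht))

theorem k_no {i l : ι} {R : L} (h : ∀ j, j ≠ l → ¬ c x j ≤ R) : ¬ k x i ≤ R := by
  obtain ⟨j, hj, hj'⟩ := h3 i l
  exact fun hh => h j hj' ((le_osup _ hj).trans hh)

theorem be1_d (t : ι) : ¬ be1 x ≤ d x t := by
  intro hh
  rcases MI_be1 hx _ _ hh with ⟨_, ⟨j, rfl⟩, h⟩ | h | h
  · exact k_no hx h3 (l := t) (R := d x t) (fun j hj => c_d hx h3 hj.symm) h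
  · exact be1g hx h3 _ h
  · obtain ⟨s, hs, -⟩ := h3 t t
    exact be1g hx h3 s (h.trans (oinf_le x hs))
theorem be1_m (l : ι) : ¬ be1 x ≤ m x l := by
  intro hh
  obtain ⟨s, hs, -⟩ := h3 l l
  exact be1_d hx h3 s (hh.trans (oinf_le _ hs))

theorem C1 : ¬ al1 x ≤ be1 x ⊔ al2 x ⊔ be2 x := by
  intro hh
  obtain ⟨i, -⟩ := exists_pair_ne ι
  have hg : ∀ j, ¬ x j ≤ be1 x ⊔ al2 x ⊔ be2 x := fun j => by
    simp [g_sup hx, gbe1 hx h3, gbe2 hx h3, gal2 hx h3]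
  rcases (MI_m hx i).sup3 ((le_asup (m x) i).trans hh) with ⟨_, ⟨j, _, rfl⟩, h⟩ | h | h | h
  · exact d_no hx h3 (hg j) h
  · exact m_k hx h3 i i (h.trans (ainf_le _ i))
  · rcases (MI_m hx i).asup h with ⟨_, ⟨j, _, rfl⟩, h⟩ | ⟨l, h⟩
    · exact d_no hx h3 (gal2 hx h3 j) h
    · exact m_k hx h3 i l (h.trans inf_le_right)
  · obtain ⟨l, hl, -⟩ := h3 i i
    rcases MI_m hx i _ _ (h.trans (ainf_le _ l)) with ⟨_, ⟨j, _, rfl⟩, h⟩ | h | h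
    · exact d_no hx h3 (by simp [g_sup hx, gc hx h3, gm hx h3]) h
    · exact mg hx h3 l i (h.trans inf_le_left)
    · exact m_d hx h3 i (h.trans (oinf_le _ hl.symm))

theorem C2 : ¬ be1 x ≤ al1 x ⊔ al2 x ⊔ be2 x := by
  intro hh
  have hg : ∀ j, ¬ x j ≤ al1 x ⊔ al2 x ⊔ be2 x := fun j => by
    simp [g_sup hx, gal1 hx h3, gbe2 hx h3, gal2 hx h3]
  obtain ⟨i, -⟩ := exists_pair_ne ι
  have hc : ∀ j, ¬ c x j ≤ al1 x ⊔ al2 x ⊔ be2 x := by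
    intro j h
    obtain ⟨t, ht, -⟩ := h3 j j
    rcases (MI_c hx j).sup3 h with h | h | h | h
    · exact c_no hx h3 (hg j) ht (hg t) h
    · exact c_al1 hx h3 j h
    · exact c_al2 hx h3 j h
    · exact c_be2 hx h3 j h
  rcases (MI_be1 hx).sup3 hh with ⟨_, ⟨j, rfl⟩, h⟩ | h | h | h
  · exact k_no hx h3 (l := i) (fun j _ => hc j) h
  · rcases (MI_be1 hx).asup h with ⟨_, ⟨j, rfl⟩, h⟩ | ⟨l, h⟩
    · exact k_no hx h3 (l := i) (fun j _ => c_al1 hx h3 j) h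
    · exact be1_m hx h3 l h
  · rcases (MI_be1 hx).asup h with ⟨_, ⟨j, rfl⟩, h⟩ | ⟨l, h⟩
    · exact k_no hx h3 (l := i) (fun j _ => c_al2 hx h3 j) h
    · exact be1_d hx h3 l (h.trans inf_le_left)
  · rcases MI_be1 hx _ _ (h.trans (ainf_le _ i)) with ⟨_, ⟨j, rfl⟩, h⟩ | h | h
    · exact k_no hx h3 (l := i) (fun j hj => c_cm hx h3 hj.symm) h
    · exact be1g hx h3 i (h.trans inf_le_left)
    · exact be1_m hx h3 i h

theorem dk_d {i t : ι} (h : t ≠ i) : ¬ d x i ⊓ k x i ≤ d x t := by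
  intro hh
  rcases MI_dk hx i _ _ hh with ⟨_, rfl | rfl, h1⟩ | h1 | h1
  · exact d_no hx h3 (R := d x t) (by rw [gd hx h3]; exact h.symm) h1
  · exact k_no hx h3 (l := t) (R := d x t) (fun j hj => c_d hx h3 hj.symm) h1
  · exact dkg hx h3 _ _ h1
  · obtain ⟨s, hs, -⟩ := h3 t t
    exact dkg hx h3 s i (h1.trans (oinf_le x hs))
theorem dk_m (i l : ι) : ¬ d x i ⊓ k x i ≤ m x l := by
  intro hh
  obtain ⟨t, ht, ht'⟩ := h3 l i
  exact dk_d hx h3 ht' (hh.trans (oinf_le _ ht))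

theorem C3 : ¬ al2 x ≤ al1 x ⊔ be1 x ⊔ be2 x := by
  intro hh
  have hg : ∀ j, ¬ x j ≤ al1 x ⊔ be1 x ⊔ be2 x := fun j => by
    simp [g_sup hx, gal1 hx h3, gbe2 hx h3, gbe1 hx h3]
  obtain ⟨i, -⟩ := exists_pair_ne ι
  have hc : ∀ j, ¬ c x j ≤ al1 x ⊔ be1 x ⊔ be2 x := by
    intro j h
    obtain ⟨t, ht, -⟩ := h3 j j
    rcases (MI_c hx j).sup3 h with h | h | h | h
    · exact c_no hx h3 (hg j) ht (hg t) h
    · exact c_al1 hx h3 j h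
    · exact c_be1 hx h3 j h
    · exact c_be2 hx h3 j h
  obtain ⟨l, hl, -⟩ := h3 i i
  rcases (MI_dk hx i).sup3 ((le_asup (fun i => d x i ⊓ k x i) i).trans hh) with
    ⟨_, rfl | rfl, h⟩ | h | h | h
  · exact d_no hx h3 (hg i) h
  · exact k_no hx h3 (l := i) (fun j _ => hc j) h
  · rcases (MI_dk hx i).asup h with ⟨_, rfl | rfl, h⟩ | ⟨l, h⟩
    · exact d_no hx h3 (gal1 hx h3 i) h
    · exact k_no hx h3 (l := i) (fun j _ => c_al1 hx h3 j) h
    · exact dk_m hx h3 i l h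
  · rcases (MI_dk hx i).osup (h.trans (ainf_le _ l)) with ⟨_, rfl | rfl, h⟩ | ⟨j, _, h⟩
    · exact d_no hx h3 (gk hx h3 i l) h
    · exact c_k hx h3 l ((le_osup _ hl).trans h)
    · exact dkg hx h3 j i (h.trans inf_le_left)
  · rcases MI_dk hx i _ _ (h.trans (ainf_le _ l)) with ⟨_, rfl | rfl, h⟩ | h | h
    · exact d_no hx h3 (by simp [g_sup hx, gc hx h3, gm hx h3]) h
    · exact k_no hx h3 (l := l) (fun j hj => c_cm hx h3 hj.symm) h
    · exact dkg hx h3 l i (h.trans inf_le_left)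
    · exact dk_m hx h3 i l h

theorem be2_k (l : ι) : ¬ be2 x ≤ k x l := by
  intro hh
  rcases (MI_be2 hx).osup hh with ⟨_, ⟨j, rfl⟩, h⟩ | ⟨j, _, h⟩
  · exact m_k hx h3 j l (le_sup_right.trans h)
  · exact be2g hx h3 j (h.trans inf_le_left)

theorem be2_d (t : ι) : ¬ be2 x ≤ d x t := by
  intro hh
  rcases MI_be2 hx _ _ hh with ⟨_, ⟨j, rfl⟩, h⟩ | h | h
  · by_cases hj : t = j
    · subst hj; exact m_d hx h3 t (le_sup_right.trans h)
    · exact c_d hx h3 hj (le_sup_left.trans h)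
  · exact be2g hx h3 t h
  · obtain ⟨s, hs, -⟩ := h3 t t
    exact be2g hx h3 s (h.trans (oinf_le x hs))

theorem C4 : ¬ be2 x ≤ al1 x ⊔ be1 x ⊔ al2 x := by
  intro hh
  have hg : ∀ j, ¬ x j ≤ al1 x ⊔ be1 x ⊔ al2 x := fun j => by
    simp [g_sup hx, gal1 hx h3, gal2 hx h3, gbe1 hx h3]
  obtain ⟨i, -⟩ := exists_pair_ne ι
  have hc : ∀ j, ¬ c x j ≤ al1 x ⊔ be1 x ⊔ al2 x := by
    intro j h
    obtain ⟨t, ht, -⟩ := h3 j j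
    rcases (MI_c hx j).sup3 h with h | h | h | h
    · exact c_no hx h3 (hg j) ht (hg t) h
    · exact c_al1 hx h3 j h
    · exact c_be1 hx h3 j h
    · exact c_al2 hx h3 j h
  rcases (MI_be2 hx).sup3 hh with ⟨_, ⟨j, rfl⟩, h⟩ | h | h | h
  · exact hc j (le_sup_left.trans h)
  · rcases (MI_be2 hx).asup h with ⟨_, ⟨j, rfl⟩, h⟩ | ⟨l, h⟩
    · exact c_al1 hx h3 j (le_sup_left.trans h)
    · obtain ⟨t, ht, -⟩ := h3 l l
      exact be2_d hx h3 t (h.trans (oinf_le _ ht))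
  · exact be2_k hx h3 i (h.trans (ainf_le _ i))
  · rcases (MI_be2 hx).asup h with ⟨_, ⟨j, rfl⟩, h⟩ | ⟨l, h⟩
    · exact c_al2 hx h3 j (le_sup_left.trans h)
    · exact be2_k hx h3 l (h.trans inf_le_right)

theorem v_ideal (i : Bool × Bool) : ∃ I : L → Prop, (∀ a b, I a → I b → I (a ⊔ b)) ∧
    (∀ a b, a ≤ b → I b → I a) ∧ (∀ j, j ≠ i → I (v x j)) ∧ ¬ I (v x i) := by
  suffices h : ∃ R, (∀ j, j ≠ i → v x j ≤ R) ∧ ¬ v x i ≤ R by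
    obtain ⟨R, h1, h2⟩ := h
    exact ⟨fun u => u ≤ R, fun a b => sup_le, fun a b => le_trans, h1, h2⟩
  rcases i with ⟨_ | _, _ | _⟩
  · refine ⟨_, ?_, C1 hx h3⟩
    rintro ⟨_ | _, _ | _⟩ h
    · exact absurd rfl h
    · exact le_sup_left.trans le_sup_left
    · exact le_sup_right.trans le_sup_left
    · exact le_sup_right
  · refine ⟨_, ?_, C2 hx h3⟩
    rintro ⟨_ | _, _ | _⟩ h
    · exact le_sup_left.trans le_sup_left
    · exact absurd rfl h
    · exact le_sup_right.trans le_sup_left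
    · exact le_sup_right
  · refine ⟨_, ?_, C3 hx h3⟩
    rintro ⟨_ | _, _ | _⟩ h
    · exact le_sup_left.trans le_sup_left
    · exact le_sup_right.trans le_sup_left
    · exact absurd rfl h
    · exact le_sup_right
  · refine ⟨_, ?_, C4 hx h3⟩
    rintro ⟨_ | _, _ | _⟩ h
    · exact le_sup_left.trans le_sup_left
    · exact le_sup_right.trans le_sup_left
    · exact le_sup_right
    · exact absurd rfl h

theorem v_free : FreeFam (v x) := by
  refine freeFam_of_sep hx.whit (v_ideal hx h3) ?_
  rintro ⟨i, s⟩
  obtain ⟨I, h1, h2, h4, h5⟩ := v_ideal (L := Lᵒᵈ) hx.dual h3 (i, !s)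
  simp only [v_dual] at h4 h5
  refine ⟨fun u => I (OrderDual.toDual u), fun a b => h1 _ _, fun a b h => h2 _ _ h, ?_, ?_⟩
  · rintro ⟨j, t⟩ h
    have := h4 (j, !t) (by intro h'; apply h; simpa using h')
    simpa using this
  · simpa using h5

end free
end
end Sym

namespace Fin5

/-- An isomorphism between freely generated lattices matches the free generators. -/
theorem gen_match {L M : Type*} [Lattice L] [Lattice M] {ρ ρ' : Type*} {f : ρ → L} {g : ρ' → M}
    (hf : FreeGen f) (hg : FreeGen g) (e : L ≃o M) : ∃ σ : ρ ≃ ρ', ∀ i, e (f i) = g (σ i) := by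
  have h1 : ∀ i, ∃ j, g j = e (f i) := fun i => hg.dprime_iff.1 ((hf.dprime_iff.2 ⟨i, rfl⟩).map e)
  have h2 : ∀ j, ∃ i, f i = e.symm (g j) := fun j =>
    hf.dprime_iff.1 ((hg.dprime_iff.2 ⟨j, rfl⟩).map e.symm)
  choose s hs using h1
  choose t ht using h2
  refine ⟨⟨s, t, fun i => ?_, fun j => ?_⟩, fun i => (hs i).symm⟩
  · apply hf.free.injective; rw [ht, hs]; simp
  · apply hg.free.injective; rw [hs, ht]; simp

section
variable {F : Type*} [Lattice F] {ι : Type*} {x : ι → F}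

theorem aut_eval {α : Type*} (π : F ≃o F) (p : FTerm α) (f : α → F) :
    π (p.eval f) = p.eval (fun i => π (f i)) :=
  FTerm.eval_map π (fun _ _ => map_sup π _ _) (fun _ _ => map_inf π _ _) p f

theorem anti_eval {α : Type*} (ψ : F ≃o Fᵒᵈ) (p : FTerm α) (f : α → F) :
    OrderDual.ofDual (ψ (p.eval f)) = p.dual.eval (fun i => OrderDual.ofDual (ψ (f i))) :=
  FTerm.eval_antimap (fun u => OrderDual.ofDual (ψ u))
    (fun _ _ => congrArg OrderDual.ofDual (map_sup ψ _ _))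
    (fun _ _ => congrArg OrderDual.ofDual (map_inf ψ _ _)) p f

section fin
variable [Fintype ι] [DecidableEq ι] [Nontrivial ι]

/-- The symmetric infinite family. -/
def fam (x : ι → F) (i : ℕ × Bool) : F := (Six.Rf i).eval (Sym.v x)

theorem fam_aut (hx : FreeGen x) (π : F ≃o F) (i : ℕ × Bool) : π (fam x i) = fam x i := by
  obtain ⟨σ, hσ⟩ := gen_match hx hx π
  unfold fam
  rw [aut_eval]
  congr 1
  funext a
  rw [Sym.v_map]
  simp only [hσ]
  exact Sym.v_perm σ x a

theorem fam_anti (hx : FreeGen x) (ψ : F ≃o Fᵒᵈ) (i : ℕ × Bool) :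
    OrderDual.ofDual (ψ (fam x i)) = fam x (i.1, !i.2) := by
  obtain ⟨σ, hσ⟩ := gen_match hx hx.dual ψ
  have h : ∀ a, OrderDual.ofDual (ψ (Sym.v x a)) = Sym.v x (a.1, !a.2) := by
    intro a
    rw [Sym.v_map]
    simp only [hσ]
    rw [Sym.v_dual (fun i => x (σ i)), Sym.v_perm]
    rfl
  unfold fam
  rw [anti_eval]
  simp only [h]
  have := Six.R_flip i.1 i.2
  change _ = (Six.R i.1 (!i.2)).eval _
  rw [← this]
  unfold Six.tau
  rw [FTerm.eval_bind]
  rfl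

theorem fam_free (hx : FreeGen x) (h3 : ∀ i l : ι, ∃ j, j ≠ i ∧ j ≠ l) : FreeFam (fam x) := by
  intro p q h
  apply Six.Rf_free
  apply Sym.v_free hx h3
  rw [FTerm.eval_bind, FTerm.eval_bind]
  exact h

theorem backward {G : Type*} [Lattice G] {ρ : Type*} [Nonempty ρ] {y : ρ → G} (hy : FreeGen y)
    (hx : FreeGen x) (h3 : ∀ i l : ι, ∃ j, j ≠ i ∧ j ≠ l)
    (j : ρ → ℕ × Bool) (hj : Function.Injective j) (s : ρ → ρ)
    (hs : ∀ r, j (s r) = ((j r).1, !(j r).2)) :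
    ∃ φ : LatticeHom G F, Function.Injective φ ∧ DASymmetric (Set.range ⇑φ) := by
  have hss : ∀ r, s (s r) = r := fun r => hj (by simp [hs])
  let g : ρ → F := fun r => fam x (j r)
  have hg : FreeFam g := by
    intro p q h
    obtain ⟨t, ht⟩ := hj.hasLeftInverse
    have h1 : FTerm.W (p.bind fun r => .var (j r)) (q.bind fun r => .var (j r)) := by
      apply fam_free hx h3
      rw [FTerm.eval_bind, FTerm.eval_bind]
      exact h
    have h2 := h1.bind (fun k => .var (t k))
    rw [FTerm.bind_bind, FTerm.bind_bind] at h2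
    simp only [FTerm.bind, ht _] at h2
    have e : ∀ p : FTerm ρ, p.bind (fun i => FTerm.var i) = p := FTerm.bind_var
    rwa [e, e] at h2
  obtain ⟨φ, hφ⟩ := hy.lift g
  refine ⟨φ, hy.lift_injective hg hφ, ?_, ?_⟩
  · intro π
    have key : ∀ w, π (φ w) = φ w := by
      intro w
      obtain ⟨p, rfl⟩ := hy.surj w
      rw [hφ, aut_eval]
      congr 1
      funext r
      exact fam_aut hx π _
    ext u
    constructor
    · rintro ⟨_, ⟨w, rfl⟩, rfl⟩
      exact ⟨w, (key w).symm⟩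
    · rintro ⟨w, rfl⟩
      exact ⟨_, ⟨w, rfl⟩, key w⟩
  · intro ψ
    have hψ : ∀ r, OrderDual.ofDual (ψ (g r)) = g (s r) := by
      intro r
      simp only [g, hs]
      exact fam_anti hx ψ _
    have key : ∀ p : FTerm ρ, OrderDual.ofDual (ψ (p.eval g)) = p.dual.eval (fun r => g (s r)) := by
      intro p
      rw [anti_eval]; simp only [hψ]
    have mem : ∀ p : FTerm ρ, p.eval (fun r => g (s r)) ∈ Set.range φ := by
      intro p
      refine ⟨(p.bind (fun r => .var (s r))).eval y, ?_⟩
      rw [hφ, FTerm.eval_bind]; rfl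
    ext u
    constructor
    · rintro ⟨_, ⟨w, rfl⟩, rfl⟩
      obtain ⟨p, rfl⟩ := hy.surj w
      simp only [hφ, key]
      exact mem _
    · rintro ⟨w, rfl⟩
      obtain ⟨p, rfl⟩ := hy.surj w
      refine ⟨_, mem p.dual, ?_⟩
      simp only [anti_eval, FTerm.dual_dual, hψ, hss, hφ]
end fin
end

/-- Double primeness relative to a subset. -/
def DIn {F : Type*} [Lattice F] (S : Set F) (u : F) : Prop :=
  u ∈ S ∧ (∀ a ∈ S, ∀ b ∈ S, u ≤ a ⊔ b → u ≤ a ∨ u ≤ b) ∧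
    (∀ a ∈ S, ∀ b ∈ S, a ⊓ b ≤ u → a ≤ u ∨ b ≤ u)

section fw
variable {F : Type*} [Lattice F] {G : Type*} [Lattice G]

theorem DIn_iff {ρ : Type*} {y : ρ → G} (hy : FreeGen y) {φ : LatticeHom G F}
    (hφ : Function.Injective φ) (u : F) : DIn (Set.range φ) u ↔ ∃ i, φ (y i) = u := by
  have le : ∀ a b, φ a ≤ φ b ↔ a ≤ b := by
    intro a b
    rw [← sup_eq_right, ← map_sup, hφ.eq_iff, sup_eq_right]
  constructor
  · rintro ⟨⟨w, rfl⟩, h1, h2⟩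
    have : DPrime w := by
      constructor
      · intro a b h
        have := h1 _ ⟨a, rfl⟩ _ ⟨b, rfl⟩ (by rw [← map_sup, le]; exact h)
        simpa only [le] using this
      · intro a b h
        have := h2 _ ⟨a, rfl⟩ _ ⟨b, rfl⟩ (by rw [← map_inf, le]; exact h)
        simpa only [le] using this
    obtain ⟨i, rfl⟩ := hy.dprime_iff.1 this
    exact ⟨i, rfl⟩
  · rintro ⟨i, rfl⟩
    have h := hy.dprime_iff.2 ⟨i, rfl⟩
    refine ⟨⟨_, rfl⟩, ?_, ?_⟩
    · rintro _ ⟨a, rfl⟩ _ ⟨b, rfl⟩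
      rw [← map_sup, le, le, le]; exact h.1 a b
    · rintro _ ⟨a, rfl⟩ _ ⟨b, rfl⟩
      rw [← map_inf, le, le, le]; exact h.2 a b

theorem DIn.aut {S : Set F} {u : F} (h : DIn S u) (π : F ≃o F) (hπ : π '' S = S) :
    DIn S (π u) := by
  obtain ⟨h0, h1, h2⟩ := h
  refine ⟨by rw [← hπ]; exact ⟨u, h0, rfl⟩, ?_, ?_⟩
  · intro a ha b hb
    rw [← hπ] at ha hb
    obtain ⟨a, ha, rfl⟩ := ha
    obtain ⟨b, hb, rfl⟩ := hb
    rw [← map_sup, π.le_iff_le, π.le_iff_le, π.le_iff_le]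
    exact h1 a ha b hb
  · intro a ha b hb
    rw [← hπ] at ha hb
    obtain ⟨a, ha, rfl⟩ := ha
    obtain ⟨b, hb, rfl⟩ := hb
    rw [← map_inf, π.le_iff_le, π.le_iff_le, π.le_iff_le]
    exact h2 a ha b hb

theorem anti_le (ψ : F ≃o Fᵒᵈ) (a b : F) :
    OrderDual.ofDual (ψ a) ≤ OrderDual.ofDual (ψ b) ↔ b ≤ a := by
  rw [OrderDual.ofDual_le_ofDual, ψ.le_iff_le]
theorem anti_sup (ψ : F ≃o Fᵒᵈ) (a b : F) :
    OrderDual.ofDual (ψ a) ⊔ OrderDual.ofDual (ψ b) = OrderDual.ofDual (ψ (a ⊓ b)) := by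
  rw [map_inf]; rfl
theorem anti_inf (ψ : F ≃o Fᵒᵈ) (a b : F) :
    OrderDual.ofDual (ψ a) ⊓ OrderDual.ofDual (ψ b) = OrderDual.ofDual (ψ (a ⊔ b)) := by
  rw [map_sup]; rfl

theorem DIn.anti {S : Set F} {u : F} (h : DIn S u) (ψ : F ≃o Fᵒᵈ)
    (hψ : (fun u => OrderDual.ofDual (ψ u)) '' S = S) : DIn S (OrderDual.ofDual (ψ u)) := by
  obtain ⟨h0, h1, h2⟩ := h
  refine ⟨by rw [← hψ]; exact ⟨u, h0, rfl⟩, ?_, ?_⟩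
  · intro a ha b hb
    rw [← hψ] at ha hb
    obtain ⟨a, ha, rfl⟩ := ha
    obtain ⟨b, hb, rfl⟩ := hb
    simp only [anti_sup, anti_le]
    exact h2 a ha b hb
  · intro a ha b hb
    rw [← hψ] at ha hb
    obtain ⟨a, ha, rfl⟩ := ha
    obtain ⟨b, hb, rfl⟩ := hb
    simp only [anti_inf, anti_le]
    exact h1 a ha b hb
end fw

/-- A Polish-style code of terms. -/
def enc {ι : Type u} : FTerm ι → List (ι ⊕ Bool)
  | .var i => [.inl i]
  | .sup a b => .inr true :: (enc a ++ enc b)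
  | .inf a b => .inr false :: (enc a ++ enc b)

theorem enc_inj {ι : Type u} (p : FTerm ι) : ∀ (q : FTerm ι) (l l' : List (ι ⊕ Bool)),
    enc p ++ l = enc q ++ l' → p = q ∧ l = l' := by
  induction p with
  | var i =>
    intro q l l' h
    cases q <;> simp_all [enc]
  | sup a b iha ihb =>
    intro q l l' h
    cases q with
    | sup c d =>
      simp only [enc, List.cons_append, List.append_assoc, List.cons.injEq, true_and] at h
      obtain ⟨rfl, h'⟩ := iha _ _ _ h
      obtain ⟨rfl, h''⟩ := ihb _ _ _ h'
      exact ⟨rfl, h''⟩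
    | _ => simp [enc] at h
  | inf a b iha ihb =>
    intro q l l' h
    cases q with
    | inf c d =>
      simp only [enc, List.cons_append, List.append_assoc, List.cons.injEq, true_and] at h
      obtain ⟨rfl, h'⟩ := iha _ _ _ h
      obtain ⟨rfl, h''⟩ := ihb _ _ _ h'
      exact ⟨rfl, h''⟩
    | _ => simp [enc] at h

theorem card_FTerm (ι : Type u) : #(FTerm ι) ≤ max ℵ₀ #ι := by
  have h : Function.Injective (enc (ι := ι)) := fun p q h =>
    (enc_inj p q [] [] (by rw [h])).1
  refine (mk_le_of_injective h).trans ((mk_list_le_max _).trans (max_le (le_max_left _ _) ?_))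
  rw [mk_sum]
  refine (add_le_max _ _).trans ?_
  simp only [lift_uzero, mk_bool, lift_ofNat]
  refine max_le (max_le (le_max_right _ _) ?_) (le_max_left _ _)
  exact (natCast_le_aleph0 (n := 2)).trans (le_max_left _ _)

theorem eval_const {α : Type*} (p : FTerm α) (P : Prop) : p.eval (fun _ => P) = P := by
  induction p <;> simp_all [FTerm.eval]

section main
variable {F : Type*} [Lattice F] {G : Type*} [Lattice G] {ι ρ : Type u} {x : ι → F} {y : ρ → G}

theorem card_bound (hx : FreeGen x) (hy : FreeGen y) {φ : LatticeHom G F}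
    (hφ : Function.Injective φ) : #ρ ≤ max ℵ₀ #ι := by
  choose t ht using fun i => hx.surj (φ (y i))
  refine (mk_le_of_injective (f := t) ?_).trans (card_FTerm ι)
  intro i j h
  apply hy.free.injective
  apply hφ
  rw [← ht, ← ht, h]

theorem perm_aut (hx : FreeGen x) (σ : ι ≃ ι) : ∃ π : F ≃o F, ∀ i, π (x i) = x (σ i) :=
  hx.iso (hx.comp_equiv σ)

theorem inf_case (hx : FreeGen x) (hy : FreeGen y) [Nonempty ρ] {φ : LatticeHom G F}
    (hφ : Function.Injective φ) (hS : DASymmetric (Set.range φ)) (hinf : ℵ₀ ≤ #ι) : #ι ≤ #ρ := by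
  by_contra hlt
  rw [not_le] at hlt
  have : Infinite ι := infinite_iff.2 hinf
  choose t ht using fun i => hx.surj (φ (y i))
  let T : Set ι := ⋃ i, (t i).vars
  have hT : #T < #ι := by
    rcases finite_or_infinite ρ with h | h
    · have : T.Finite := Set.finite_iUnion fun i => (t i).vars_finite
      exact (lt_aleph0_iff_set_finite.2 this).trans_le hinf
    · refine lt_of_le_of_lt ((mk_iUnion_le _).trans ?_) hlt
      refine (mul_le_mul_right (ciSup_le' (a := ℵ₀) fun i => ?_) _).trans ?_
      · exact (lt_aleph0_iff_set_finite.2 (t i).vars_finite).le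
      · rw [mul_aleph0_eq (aleph0_le_mk ρ)]
  have hTc : #T ≤ #(Tᶜ : Set ι) := by rw [mk_compl_of_infinite T hT]; exact hT.le
  obtain ⟨f⟩ := hTc
  obtain ⟨σ, hσ⟩ := extend_function_of_lt (f.trans (Function.Embedding.subtype _)) hT
    ⟨Equiv.refl ι⟩
  obtain ⟨π, hπ⟩ := perm_aut hx σ
  obtain ⟨i⟩ := ‹Nonempty ρ›
  obtain ⟨j, hj⟩ := (DIn_iff hy hφ _).1 (((DIn_iff hy hφ _).2 ⟨i, rfl⟩).aut π (hS.1 π))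
  obtain ⟨χ, hχ⟩ := hx.lift (fun i => i ∈ T)
  rw [← ht j, ← ht i, aut_eval] at hj
  have h1 : χ ((t j).eval x) = True := by
    rw [hχ, ← eval_const (t j) True]
    apply FTerm.eval_congr
    intro k hk
    exact eq_true (Set.mem_iUnion.2 ⟨j, hk⟩ : k ∈ T)
  have h2 : χ ((t i).eval fun i => π (x i)) = False := by
    rw [FTerm.eval_map χ (fun _ _ => map_sup χ _ _) (fun _ _ => map_inf χ _ _),
      ← eval_const (t i) False]
    apply FTerm.eval_congr
    intro k hk
    have hkT : k ∈ T := Set.mem_iUnion.2 ⟨i, hk⟩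
    have := hσ ⟨k, hkT⟩
    rw [hπ]
    have h5 := hχ (.var (σ k))
    simp only [FTerm.eval] at h5
    rw [h5]
    have h3 := (f ⟨k, hkT⟩).2
    simp only [eq_iff_iff, iff_false]
    intro h4
    apply h3
    simp only [Function.Embedding.trans_apply, Function.Embedding.subtype_apply] at this
    rw [← this]; exact h4
  rw [← hj, h1] at h2
  exact true_ne_false h2

theorem fixed_gen (hx : FreeGen x) (δ : F ≃o Fᵒᵈ)
    (hδ : ∀ u, OrderDual.ofDual (δ (OrderDual.ofDual (δ u))) = u)
    {u : F} (hu : OrderDual.ofDual (δ u) = u) : ∃ i, x i = u := by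
  obtain ⟨p, hp⟩ := hx.surj u
  induction p with
  | var i => exact ⟨i, hp⟩
  | sup a b iha ihb =>
    simp only [FTerm.eval] at hp
    have e1 : OrderDual.ofDual (δ (a.eval x)) ⊓ OrderDual.ofDual (δ (b.eval x)) = u := by
      rw [anti_inf, hp, hu]
    have ha : a.eval x ≤ u := hp ▸ le_sup_left
    have hb : b.eval x ≤ u := hp ▸ le_sup_right
    rcases hx.whit _ _ _ _ (e1.trans hp.symm).le with h | h | h | h
    · rw [hp] at h; replace h := h.trans_eq hu.symm
      rw [anti_le] at h; exact iha (le_antisymm ha h)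
    · rw [hp] at h; replace h := h.trans_eq hu.symm
      rw [anti_le] at h; exact ihb (le_antisymm hb h)
    · rw [e1] at h; exact iha (le_antisymm ha h)
    · rw [e1] at h; exact ihb (le_antisymm hb h)
  | inf a b iha ihb =>
    simp only [FTerm.eval] at hp
    have e1 : OrderDual.ofDual (δ (a.eval x)) ⊔ OrderDual.ofDual (δ (b.eval x)) = u := by
      rw [anti_sup, hp, hu]
    have ha : u ≤ a.eval x := hp ▸ inf_le_left
    have hb : u ≤ b.eval x := hp ▸ inf_le_right
    rcases hx.whit _ _ _ _ (hp.trans e1.symm).le with h | h | h | h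
    · rw [e1] at h; exact iha (le_antisymm h ha)
    · rw [e1] at h; exact ihb (le_antisymm h hb)
    · rw [hp] at h; replace h := hu.trans_le h
      rw [anti_le] at h; exact iha (le_antisymm h ha)
    · rw [hp] at h; replace h := hu.trans_le h
      rw [anti_le] at h; exact ihb (le_antisymm h hb)

theorem odd_case (hx : FreeGen x) (hy : FreeGen y) [Fintype ρ] (hodd : ¬ 2 ∣ Fintype.card ρ)
    {φ : LatticeHom G F}
    (hφ : Function.Injective φ) (hS : DASymmetric (Set.range φ)) : #ρ = #ι := by
  classical
  obtain ⟨δ, hδ⟩ := hx.iso hx.dual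
  have hδ' : ∀ p : FTerm ι, OrderDual.ofDual (δ (p.eval x)) = p.dual.eval x := by
    intro p; rw [anti_eval]; simp only [hδ, OrderDual.ofDual_toDual]
  have hinv : ∀ u, OrderDual.ofDual (δ (OrderDual.ofDual (δ u))) = u := by
    intro u
    obtain ⟨p, rfl⟩ := hx.surj u
    rw [hδ', hδ', FTerm.dual_dual]
  choose s hs using fun i =>
    (DIn_iff hy hφ _).1 (((DIn_iff hy hφ _).2 ⟨i, rfl⟩).anti δ (hS.2 δ))
  have hss : Function.Involutive s := by
    intro i
    apply hy.free.injective
    apply hφ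
    rw [hs, hs, hinv]
  obtain ⟨i, hi⟩ := Equiv.Perm.exists_fixed_point_of_prime (p := 2) (n := 1) hodd
    (σ := hss.toPerm s) (by ext i; simp [pow_two, hss i])
  have hi' : s i = i := hi
  obtain ⟨j, hj⟩ := fixed_gen hx δ hinv (u := φ (y i)) (by rw [← hs, hi'])
  have hall : ∀ l, ∃ k, φ (y k) = x l := by
    intro l
    obtain ⟨π, hπ⟩ := perm_aut hx (Equiv.swap j l)
    have := (DIn_iff hy hφ _).1 (((DIn_iff hy hφ _).2 ⟨i, rfl⟩).aut π (hS.1 π))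
    rw [← hj, hπ, Equiv.swap_apply_left] at this
    exact this
  have huniv : ∀ u, u ∈ Set.range φ := by
    intro u
    obtain ⟨p, rfl⟩ := hx.surj u
    choose k hk using hall
    refine ⟨p.eval (fun l => y (k l)), ?_⟩
    rw [FTerm.eval_map φ (fun _ _ => map_sup φ _ _) (fun _ _ => map_inf φ _ _)]
    simp only [hk]
  have hrev : ∀ k, ∃ l, x l = φ (y k) := by
    intro k
    have := (DIn_iff hy hφ _).2 ⟨k, rfl⟩
    exact hx.dprime_iff.1 ⟨fun a b => this.2.1 a (huniv a) b (huniv b),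
      fun a b => this.2.2 a (huniv a) b (huniv b)⟩
  choose k hk using hall
  choose l hl using hrev
  refine mk_congr ⟨l, k, fun i => ?_, fun i => ?_⟩
  · apply hy.free.injective; apply hφ; rw [hk, hl]
  · apply hx.free.injective; rw [hl, hk]

theorem same_case (hx : FreeGen x) (hy : FreeGen y) (σ : ρ ≃ ι) :
    ∃ φ : LatticeHom G F, Function.Injective φ ∧ DASymmetric (Set.range ⇑φ) := by
  have hg := hx.comp_equiv σ
  obtain ⟨φ, hφ⟩ := hy.lift (fun i => x (σ i))
  have : Set.range φ = Set.univ := by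
    refine Set.eq_univ_of_forall fun u => ?_
    obtain ⟨p, rfl⟩ := hg.surj u
    exact ⟨_, hφ p⟩
  refine ⟨φ, hy.lift_injective hg.free hφ, ?_⟩
  rw [this]
  constructor
  · intro π
    rw [Set.image_univ]; exact π.surjective.range_eq
  · intro ψ
    rw [Set.image_univ]
    exact Function.Surjective.range_eq (OrderDual.ofDual.surjective.comp ψ.surjective)
end main
end Fin5

theorem DA_symmetric_range_embedding_iff {κ lam : Cardinal.{u}}
    (hκ : 3 ≤ κ) (hlam : 3 ≤ lam)
    {F : Type*} [Lattice F] {ι : Type u} (x : ι → F) (hx : IsFreelyGenerated x)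
    (hι : #ι = lam)
    {G : Type*} [Lattice G] {ρ : Type u} (y : ρ → G) (hy : IsFreelyGenerated y)
    (hρ : #ρ = κ) :
    (∃ φ : LatticeHom G F, Function.Injective φ ∧ DASymmetric (Set.range ⇑φ)) ↔
      (κ = lam ∨ (lam < ℵ₀ ∧ (κ = ℵ₀ ∨ ∃ k : ℕ, 0 < k ∧ κ = 2 * (k : Cardinal)))) := by
  classical
  subst hι hρ
  replace hx := hx.freeGen
  replace hy := hy.freeGen
  have : Nonempty ρ := by
    rw [← mk_ne_zero_iff]
    rintro h
    rw [h] at hκ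
    exact absurd hκ (by norm_num)
  constructor
  · rintro ⟨φ, hφ, hS⟩
    have hb := Fin5.card_bound hx hy hφ
    by_cases hfin : #ι < ℵ₀
    · rw [max_eq_left hfin.le] at hb
      rcases hb.lt_or_eq with h | h
      · have : Finite ρ := lt_aleph0_iff_finite.1 h
        have := Fintype.ofFinite ρ
        by_cases hodd : 2 ∣ Fintype.card ρ
        · obtain ⟨k, hk⟩ := hodd
          refine Or.inr ⟨hfin, Or.inr ⟨k, ?_, ?_⟩⟩
          · have := Fintype.card_pos (α := ρ); omega
          · rw [mk_fintype, hk]; push_cast; rfl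
        · exact Or.inl (Fin5.odd_case hx hy hodd hφ hS)
      · exact Or.inr ⟨hfin, Or.inl h⟩
    · rw [not_lt] at hfin
      rw [max_eq_right hfin] at hb
      exact Or.inl (le_antisymm hb (Fin5.inf_case hx hy hφ hS hfin))
  · rintro (h | ⟨hfin, h⟩)
    · obtain ⟨σ⟩ := Cardinal.eq.1 h
      exact Fin5.same_case hx hy σ
    · have : Finite ι := lt_aleph0_iff_finite.1 hfin
      have := Fintype.ofFinite ι
      have hc : 3 ≤ Fintype.card ι := by
        rw [mk_fintype] at hlam; exact_mod_cast hlam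
      have : Nontrivial ι := Fintype.one_lt_card_iff_nontrivial.1 (by omega)
      have h3 : ∀ i l : ι, ∃ j, j ≠ i ∧ j ≠ l := by
        intro i l
        obtain ⟨j, hj⟩ := Finset.exists_mem_notMem_of_card_lt_card
          (s := {i, l}) (t := (Finset.univ : Finset ι))
          (lt_of_le_of_lt Finset.card_le_two (by rw [Finset.card_univ]; omega))
        refine ⟨j, ?_⟩
        simpa using hj
      rcases h with h | ⟨k, hk, h⟩
      · obtain ⟨hd⟩ := denumerable_iff.2 h
        let e : ρ ≃ ℕ × Bool := (Denumerable.eqv ρ).trans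
          (Equiv.boolProdNatEquivNat.symm.trans (Equiv.prodComm _ _))
        exact Fin5.backward hy hx h3 e e.injective (fun r => e.symm ((e r).1, !(e r).2)) (by simp)
      · have : Finite ρ := lt_aleph0_iff_finite.1 (by
          rw [h]; exact_mod_cast natCast_lt_aleph0 (n := 2 * k))
        have := Fintype.ofFinite ρ
        have hcard : Fintype.card ρ = 2 * k := by
          rw [mk_fintype] at h; exact_mod_cast h
        let e : ρ ≃ Fin k × Bool := Fintype.equivOfCardEq (by simp [hcard, mul_comm])
        refine Fin5.backward hy hx h3 (fun r => ((e r).1, (e r).2)) ?_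
          (fun r => e.symm ((e r).1, !(e r).2)) (by simp)
        intro r r' h
        simp only [Prod.mk.injEq] at h
        exact e.injective (Prod.ext (Fin.ext h.1) h.2)
end

section
/- Let κ and λ be cardinals with 3 ≤ κ and 3 ≤ λ. Let F be a lattice freely generated by a family x : ι → F with #ι = λ, and let G be a lattice freely generated by a family y : ρ → G with #ρ = κ. Then there exists an injective lattice homomorphism φ : G → F whose range is a symmetric subset of F if and only if either (λ < ℵ₀ and κ ≤ ℵ₀) or (κ = λ and ℵ₀ ≤ κ). -/
open Cardinal

universe u

/-- A subset `S` of a lattice is symmetric if it is invariant under all automorphisms. -/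
def SymmetricSubset {F : Type*} [Lattice F] (S : Set F) : Prop :=
  ∀ π : F ≃o F, π '' S = S

universe w

/-! ### Lattice terms -/

/-- Lattice terms over a set of variables. -/
inductive Tm (α : Type*) where
  | var : α → Tm α
  | sup : Tm α → Tm α → Tm α
  | inf : Tm α → Tm α → Tm α

namespace Tm

variable {α β K L : Type*} [Lattice K] [Lattice L]

/-- Evaluation of terms. -/
def ev (f : α → K) : Tm α → K
  | var a => f a
  | sup s t => ev f s ⊔ ev f t
  | inf s t => ev f s ⊓ ev f t

/-- Substitution. -/
def bind (g : α → Tm β) : Tm α → Tm β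
  | var a => g a
  | sup s t => sup (bind g s) (bind g t)
  | inf s t => inf (bind g s) (bind g t)

/-- Variables of a term. -/
def vars : Tm α → Set α
  | var a => {a}
  | sup s t => vars s ∪ vars t
  | inf s t => vars s ∪ vars t

theorem vars_finite (t : Tm α) : t.vars.Finite := by
  induction t with
  | var a => exact Set.finite_singleton a
  | sup s t hs ht => exact hs.union ht
  | inf s t hs ht => exact hs.union ht

theorem ev_bind (f : β → K) (g : α → Tm β) (t : Tm α) :
    ev f (bind g t) = ev (fun a => ev f (g a)) t := by
  induction t with
  | var a => rfl
  | sup s t hs ht => simp [ev, bind, hs, ht]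
  | inf s t hs ht => simp [ev, bind, hs, ht]

theorem map_ev (φ : LatticeHom K L) (f : α → K) (t : Tm α) :
    φ (ev f t) = ev (fun a => φ (f a)) t := by
  induction t with
  | var a => rfl
  | sup s t hs ht => simp [ev, hs, ht]
  | inf s t hs ht => simp [ev, hs, ht]

theorem ev_congr (f g : α → K) (t : Tm α) (h : ∀ a ∈ t.vars, f a = g a) : ev f t = ev g t := by
  induction t with
  | var a => exact h a rfl
  | sup s t hs ht =>
    simp only [ev]; rw [hs fun a ha => h a (Or.inl ha), ht fun a ha => h a (Or.inr ha)]
  | inf s t hs ht =>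
    simp only [ev]; rw [hs fun a ha => h a (Or.inl ha), ht fun a ha => h a (Or.inr ha)]

theorem ev_mono (f g : α → K) (h : ∀ a, f a ≤ g a) (t : Tm α) : ev f t ≤ ev g t := by
  induction t with
  | var a => exact h a
  | sup s t hs ht => exact sup_le_sup hs ht
  | inf s t hs ht => exact inf_le_inf hs ht

theorem ev_le (f : α → K) (z : K) (t : Tm α) (h : ∀ a, f a ≤ z) : ev f t ≤ z := by
  induction t with
  | var a => exact h a
  | sup s t hs ht => exact sup_le hs ht
  | inf s t hs ht => exact inf_le_of_left_le hs

theorem le_ev (f : α → K) (z : K) (t : Tm α) (h : ∀ a, z ≤ f a) : z ≤ ev f t := by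
  induction t with
  | var a => exact h a
  | sup s t hs ht => exact le_sup_of_le_left hs
  | inf s t hs ht => exact le_inf hs ht

theorem ev_const (f : α → K) (z : K) (t : Tm α) (h : ∀ a ∈ t.vars, f a = z) : ev f t = z := by
  induction t with
  | var a => exact h a rfl
  | sup s t hs ht =>
    simp only [ev]; rw [hs fun a ha => h a (Or.inl ha), ht fun a ha => h a (Or.inr ha)]; simp
  | inf s t hs ht =>
    simp only [ev]; rw [hs fun a ha => h a (Or.inl ha), ht fun a ha => h a (Or.inr ha)]; simp

/-- Terms as a W-type (to bound the cardinality). -/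
def toW : Tm α → WType (fun a : α ⊕ Bool => Sum.elim (fun _ => Empty) (fun _ => Bool) a)
  | var a => ⟨Sum.inl a, fun e => Empty.elim e⟩
  | sup s t => ⟨Sum.inr true, fun b => Bool.rec (toW s) (toW t) b⟩
  | inf s t => ⟨Sum.inr false, fun b => Bool.rec (toW s) (toW t) b⟩

theorem toW_injective : Function.Injective (toW (α := α)) := by
  let hd : WType (fun a : α ⊕ Bool => Sum.elim (fun _ => Empty) (fun _ => Bool) a) → α ⊕ Bool :=
    fun w => WType.rec (fun a _ _ => a) w
  intro s
  induction s with
  | var a =>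
    intro t h
    have h' := congrArg hd h
    cases t <;> simp [toW, hd] at h'
    rw [h']
  | sup s1 s2 h1 h2 =>
    intro t h
    have h' := congrArg hd h
    cases t with
    | var => simp [toW, hd] at h'
    | inf => simp [toW, hd] at h'
    | sup t1 t2 =>
      simp only [toW, WType.mk.injEq, heq_eq_eq, true_and] at h
      rw [h1 (congrFun h false), h2 (congrFun h true)]
  | inf s1 s2 h1 h2 =>
    intro t h
    have h' := congrArg hd h
    cases t with
    | var => simp [toW, hd] at h'
    | sup => simp [toW, hd] at h'
    | inf t1 t2 =>
      simp only [toW, WType.mk.injEq, heq_eq_eq, true_and] at h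
      rw [h1 (congrFun h false), h2 (congrFun h true)]

theorem card_le {α : Type u} : #(Tm α) ≤ max #α ℵ₀ := by
  refine (mk_le_of_injective toW_injective).trans ?_
  have : ∀ a : α ⊕ Bool, Finite
      ((fun a : α ⊕ Bool => (Sum.elim (fun _ => Empty) (fun _ => Bool) a : Type)) a) := by
    rintro (a | a)
    · exact inferInstanceAs (Finite Empty)
    · exact inferInstanceAs (Finite Bool)
  refine (WType.cardinalMk_le_max_aleph0_of_finite').trans ?_
  refine max_le ?_ (le_max_right _ _)
  rw [mk_sum]
  simp only [lift_uzero]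
  refine (add_le_max _ _).trans ?_
  refine max_le (max_le (le_max_left _ _) (le_max_of_le_right ?_)) (le_max_right _ _)
  simp

theorem countable_tm {α : Type*} [Countable α] : Countable (Tm α) := by
  rw [← mk_le_aleph0_iff]
  exact card_le.trans (max_le (mk_le_aleph0_iff.2 inferInstance) le_rfl)

end Tm

open Tm

theorem exists_tm {F ι : Type*} [Lattice F] {x : ι → F}
    (hx : latticeClosure (Set.range x) = Set.univ) (a : F) : ∃ t : Tm ι, ev x t = a := by
  let S : Sublattice F :=
    { carrier := Set.range (ev x)
      supClosed' := by
        rintro _ ⟨s, rfl⟩ _ ⟨t, rfl⟩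
        exact ⟨sup s t, rfl⟩
      infClosed' := by
        rintro _ ⟨s, rfl⟩ _ ⟨t, rfl⟩
        exact ⟨inf s t, rfl⟩ }
  have h : latticeClosure (Set.range x) ⊆ (S : Set F) := by
    apply latticeClosure_min
    · rintro _ ⟨i, rfl⟩
      exact ⟨var i, rfl⟩
    · exact S.isSublattice
  rw [hx] at h
  exact h (Set.mem_univ a)

/-! ### Universe-independent freeness -/


theorem exists_small_lattice (K : Type*) [Lattice K] [Countable K] :
    ∃ (K' : Type w) (_ : Lattice K'), Nonempty (K ≃o K') := by
  let e := orderIsoShrink.{w} K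
  let inst : Lattice (Shrink.{w} K) :=
    { (inferInstance : PartialOrder (Shrink.{w} K)) with
      sup := fun a b => e (e.symm a ⊔ e.symm b)
      inf := fun a b => e (e.symm a ⊓ e.symm b)
      le_sup_left := fun a b => by
        rw [← e.symm.le_iff_le]; simp
      le_sup_right := fun a b => by
        rw [← e.symm.le_iff_le]; simp
      sup_le := fun a b c hac hbc => by
        rw [← e.symm.le_iff_le] at hac hbc ⊢; simp [hac, hbc]
      inf_le_left := fun a b => by
        rw [← e.symm.le_iff_le]; simp
      inf_le_right := fun a b => by
        rw [← e.symm.le_iff_le]; simp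
      le_inf := fun a b c hab hac => by
        rw [← e.symm.le_iff_le] at hab hac ⊢; simp [hab, hac] }
  exact ⟨Shrink.{w} K, inst, ⟨e⟩⟩

theorem ev_le_of_small {K α : Type*} [Lattice K] {s t : Tm α}
    (h : ∀ (K' : Type w) [Lattice K'] (f : α → K'), ev f s ≤ ev f t) (f : α → K) :
    ev f s ≤ ev f t := by
  classical
  obtain ⟨a0, ha0⟩ : ∃ a0, a0 ∈ s.vars := by
    clear h
    induction s with
    | var a => exact ⟨a, rfl⟩
    | sup s t hs ht => exact hs.imp fun a ha => Or.inl ha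
    | inf s t hs ht => exact hs.imp fun a ha => Or.inl ha
  let V : Set α := s.vars ∪ t.vars
  have hV : V.Finite := s.vars_finite.union t.vars_finite
  have : Countable V := hV.countable
  have : Countable (Tm V) := countable_tm
  let S : Sublattice K :=
    { carrier := Set.range (ev (fun v : V => f v))
      supClosed' := by
        rintro _ ⟨s, rfl⟩ _ ⟨t, rfl⟩
        exact ⟨sup s t, rfl⟩
      infClosed' := by
        rintro _ ⟨s, rfl⟩ _ ⟨t, rfl⟩
        exact ⟨inf s t, rfl⟩ }
  have : Countable S := (Set.countable_range (ev (fun v : V => f v))).to_subtype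
  obtain ⟨K', inst, ⟨e⟩⟩ := exists_small_lattice.{w} S
  let g : α → S := fun a => if ha : a ∈ V then ⟨f a, ⟨var ⟨a, ha⟩, rfl⟩⟩
    else ⟨f a0, ⟨var ⟨a0, Or.inl ha0⟩, rfl⟩⟩
  have key := h K' (fun a => e (g a))
  have h1 : ∀ r : Tm α, ev (fun a => e (g a)) r = e (ev g r) := by
    intro r
    exact (map_ev (e : LatticeHom S K') g r).symm
  rw [h1, h1, e.le_iff_le] at key
  have h2 : ∀ r : Tm α, r.vars ⊆ V → ((ev g r : S) : K) = ev f r := by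
    intro r hr
    rw [show ((ev g r : S) : K) = S.subtype (ev g r) from rfl, map_ev]
    apply ev_congr
    intro a ha
    simp [g, hr ha]
  rw [← h2 s Set.subset_union_left, ← h2 t Set.subset_union_right]
  exact key

theorem IsFreelyGenerated.ev_le {F ι : Type*} [Lattice F] {x : ι → F}
    (hx : IsFreelyGenerated.{_, _, w} x) {s t : Tm ι} (h : ev x s ≤ ev x t)
    {K : Type*} [Lattice K] (f : ι → K) : ev f s ≤ ev f t := by
  apply ev_le_of_small.{w}
  intro K' _ f
  obtain ⟨φ, hφ⟩ := hx.2 K' f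
  have := OrderHomClass.mono φ h
  rw [map_ev, map_ev] at this
  simpa [hφ] using this

theorem IsFreelyGenerated.hom {F ι : Type*} [Lattice F] {x : ι → F}
    (hx : IsFreelyGenerated.{_, _, w} x) {K : Type*} [Lattice K] (f : ι → K) :
    ∃ φ : LatticeHom F K, ∀ i, φ (x i) = f i := by
  choose τ hτ using exists_tm hx.1
  have key : ∀ s t, ev x s = ev x t → ev f s = ev f t := fun s t h =>
    le_antisymm (hx.ev_le h.le f) (hx.ev_le h.ge f)
  refine ⟨⟨⟨fun a => ev f (τ a), ?_⟩, ?_⟩, ?_⟩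
  · intro a b
    exact key (τ (a ⊔ b)) (sup (τ a) (τ b)) (by simp [ev, hτ])
  · intro a b
    exact key (τ (a ⊓ b)) (inf (τ a) (τ b)) (by simp [ev, hτ])
  · intro i
    exact key (τ (x i)) (var i) (by simp [ev, hτ])

/-! ### Whitman's condition, by Day's doubling construction -/

/-- Whitman's condition. -/
def Whit (F : Type*) [Lattice F] : Prop :=
  ∀ a b c d : F, a ⊓ b ≤ c ⊔ d → a ≤ c ⊔ d ∨ b ≤ c ⊔ d ∨ a ⊓ b ≤ c ∨ a ⊓ b ≤ d

/-- The doubling of the interval `[p, q]`. -/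
def Dbl {F : Type*} [Lattice F] (p q : F) : Type _ :=
  {z : F × Prop // (z.2 → p ≤ z.1) ∧ (p ≤ z.1 → ¬ z.1 ≤ q → z.2)}

instance {F : Type*} [Lattice F] (p q : F) : PartialOrder (Dbl p q) :=
  inferInstanceAs (PartialOrder {z : F × Prop // (z.2 → p ≤ z.1) ∧ (p ≤ z.1 → ¬ z.1 ≤ q → z.2)})

theorem Dbl.le_def {F : Type*} [Lattice F] {p q : F} (a b : Dbl p q) :
    a ≤ b ↔ a.1.1 ≤ b.1.1 ∧ (a.1.2 → b.1.2) := Iff.rfl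

instance {F : Type*} [Lattice F] (p q : F) : Lattice (Dbl p q) where
  sup a b := ⟨(a.1.1 ⊔ b.1.1, a.1.2 ∨ b.1.2 ∨ (p ≤ a.1.1 ⊔ b.1.1 ∧ ¬ a.1.1 ⊔ b.1.1 ≤ q)),
    by
      rintro (h | h | h)
      · exact le_sup_of_le_left (a.2.1 h)
      · exact le_sup_of_le_right (b.2.1 h)
      · exact h.1,
    fun h1 h2 => Or.inr (Or.inr ⟨h1, h2⟩)⟩
  inf a b := ⟨(a.1.1 ⊓ b.1.1, a.1.2 ∧ b.1.2),
    fun h => le_inf (a.2.1 h.1) (b.2.1 h.2),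
    fun h1 h2 => ⟨a.2.2 (h1.trans inf_le_left) fun h => h2 (inf_le_of_left_le h),
      b.2.2 (h1.trans inf_le_right) fun h => h2 (inf_le_of_right_le h)⟩⟩
  le_sup_left a b := ⟨le_sup_left, fun h => Or.inl h⟩
  le_sup_right a b := ⟨le_sup_right, fun h => Or.inr (Or.inl h)⟩
  sup_le a b c hac hbc := by
    rw [Dbl.le_def] at hac hbc
    refine ⟨sup_le hac.1 hbc.1, ?_⟩
    rintro (h | h | h)
    · exact hac.2 h
    · exact hbc.2 h
    · exact c.2.2 (h.1.trans (sup_le hac.1 hbc.1)) fun hc => h.2 ((sup_le hac.1 hbc.1).trans hc)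
  inf_le_left a b := ⟨inf_le_left, fun h => h.1⟩
  inf_le_right a b := ⟨inf_le_right, fun h => h.2⟩
  le_inf a b c hab hac := ⟨le_inf hab.1 hac.1, fun h => ⟨hab.2 h, hac.2 h⟩⟩

/-- The projection of the doubling. -/
def Dbl.proj {F : Type*} [Lattice F] (p q : F) : LatticeHom (Dbl p q) F where
  toFun a := a.1.1
  map_sup' _ _ := rfl
  map_inf' _ _ := rfl

theorem IsFreelyGenerated.whit {F ι : Type*} [Lattice F] {x : ι → F}
    (hx : IsFreelyGenerated.{_, _, w} x) : Whit F := by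
  intro a b c d h
  by_contra! hcon
  obtain ⟨h1, h2, h3, h4⟩ := hcon
  let p := a ⊓ b
  let q := c ⊔ d
  obtain ⟨φ, hφ⟩ := hx.hom (K := Dbl p q)
    (fun i => ⟨(x i, p ≤ x i ∧ ¬ x i ≤ q), fun h => h.1, fun h h' => ⟨h, h'⟩⟩)
  have hp : ∀ z : F, (φ z).1.1 = z := by
    intro z
    obtain ⟨t, rfl⟩ := exists_tm hx.1 z
    rw [show (φ (ev x t)).1.1 = Dbl.proj p q (φ (ev x t)) from rfl, map_ev, map_ev]
    apply ev_congr
    intro i _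
    rw [hφ]; rfl
  have ha : (φ a).1.2 := (φ a).2.2 (by rw [hp]; exact inf_le_left) (by rw [hp]; exact h1)
  have hb : (φ b).1.2 := (φ b).2.2 (by rw [hp]; exact inf_le_right) (by rw [hp]; exact h2)
  have hc : ¬ (φ c).1.2 := fun hh => h3 (by simpa [hp] using (φ c).2.1 hh)
  have hd : ¬ (φ d).1.2 := fun hh => h4 (by simpa [hp] using (φ d).2.1 hh)
  have hm := OrderHomClass.mono φ h
  rw [map_inf, map_sup] at hm
  rcases ((Dbl.le_def _ _).1 hm).2 ⟨ha, hb⟩ with hh | hh | hh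
  · exact hc hh
  · exact hd hh
  · exact hh.2 (by rw [hp, hp])

/-! ### Irredundant families -/

/-- Every member is separated from the others by an ideal. -/
def JIrr {F ι : Type*} [Lattice F] (x : ι → F) : Prop :=
  ∀ a, ∃ J : Set F, (∀ u v, u ≤ v → v ∈ J → u ∈ J) ∧ (∀ u ∈ J, ∀ v ∈ J, u ⊔ v ∈ J) ∧
    (∀ b, b ≠ a → x b ∈ J) ∧ x a ∉ J

/-- Every member is separated from the others by a filter. -/
def MIrr {F ι : Type*} [Lattice F] (x : ι → F) : Prop :=
  ∀ a, ∃ J : Set F, (∀ u v, v ≤ u → v ∈ J → u ∈ J) ∧ (∀ u ∈ J, ∀ v ∈ J, u ⊓ v ∈ J) ∧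
    (∀ b, b ≠ a → x b ∈ J) ∧ x a ∉ J

section Irr

variable {F ι : Type*} [Lattice F] {x : ι → F}

theorem JIrr.comp (h : JIrr x) {κ : Type*} {f : κ → ι} (hf : Function.Injective f) :
    JIrr (fun k => x (f k)) := by
  intro a
  obtain ⟨J, h1, h2, h3, h4⟩ := h (f a)
  exact ⟨J, h1, h2, fun b hb => h3 _ (hf.ne hb), h4⟩

theorem MIrr.comp (h : MIrr x) {κ : Type*} {f : κ → ι} (hf : Function.Injective f) :
    MIrr (fun k => x (f k)) := by
  intro a
  obtain ⟨J, h1, h2, h3, h4⟩ := h (f a)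
  exact ⟨J, h1, h2, fun b hb => h3 _ (hf.ne hb), h4⟩

theorem JIrr.eq_of_le (h : JIrr x) {a b : ι} (hab : x a ≤ x b) : a = b := by
  obtain ⟨J, h1, h2, h3, h4⟩ := h a
  by_contra hne
  exact h4 (h1 _ _ hab (h3 b (Ne.symm hne)))

theorem JIrr.prime (h : JIrr x) {a : ι} {s t : Tm ι} (hle : x a ≤ ev x s ⊔ ev x t) :
    x a ≤ ev x s ∨ x a ≤ ev x t := by
  obtain ⟨J, h1, h2, h3, h4⟩ := h a
  have key : ∀ t : Tm ι, x a ≤ ev x t ∨ ev x t ∈ J := by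
    intro t
    induction t with
    | var b =>
      by_cases hb : b = a
      · subst hb; exact Or.inl le_rfl
      · exact Or.inr (h3 b hb)
    | sup s t hs ht =>
      rcases hs with hs | hs
      · exact Or.inl (le_sup_of_le_left hs)
      rcases ht with ht | ht
      · exact Or.inl (le_sup_of_le_right ht)
      · exact Or.inr (h2 _ hs _ ht)
    | inf s t hs ht =>
      rcases hs with hs | hs
      · rcases ht with ht | ht
        · exact Or.inl (le_inf hs ht)
        · exact Or.inr (h1 _ _ inf_le_right ht)
      · exact Or.inr (h1 _ _ inf_le_left hs)
  rcases key s with hs | hs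
  · exact Or.inl hs
  rcases key t with ht | ht
  · exact Or.inr ht
  · exact absurd (h1 _ _ hle (h2 _ hs _ ht)) h4

theorem MIrr.prime (h : MIrr x) {a : ι} {s t : Tm ι} (hle : ev x s ⊓ ev x t ≤ x a) :
    ev x s ≤ x a ∨ ev x t ≤ x a := by
  obtain ⟨J, h1, h2, h3, h4⟩ := h a
  have key : ∀ t : Tm ι, ev x t ≤ x a ∨ ev x t ∈ J := by
    intro t
    induction t with
    | var b =>
      by_cases hb : b = a
      · subst hb; exact Or.inl le_rfl
      · exact Or.inr (h3 b hb)
    | inf s t hs ht =>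
      rcases hs with hs | hs
      · exact Or.inl (inf_le_of_left_le hs)
      rcases ht with ht | ht
      · exact Or.inl (inf_le_of_right_le ht)
      · exact Or.inr (h2 _ hs _ ht)
    | sup s t hs ht =>
      rcases hs with hs | hs
      · rcases ht with ht | ht
        · exact Or.inl (sup_le hs ht)
        · exact Or.inr (h1 _ _ le_sup_right ht)
      · exact Or.inr (h1 _ _ le_sup_left hs)
  rcases key s with hs | hs
  · exact Or.inl hs
  rcases key t with ht | ht
  · exact Or.inr ht
  · exact absurd (h1 _ _ hle (h2 _ hs _ ht)) h4

/-- In a lattice with Whitman's condition, an irredundant family satisfies only the inequalities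
that hold in all lattices. -/
theorem ev_le_of_irr (hW : Whit F) (hJ : JIrr x) (hM : MIrr x) {G : Type*} [Lattice G]
    (y : ι → G) (s t : Tm ι) (h : ev x s ≤ ev x t) : ev y s ≤ ev y t := by
  induction s generalizing t with
  | var a =>
    induction t with
    | var b =>
      rw [hJ.eq_of_le h]
    | sup t1 t2 h1 h2 =>
      rcases hJ.prime h with hh | hh
      · exact le_sup_of_le_left (h1 hh)
      · exact le_sup_of_le_right (h2 hh)
    | inf t1 t2 h1 h2 =>
      exact le_inf (h1 (h.trans inf_le_left)) (h2 (h.trans inf_le_right))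
  | sup s1 s2 h1 h2 =>
    exact sup_le (h1 t (le_sup_left.trans h)) (h2 t (le_sup_right.trans h))
  | inf s1 s2 h1 h2 =>
    induction t with
    | var b =>
      rcases hM.prime h with hh | hh
      · exact inf_le_of_left_le (h1 _ hh)
      · exact inf_le_of_right_le (h2 _ hh)
    | sup t1 t2 k1 k2 =>
      rcases hW _ _ _ _ h with hh | hh | hh | hh
      · exact inf_le_of_left_le (h1 (sup t1 t2) hh)
      · exact inf_le_of_right_le (h2 (sup t1 t2) hh)
      · exact le_sup_of_le_left (k1 hh)
      · exact le_sup_of_le_right (k2 hh)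
    | inf t1 t2 k1 k2 =>
      exact le_inf (k1 (h.trans inf_le_left)) (k2 (h.trans inf_le_right))

/-- Whitman's algorithm (with fuel). -/
def wle : ℕ → Tm (Fin 3) → Tm (Fin 3) → Bool
  | 0, _, _ => true
  | n + 1, s, t =>
    match s with
    | sup a b => wle n a t && wle n b t
    | var i =>
      match t with
      | inf c d => wle n (var i) c && wle n (var i) d
      | var j => decide (i = j)
      | sup c d => wle n (var i) c || wle n (var i) d
    | inf a b =>
      match t with
      | inf c d => wle n (inf a b) c && wle n (inf a b) d
      | var j => wle n a (var j) || wle n b (var j)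
      | sup c d => wle n a (sup c d) || wle n b (sup c d) || wle n (inf a b) c || wle n (inf a b) d

theorem wle_of_le {X : Fin 3 → F} (hW : Whit F) (hJ : JIrr X) (hM : MIrr X) (n : ℕ)
    (s t : Tm (Fin 3)) (h : ev X s ≤ ev X t) : wle n s t = true := by
  induction n generalizing s t with
  | zero => rfl
  | succ n ih =>
    cases s with
    | sup a b =>
      simp only [wle, Bool.and_eq_true]
      exact ⟨ih _ _ (le_sup_left.trans h), ih _ _ (le_sup_right.trans h)⟩
    | var i =>
      cases t with
      | inf c d =>
        simp only [wle, Bool.and_eq_true]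
        exact ⟨ih _ _ (h.trans inf_le_left), ih _ _ (h.trans inf_le_right)⟩
      | var j => simpa [wle] using hJ.eq_of_le h
      | sup c d =>
        simp only [wle, Bool.or_eq_true]
        exact (hJ.prime h).imp (ih (var i) c) (ih (var i) d)
    | inf a b =>
      cases t with
      | inf c d =>
        simp only [wle, Bool.and_eq_true]
        exact ⟨ih _ _ (h.trans inf_le_left), ih _ _ (h.trans inf_le_right)⟩
      | var j =>
        simp only [wle, Bool.or_eq_true]
        exact (hM.prime h).imp (ih a (var j)) (ih b (var j))
      | sup c d =>
        simp only [wle, Bool.or_eq_true]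
        rcases hW _ _ _ _ h with hh | hh | hh | hh
        · exact Or.inl (Or.inl (Or.inl (ih a (sup c d) hh)))
        · exact Or.inl (Or.inl (Or.inr (ih b (sup c d) hh)))
        · exact Or.inl (Or.inr (ih (inf a b) c hh))
        · exact Or.inr (ih (inf a b) d hh)

theorem not_le_of_wle {X : Fin 3 → F} (hW : Whit F) (hJ : JIrr X) (hM : MIrr X) {n : ℕ}
    {s t : Tm (Fin 3)} (h : wle n s t = false) : ¬ ev X s ≤ ev X t := fun hle => by
  rw [wle_of_le hW hJ hM n s t hle] at h
  cases h

theorem IsFreelyGenerated.jirr (hx : IsFreelyGenerated.{_, _, w} x) : JIrr x := by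
  classical
  intro a
  obtain ⟨φ, hφ⟩ := hx.hom (fun i => i = a)
  refine ⟨{v | ¬ φ v}, ?_, ?_, ?_, ?_⟩
  · intro u v huv hv hu
    exact hv (OrderHomClass.mono φ huv hu)
  · intro u hu v hv h
    rw [map_sup] at h
    exact h.elim hu hv
  · intro b hb
    simpa [hφ] using hb
  · simp [hφ]

theorem IsFreelyGenerated.mirr (hx : IsFreelyGenerated.{_, _, w} x) : MIrr x := by
  classical
  intro a
  obtain ⟨φ, hφ⟩ := hx.hom (fun i => i ≠ a)
  refine ⟨{v | φ v}, ?_, ?_, ?_, ?_⟩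
  · intro u v huv hv
    exact OrderHomClass.mono φ huv hv
  · intro u hu v hv
    simp only [Set.mem_ofPred_eq, map_inf]
    exact ⟨hu, hv⟩
  · intro b hb
    simpa [hφ] using hb
  · simp [hφ]

theorem IsFreelyGenerated.injective (hx : IsFreelyGenerated.{_, _, w} x) : Function.Injective x :=
  fun _ _ h => hx.jirr.eq_of_le h.le

/-! ### Automorphisms -/

theorem IsFreelyGenerated.aut (hx : IsFreelyGenerated.{_, _, w} x) (π : F ≃o F) (i : ι) :
    ∃ j, π (x i) = x j := by
  have h1 : ∀ u v : F, π (x i) = u ⊔ v → π (x i) = u ∨ π (x i) = v := by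
    intro u v h
    obtain ⟨s, hs⟩ := exists_tm hx.1 (π.symm u)
    obtain ⟨t, ht⟩ := exists_tm hx.1 (π.symm v)
    have : x i ≤ ev x s ⊔ ev x t := by
      rw [hs, ht, ← map_sup, ← h]; simp
    rcases hx.jirr.prime this with hh | hh
    · left
      rw [hs] at hh
      exact le_antisymm ((π.le_symm_apply).1 hh) (h ▸ le_sup_left)
    · right
      rw [ht] at hh
      exact le_antisymm ((π.le_symm_apply).1 hh) (h ▸ le_sup_right)
  have h2 : ∀ u v : F, π (x i) = u ⊓ v → π (x i) = u ∨ π (x i) = v := by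
    intro u v h
    obtain ⟨s, hs⟩ := exists_tm hx.1 (π.symm u)
    obtain ⟨t, ht⟩ := exists_tm hx.1 (π.symm v)
    have : ev x s ⊓ ev x t ≤ x i := by
      rw [hs, ht, ← map_inf, ← h]; simp
    rcases hx.mirr.prime this with hh | hh
    · left
      rw [hs] at hh
      exact le_antisymm (h ▸ inf_le_left) ((π.symm_apply_le).1 hh)
    · right
      rw [ht] at hh
      exact le_antisymm (h ▸ inf_le_right) ((π.symm_apply_le).1 hh)
  obtain ⟨t, ht⟩ := exists_tm hx.1 (π (x i))
  induction t with
  | var j => exact ⟨j, ht.symm⟩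
  | sup s t hs ht' =>
    rcases h1 _ _ ht.symm with hh | hh
    · exact hs hh.symm
    · exact ht' hh.symm
  | inf s t hs ht' =>
    rcases h2 _ _ ht.symm with hh | hh
    · exact hs hh.symm
    · exact ht' hh.symm

theorem IsFreelyGenerated.exists_aut (hx : IsFreelyGenerated.{_, _, w} x) (σ : Equiv.Perm ι) :
    ∃ π : F ≃o F, ∀ t : Tm ι, π (ev x t) = ev (fun i => x (σ i)) t := by
  obtain ⟨φ, hφ⟩ := hx.hom (fun i => x (σ i))
  obtain ⟨ψ, hψ⟩ := hx.hom (fun i => x (σ.symm i))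
  have h1 : ∀ z, ψ (φ z) = z := by
    intro z
    obtain ⟨t, rfl⟩ := exists_tm hx.1 z
    rw [map_ev, map_ev]
    exact ev_congr _ _ _ fun i _ => by simp [hφ, hψ]
  have h2 : ∀ z, φ (ψ z) = z := by
    intro z
    obtain ⟨t, rfl⟩ := exists_tm hx.1 z
    rw [map_ev, map_ev]
    exact ev_congr _ _ _ fun i _ => by simp [hφ, hψ]
  refine ⟨⟨⟨φ, ψ, h1, h2⟩, ?_⟩, ?_⟩
  · intro a b
    refine ⟨fun h => ?_, fun h => OrderHomClass.mono φ h⟩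
    have := OrderHomClass.mono ψ h
    simpa [h1] using this
  · intro t
    change φ (ev x t) = _
    rw [map_ev]
    exact ev_congr _ _ _ fun i _ => hφ i

end Irr

/-! ### Infinitely many free elements over three (Whitman) -/

/-- Abbreviations for the three variables. -/
def vx : Tm (Fin 3) := var 0
/-- Second variable. -/
def vy : Tm (Fin 3) := var 1
/-- Third variable. -/
def vz : Tm (Fin 3) := var 2

/-- Three of the four free terms over three variables. -/
def tabc : Fin 3 → Tm (Fin 3) :=
  ![inf (sup vx (inf vy vz)) (sup vz (inf vx vy)),
    sup (inf vx (sup vy vz)) (inf vy (sup vx vz)),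
    inf vz (sup vx vy)]

/-- The fourth free term. -/
def td : Tm (Fin 3) := sup vy (inf vx vz)

/-- The four terms. -/
def tq : Option (Fin 3) → Tm (Fin 3)
  | none => td
  | some i => tabc i

/-- Join of three terms. -/
def sup3 (g : Fin 3 → Tm (Fin 3)) : Tm (Fin 3) := sup (g 0) (sup (g 1) (g 2))

/-- Meet of three terms. -/
def inf3 (g : Fin 3 → Tm (Fin 3)) : Tm (Fin 3) := inf (g 0) (inf (g 1) (g 2))

/-- The iterated substitution. -/
def itr : ℕ → Tm (Fin 3) → Tm (Fin 3)
  | 0, t => t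
  | k + 1, t => bind tabc (itr k t)

/-- `d₀ ∨ d₁ ∨ ... ∨ φ^k t` -/
def eJ : ℕ → Tm (Fin 3) → Tm (Fin 3)
  | 0, t => t
  | k + 1, t => sup td (bind tabc (eJ k t))

/-- `d₀ ∧ d₁ ∧ ... ∧ φ^k t` -/
def eM : ℕ → Tm (Fin 3) → Tm (Fin 3)
  | 0, t => t
  | k + 1, t => inf td (bind tabc (eM k t))

section Iter

variable {F : Type*} [Lattice F]

theorem jirr_of_le {α : Type*} {p : α → F} (r : α → F) (h1 : ∀ a b, b ≠ a → p b ≤ r a)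
    (h2 : ∀ a, ¬ p a ≤ r a) : JIrr p := fun a =>
  ⟨{v | v ≤ r a}, fun _ _ h h' => le_trans h h', fun _ h _ h' => sup_le h h', h1 a, h2 a⟩

theorem mirr_of_le {α : Type*} {p : α → F} (r : α → F) (h1 : ∀ a b, b ≠ a → r a ≤ p b)
    (h2 : ∀ a, ¬ r a ≤ p a) : MIrr p := fun a =>
  ⟨{v | r a ≤ v}, fun _ _ h h' => le_trans h' h, fun _ h _ h' => le_inf h h', h1 a, h2 a⟩

/-- the join of the other three -/
def tqJ : Option (Fin 3) → Tm (Fin 3)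
  | none => sup3 tabc
  | some 0 => sup td (sup (tabc 1) (tabc 2))
  | some 1 => sup td (sup (tabc 0) (tabc 2))
  | some 2 => sup td (sup (tabc 0) (tabc 1))

/-- the meet of the other three -/
def tqM : Option (Fin 3) → Tm (Fin 3)
  | none => inf3 tabc
  | some 0 => inf td (inf (tabc 1) (tabc 2))
  | some 1 => inf td (inf (tabc 0) (tabc 2))
  | some 2 => inf td (inf (tabc 0) (tabc 1))

set_option maxRecDepth 100000 in
set_option maxHeartbeats 4000000 in
theorem tqJ_wle : ∀ a, wle 30 (tq a) (tqJ a) = false := by decide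
set_option maxRecDepth 100000 in
set_option maxHeartbeats 4000000 in
theorem tqM_wle : ∀ a, wle 30 (tqM a) (tq a) = false := by decide

variable {X : Fin 3 → F}

theorem tq_jirr (hW : Whit F) (hJ : JIrr X) (hM : MIrr X) : JIrr (fun a => ev X (tq a)) := by
  refine jirr_of_le (fun a => ev X (tqJ a)) ?_ (fun a => not_le_of_wle hW hJ hM (tqJ_wle a))
  intro a b hab
  rcases a with _ | a
  · rcases b with _ | b
    · exact absurd rfl hab
    · fin_cases b
      · exact le_sup_left
      · exact le_sup_of_le_right le_sup_left
      · exact le_sup_of_le_right le_sup_right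
  · rcases b with _ | b
    · fin_cases a <;> exact le_sup_left
    · fin_cases a <;> fin_cases b <;> first
        | exact absurd rfl hab
        | exact le_sup_of_le_right le_sup_left
        | exact le_sup_of_le_right le_sup_right

theorem tq_mirr (hW : Whit F) (hJ : JIrr X) (hM : MIrr X) : MIrr (fun a => ev X (tq a)) := by
  refine mirr_of_le (fun a => ev X (tqM a)) ?_ (fun a => not_le_of_wle hW hJ hM (tqM_wle a))
  intro a b hab
  rcases a with _ | a
  · rcases b with _ | b
    · exact absurd rfl hab
    · fin_cases b
      · exact inf_le_left
      · exact inf_le_of_right_le inf_le_left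
      · exact inf_le_of_right_le inf_le_right
  · rcases b with _ | b
    · fin_cases a <;> exact inf_le_left
    · fin_cases a <;> fin_cases b <;> first
        | exact absurd rfl hab
        | exact inf_le_of_right_le inf_le_left
        | exact inf_le_of_right_le inf_le_right

theorem le_sup3 (g : Fin 3 → Tm (Fin 3)) (i : Fin 3) : ev X (g i) ≤ ev X (sup3 g) := by
  fin_cases i
  · exact le_sup_left
  · exact le_sup_of_le_right le_sup_left
  · exact le_sup_of_le_right le_sup_right

theorem inf3_le (g : Fin 3 → Tm (Fin 3)) (i : Fin 3) : ev X (inf3 g) ≤ ev X (g i) := by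
  fin_cases i
  · exact inf_le_left
  · exact inf_le_of_right_le inf_le_left
  · exact inf_le_of_right_le inf_le_right

theorem bind_le_sup3 (g : Fin 3 → Tm (Fin 3)) (t : Tm (Fin 3)) :
    ev X (bind g t) ≤ ev X (sup3 g) := by
  rw [ev_bind]
  exact Tm.ev_le _ _ _ fun a => le_sup3 g a

theorem inf3_le_bind (g : Fin 3 → Tm (Fin 3)) (t : Tm (Fin 3)) :
    ev X (inf3 g) ≤ ev X (bind g t) := by
  rw [ev_bind]
  exact Tm.le_ev _ _ _ fun a => inf3_le g a

theorem stepJ (hW : Whit F) (hJ : JIrr X) (hM : MIrr X) (s t : Tm (Fin 3))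
    (h : ev X (bind tabc s) ≤ ev X (sup td (bind tabc t))) : ev X s ≤ ev X t := by
  let y : Option (Fin 3) → F := fun o => o.elim (ev X (inf3 var)) X
  have key := ev_le_of_irr hW (tq_jirr hW hJ hM) (tq_mirr hW hJ hM) y
    (bind (fun i => var (some i)) s) (sup (var none) (bind (fun i => var (some i)) t))
  simp only [ev, ev_bind] at key h
  refine (key h).trans (sup_le ?_ le_rfl)
  exact Tm.le_ev _ _ _ fun a => inf3_le var a

theorem stepM (hW : Whit F) (hJ : JIrr X) (hM : MIrr X) (s t : Tm (Fin 3))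
    (h : ev X (inf td (bind tabc t)) ≤ ev X (bind tabc s)) : ev X t ≤ ev X s := by
  let y : Option (Fin 3) → F := fun o => o.elim (ev X (sup3 var)) X
  have key := ev_le_of_irr hW (tq_jirr hW hJ hM) (tq_mirr hW hJ hM) y
    (inf (var none) (bind (fun i => var (some i)) t)) (bind (fun i => var (some i)) s)
  simp only [ev, ev_bind] at key h
  refine le_trans (le_inf ?_ le_rfl) (key h)
  exact Tm.ev_le _ _ _ fun a => le_sup3 var a

theorem stepJ_iter (hW : Whit F) (hJ : JIrr X) (hM : MIrr X) (k : ℕ) (s t : Tm (Fin 3))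
    (h : ev X (itr k s) ≤ ev X (eJ k t)) : ev X s ≤ ev X t := by
  induction k with
  | zero => exact h
  | succ k ih => exact ih (stepJ hW hJ hM _ _ h)

theorem stepM_iter (hW : Whit F) (hJ : JIrr X) (hM : MIrr X) (k : ℕ) (s t : Tm (Fin 3))
    (h : ev X (eM k t) ≤ ev X (itr k s)) : ev X t ≤ ev X s := by
  induction k with
  | zero => exact h
  | succ k ih => exact ih (stepM hW hJ hM _ _ h)

theorem itr_le_eJ {j k : ℕ} (hjk : j ≠ k) (X : Fin 3 → F) :
    ev X (itr j td) ≤ ev X (eJ k (sup3 tabc)) := by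
  induction k generalizing X j with
  | zero =>
    obtain ⟨j, rfl⟩ := Nat.exists_eq_succ_of_ne_zero hjk
    exact bind_le_sup3 _ _
  | succ k ih =>
    cases j with
    | zero => exact le_sup_left
    | succ j =>
      refine le_sup_of_le_right ?_
      change ev X (bind tabc (itr j td)) ≤ ev X (bind tabc (eJ k (sup3 tabc)))
      rw [ev_bind, ev_bind]
      exact ih (by omega) _

theorem eM_le_itr {j k : ℕ} (hjk : j ≠ k) (X : Fin 3 → F) :
    ev X (eM k (inf3 tabc)) ≤ ev X (itr j td) := by
  induction k generalizing X j with
  | zero =>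
    obtain ⟨j, rfl⟩ := Nat.exists_eq_succ_of_ne_zero hjk
    exact inf3_le_bind _ _
  | succ k ih =>
    cases j with
    | zero => exact inf_le_left
    | succ j =>
      refine inf_le_of_right_le ?_
      change ev X (bind tabc (eM k (inf3 tabc))) ≤ ev X (bind tabc (itr j td))
      rw [ev_bind, ev_bind]
      exact ih (by omega) _

theorem itr_jirr (hW : Whit F) (hJ : JIrr X) (hM : MIrr X) : JIrr (fun k => ev X (itr k td)) := by
  refine jirr_of_le (fun k => ev X (eJ k (sup3 tabc))) (fun a b hb => itr_le_eJ hb X) ?_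
  intro k h
  exact not_le_of_wle hW hJ hM (tqJ_wle none) (stepJ_iter hW hJ hM k _ _ h)

theorem itr_mirr (hW : Whit F) (hJ : JIrr X) (hM : MIrr X) : MIrr (fun k => ev X (itr k td)) := by
  refine mirr_of_le (fun k => ev X (eM k (inf3 tabc))) (fun a b hb => eM_le_itr hb X) ?_
  intro k h
  exact not_le_of_wle hW hJ hM (tqM_wle none) (stepM_iter hW hJ hM k _ _ h)

end Iter

/-! ### Three symmetric free elements -/

/-- The six permutations of the variables. -/
def perms : List (Fin 3 → Fin 3) :=
  [![0, 1, 2], ![0, 2, 1], ![1, 0, 2], ![1, 2, 0], ![2, 0, 1], ![2, 1, 0]]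

/-- Renaming of variables. -/
def ren (τ : Fin 3 → Fin 3) (t : Tm (Fin 3)) : Tm (Fin 3) := bind (fun i => var (τ i)) t

/-- Symmetrization. -/
def symJ (t : Tm (Fin 3)) : Tm (Fin 3) := perms.foldr (fun τ r => sup (ren τ t) r) t

/-- The meet of six conjugates of `x ∨ (y ∧ (x ∨ z))`. -/
def tu : Fin 3 → Tm (Fin 3) :=
  ![inf (sup vx (inf vy (sup vx vz))) <| inf (sup vx (inf vz (sup vx vy))) <|
      inf (sup vy (inf vx (sup vy vz))) <| inf (sup vy (inf vz (sup vx vy))) <|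
      inf (sup vz (inf vx (sup vy vz))) (sup vz (inf vy (sup vx vz))),
    inf (sup vx (inf vy vz)) (sup vz (inf vx vy)),
    inf vx (sup vy vz)]

/-- the join of the other two -/
def tuJ : Fin 3 → Tm (Fin 3) :=
  ![sup (symJ (tu 1)) (symJ (tu 2)), sup (symJ (tu 0)) (symJ (tu 2)),
    sup (symJ (tu 0)) (symJ (tu 1))]

/-- the meet of the other two -/
def tuM : Fin 3 → Tm (Fin 3) :=
  ![inf (symJ (tu 1)) (symJ (tu 2)), inf (symJ (tu 0)) (symJ (tu 2)),
    inf (symJ (tu 0)) (symJ (tu 1))]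

set_option maxRecDepth 100000 in
set_option maxHeartbeats 4000000 in
theorem tuJ_wle : ∀ a, wle 60 (symJ (tu a)) (tuJ a) = false := by decide
set_option maxRecDepth 100000 in
set_option maxHeartbeats 4000000 in
theorem tuM_wle : ∀ a, wle 60 (tuM a) (symJ (tu a)) = false := by decide

set_option maxRecDepth 100000 in
set_option maxHeartbeats 4000000 in
theorem perms_ext : ∀ g : Fin 3 → Option (Fin 3),
    (∀ a b, g a = g b → g a = none ∨ a = b) →
      ∃ τ ∈ perms, ∀ a, g a = none ∨ g a = some (τ a) := by
  decide

theorem le_symJ {F : Type*} [Lattice F] (X : Fin 3 → F) (t : Tm (Fin 3)) {τ : Fin 3 → Fin 3}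
    (hτ : τ ∈ perms) : ev (fun i => X (τ i)) t ≤ ev X (symJ t) := by
  have h : ev (fun i => X (τ i)) t = ev X (ren τ t) := by
    rw [ren, ev_bind]; rfl
  rw [h, symJ]
  generalize perms = l at hτ
  induction l with
  | nil => simp at hτ
  | cons σ l ih =>
    rcases List.mem_cons.1 hτ with rfl | hh
    · exact le_sup_left
    · exact le_sup_of_le_right (ih hh)

theorem symJ_le {F : Type*} [Lattice F] (X : Fin 3 → F) (t : Tm (Fin 3)) (z : F)
    (h0 : ev X t ≤ z) (h : ∀ τ ∈ perms, ev (fun i => X (τ i)) t ≤ z) : ev X (symJ t) ≤ z := by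
  rw [symJ]
  generalize perms = l at h
  induction l with
  | nil => exact h0
  | cons σ l ih =>
    refine sup_le ?_ (ih fun τ hτ => h τ (List.mem_cons_of_mem _ hτ))
    rw [ren, ev_bind]
    exact h σ List.mem_cons_self

set_option maxRecDepth 100000 in
set_option maxHeartbeats 4000000 in
theorem perms_inj : ∀ τ ∈ perms, Function.Injective τ := by
  decide

section Sym

variable {F ι : Type*} [Lattice F] {x : ι → F}

/-- There are three irredundant symmetric elements. -/
theorem IsFreelyGenerated.exists_sym (hx : IsFreelyGenerated.{_, _, w} x) [Finite ι]
    (e : Fin 3 ↪ ι) :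
    ∃ P : Fin 3 → F, JIrr P ∧ MIrr P ∧ ∀ π : F ≃o F, ∀ a, π (P a) = P a := by
  classical
  have := Fintype.ofFinite ι
  have := Fintype.ofFinite (Fin 3 ↪ ι)
  have hne : (Finset.univ : Finset (Fin 3 ↪ ι)).Nonempty := ⟨e, Finset.mem_univ _⟩
  let P : Fin 3 → F := fun a => Finset.univ.sup' hne fun f : Fin 3 ↪ ι => ev (fun i => x (f i)) (tu a)
  let X : Fin 3 → F := fun i => x (e i)
  have hJ : JIrr X := hx.jirr.comp e.injective
  have hM : MIrr X := hx.mirr.comp e.injective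
  obtain ⟨φ, hφ⟩ := hx.hom
    (fun i => (Function.partialInv e i).elim (ev X (inf3 var)) X)
  have hφe : ∀ i, φ (x (e i)) = X i := by
    intro i
    rw [hφ, Function.partialInv_left e.injective]
    rfl
  have hP : ∀ a, φ (P a) = ev X (symJ (tu a)) := by
    intro a
    simp only [P]
    rw [map_finset_sup']
    apply le_antisymm
    · apply Finset.sup'_le
      intro f _
      simp only [Function.comp]
      rw [map_ev]
      obtain ⟨τ, hτ, hτ'⟩ := perms_ext (fun i => Function.partialInv e (f i)) (by
        intro i j hij
        rcases h : Function.partialInv e (f i) with _ | c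
        · exact Or.inl rfl
        · right
          have h1 := (Function.Injective.isPartialInv e.injective c (f i)).1 h
          have h2 := (Function.Injective.isPartialInv e.injective c (f j)).1 (hij ▸ h)
          exact f.injective (h1.symm.trans h2))
      refine le_trans (ev_mono _ _ (fun i => ?_) _) (le_symJ X (tu a) hτ)
      rw [hφ]
      rcases hτ' i with h | h
      · rw [h]
        exact inf3_le var _
      · rw [h]
        rfl
    · have key : ∀ τ : Fin 3 → Fin 3, Function.Injective τ → ev (fun i => X (τ i)) (tu a) ≤
          Finset.univ.sup' hne (φ ∘ fun f : Fin 3 ↪ ι => ev (fun i => x (f i)) (tu a)) := by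
        intro τ hτ
        refine le_trans ?_ (Finset.le_sup' _ (Finset.mem_univ ((⟨τ, hτ⟩ : Fin 3 ↪ Fin 3).trans e)))
        simp only [Function.comp]
        rw [map_ev]
        refine ev_mono _ _ (fun i => ?_) _
        exact (hφe (τ i)).ge
      exact symJ_le _ _ _ (key id Function.injective_id) fun τ hτ => key τ (perms_inj τ hτ)
  have hW := hx.whit
  refine ⟨P, ?_, ?_, ?_⟩
  · intro a
    refine ⟨{v | φ v ≤ ev X (tuJ a)}, ?_, ?_, ?_, ?_⟩
    · exact fun u v h h' => (OrderHomClass.mono φ h).trans h'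
    · intro u hu v hv
      change φ (u ⊔ v) ≤ _
      rw [map_sup]
      exact sup_le hu hv
    · intro b hb
      change φ (P b) ≤ _
      rw [hP]
      fin_cases a <;> fin_cases b <;> first
        | exact absurd rfl hb
        | exact le_sup_left
        | exact le_sup_right
    · change ¬ φ (P a) ≤ _
      rw [hP]
      exact not_le_of_wle hW hJ hM (tuJ_wle a)
  · intro a
    refine ⟨{v | ev X (tuM a) ≤ φ v}, ?_, ?_, ?_, ?_⟩
    · exact fun u v h h' => le_trans h' (OrderHomClass.mono φ h)
    · intro u hu v hv
      change _ ≤ φ (u ⊓ v)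
      rw [map_inf]
      exact le_inf hu hv
    · intro b hb
      change _ ≤ φ (P b)
      rw [hP]
      fin_cases a <;> fin_cases b <;> first
        | exact absurd rfl hb
        | exact inf_le_left
        | exact inf_le_right
    · change ¬ _ ≤ φ (P a)
      rw [hP]
      exact not_le_of_wle hW hJ hM (tuM_wle a)
  · have hle : ∀ π : F ≃o F, ∀ a, π (P a) ≤ P a := by
      intro π a
      choose σ hσ using hx.aut π
      have hσi : Function.Injective σ := by
        intro i j hij
        apply hx.injective
        apply π.injective
        rw [hσ, hσ, hij]
      simp only [P]
      rw [map_finset_sup']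
      apply Finset.sup'_le
      intro f _
      simp only [Function.comp]
      refine le_trans ?_ (Finset.le_sup' _ (Finset.mem_univ (f.trans ⟨σ, hσi⟩)))
      refine le_trans (map_ev (π : LatticeHom F F) _ _).le ?_
      exact ev_mono _ _ (fun i => (hσ (f i)).le) _
    intro π a
    refine le_antisymm (hle π a) ?_
    have := hle π.symm a
    exact (π.symm_apply_le).1 this

end Sym

theorem exists_perm_avoid {ι : Type*} (V : Set ι) (hV : Vᶜ.Infinite) (A : Finset ι) :
    ∃ σ : Equiv.Perm ι, ∀ a ∈ A, σ a ∉ V := by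
  classical
  induction A using Finset.induction_on with
  | empty => exact ⟨1, by simp⟩
  | insert a A ha ih =>
    obtain ⟨σ, hσ⟩ := ih
    by_cases h : σ a ∈ V
    · obtain ⟨c, hc, hc'⟩ := hV.exists_notMem_finset (A.image σ)
      refine ⟨σ.trans (Equiv.swap (σ a) c), ?_⟩
      intro b hb
      rcases Finset.mem_insert.1 hb with rfl | hb
      · simpa using hc
      · have h1 : σ b ≠ σ a := fun hh => ha (σ.injective hh ▸ hb)
        have h2 : σ b ≠ c := fun hh => hc' (hh ▸ Finset.mem_image_of_mem σ hb)
        simpa [Equiv.swap_apply_of_ne_of_ne h1 h2] using hσ b hb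
    · refine ⟨σ, fun b hb => ?_⟩
      rcases Finset.mem_insert.1 hb with rfl | hb
      · exact h
      · exact hσ b hb

theorem symmetric_range_embedding_iff {κ lam : Cardinal.{u}}
    (hκ : 3 ≤ κ) (hlam : 3 ≤ lam)
    {F : Type*} [Lattice F] {ι : Type u} (x : ι → F) (hx : IsFreelyGenerated x)
    (hι : #ι = lam)
    {G : Type*} [Lattice G] {ρ : Type u} (y : ρ → G) (hy : IsFreelyGenerated y)
    (hρ : #ρ = κ) :
    (∃ φ : LatticeHom G F, Function.Injective φ ∧ SymmetricSubset (Set.range ⇑φ)) ↔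
      ((lam < ℵ₀ ∧ κ ≤ ℵ₀) ∨ (κ = lam ∧ ℵ₀ ≤ κ)) := by
  subst hι hρ
  constructor
  · rintro ⟨φ, hφ, hS⟩
    choose τ hτ using exists_tm hx.1
    have hτi : Function.Injective (fun r => τ (φ (y r))) := by
      intro r r' h
      apply hy.injective
      apply hφ
      have := congrArg (ev x) h
      simpa [hτ] using this
    have hle : #ρ ≤ max #ι ℵ₀ := (mk_le_of_injective hτi).trans Tm.card_le
    rcases lt_or_ge #ι ℵ₀ with hl | hl
    · left
      rw [max_eq_right hl.le] at hle
      exact ⟨hl, hle⟩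
    · right
      rw [max_eq_left hl] at hle
      suffices h : #ι ≤ #ρ from ⟨le_antisymm hle h, hl.trans h⟩
      by_contra! hlt
      have hρ0 : Nonempty ρ := by
        rw [← mk_ne_zero_iff]
        intro h0
        rw [h0] at hκ
        simp at hκ
      obtain ⟨r0⟩ := hρ0
      let V : Set ι := ⋃ r, (τ (φ (y r))).vars
      have hV : #V < #ι := by
        rcases lt_or_ge #ρ ℵ₀ with hf | hf
        · have : Finite ρ := lt_aleph0_iff_finite.1 hf
          have : V.Finite := Set.finite_iUnion fun r => Tm.vars_finite _
          exact (lt_aleph0_iff_set_finite.2 this).trans_le hl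
        · refine lt_of_le_of_lt ?_ hlt
          refine (mk_iUnion_le _).trans ?_
          refine (mul_le_mul_right (ciSup_le' fun r =>
            (lt_aleph0_iff_set_finite.2 (Tm.vars_finite (τ (φ (y r))))).le) _).trans ?_
          rw [mul_aleph0_eq hf]
      have hVc : Vᶜ.Infinite := by
        have : Infinite ι := infinite_iff.2 hl
        have h := mk_compl_of_infinite V hV
        rw [← Set.infinite_coe_iff, infinite_iff, h]
        exact hl
      obtain ⟨σ, hσ⟩ := exists_perm_avoid V hVc (Tm.vars_finite (τ (φ (y r0)))).toFinset
      obtain ⟨π, hπ⟩ := hx.exists_aut σ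
      obtain ⟨ψ, hψ⟩ := hx.hom (fun i => i ∈ V)
      have h1 : ∀ g, ψ (φ g) = True := by
        intro g
        obtain ⟨t, rfl⟩ := exists_tm hy.1 g
        rw [map_ev, map_ev]
        apply ev_const
        intro r _
        rw [← hτ (φ (y r)), map_ev]
        apply ev_const
        intro i hi
        rw [hψ]
        exact eq_true (Set.mem_iUnion.2 ⟨r, hi⟩)
      have h2 : ψ (π (φ (y r0))) = False := by
        rw [← hτ (φ (y r0)), hπ, map_ev]
        apply ev_const
        intro i hi
        rw [hψ]
        exact eq_false (hσ i (by simpa using hi))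
      have h3 : π (φ (y r0)) ∈ Set.range φ := by
        rw [← hS π]
        exact ⟨_, ⟨_, rfl⟩, rfl⟩
      obtain ⟨g, hg⟩ := h3
      rw [← hg, h1] at h2
      exact true_ne_false h2
  · rintro (⟨h1, h2⟩ | ⟨h1, h2⟩)
    · have : Finite ι := lt_aleph0_iff_finite.1 h1
      have : Countable ρ := mk_le_aleph0_iff.1 h2
      obtain ⟨j, hj⟩ := exists_injective_nat ρ
      have he : Nonempty (Fin 3 ↪ ι) := by
        rw [← lift_mk_le']
        simpa using hlam
      obtain ⟨e⟩ := he
      obtain ⟨P, hJ, hM, hP⟩ := hx.exists_sym e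
      have hW := hx.whit
      obtain ⟨φ, hφ⟩ := hy.hom (fun r => ev P (itr (j r) td))
      have hJ' := (itr_jirr hW hJ hM).comp hj
      have hM' := (itr_mirr hW hJ hM).comp hj
      have hfix : ∀ π : F ≃o F, ∀ g, π (φ g) = φ g := by
        intro π g
        obtain ⟨t, rfl⟩ := exists_tm hy.1 g
        rw [map_ev]
        refine (map_ev (π : LatticeHom F F) _ _).trans ?_
        apply ev_congr
        intro r _
        rw [hφ]
        refine (map_ev (π : LatticeHom F F) _ _).trans ?_
        apply ev_congr
        intro a _
        exact hP π a
      refine ⟨φ, ?_, ?_⟩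
      · intro g g' h
        obtain ⟨s, rfl⟩ := exists_tm hy.1 g
        obtain ⟨t, rfl⟩ := exists_tm hy.1 g'
        rw [map_ev, map_ev] at h
        simp only [hφ] at h
        exact le_antisymm (ev_le_of_irr hW hJ' hM' y s t h.le) (ev_le_of_irr hW hJ' hM' y t s h.ge)
      · intro π
        ext z
        constructor
        · rintro ⟨_, ⟨g, rfl⟩, rfl⟩
          exact ⟨g, (hfix π g).symm⟩
        · rintro ⟨g, rfl⟩
          exact ⟨φ g, ⟨g, rfl⟩, hfix π g⟩
    · obtain ⟨e⟩ := Cardinal.eq.1 h1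
      obtain ⟨φ, hφ⟩ := hy.hom (fun r => x (e r))
      obtain ⟨ψ, hψ⟩ := hx.hom (fun i => y (e.symm i))
      have h3 : ∀ z, ψ (φ z) = z := by
        intro z
        obtain ⟨t, rfl⟩ := exists_tm hy.1 z
        rw [map_ev, map_ev]
        exact ev_congr _ _ _ fun i _ => by simp [hφ, hψ]
      have h4 : ∀ z, φ (ψ z) = z := by
        intro z
        obtain ⟨t, rfl⟩ := exists_tm hx.1 z
        rw [map_ev, map_ev]
        exact ev_congr _ _ _ fun i _ => by simp [hφ, hψ]
      refine ⟨φ, Function.LeftInverse.injective h3, fun π => ?_⟩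
      rw [(Function.RightInverse.surjective h4).range_eq, Set.image_univ, π.surjective.range_eq]
end
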